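/- Fix d ∈ ℤ₊ and a smooth even function η : ℝ → [0, 1] with 1_{[−1/4, 1/4]} ≤ η ≤ 1_{(−1/2, 1/2)}. For every p ∈ (1, ∞), all parameters C₁, C₂ ∈ ℝ₊, and every ρ ∈ (0, 1), there exist D_p ∈ ℝ₊ and a constant C ∈ ℝ₊ (both possibly depending on p, ρ, C₁, C₂, d) such that for all δ ∈ (0, 1] and all integers N > D_p δ^{−D_p}, and every f ∈ ℓ^p(ℤ) ∩ ℓ²(ℤ): ‖ Π[≤ δ^{−C₁}, ≤ N^{−d} δ^{−C₂}] f ‖_{ℓ^p(ℤ)} ≤ C δ^{−C₁ ρ} ‖f‖_{ℓ^p(ℤ)}. -/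

import Mathlib

open MeasureTheory Filter
open scoped ENNReal Real

/-- `e(x) = e^{2πix}`. -/
noncomputable def e2pi (x : ℝ) : ℂ := Complex.exp (2 * Real.pi * Complex.I * x)

/-- The `ℓ^p(ℤ)` norm `( ∑_{x ∈ ℤ} ‖g x‖^p )^{1/p}`, valued in `ℝ≥0∞`. -/
noncomputable def lpNormZ (p : ℝ) (g : ℤ → ℂ) : ℝ≥0∞ :=
  (∑' x : ℤ, (‖g x‖₊ : ℝ≥0∞) ^ p) ^ (1 / p)

/-- The set of canonical fractions `R_{≤Q}`, encoded as the finset of pairs `(a, q)`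
with `1 ≤ q ≤ Q`, `0 ≤ a < q` and `gcd(a, q) = 1` (the fraction being `a/q`). -/
noncomputable def canonicalFractions (Q : ℝ) : Finset (ℕ × ℕ) :=
  (Finset.range (⌊Q⌋₊ + 1) ×ˢ Finset.Icc 1 ⌊Q⌋₊).filter
    (fun aq => aq.1 < aq.2 ∧ Nat.gcd aq.1 aq.2 = 1)

/-- The Ionescu–Wainger multiplier symbol
`ξ ↦ ∑_{θ ∈ R_{≤N₁}} η (N₂⁻¹ (ξ - θ))`, where `ξ - θ` is evaluated on the real
representative of minimal absolute value (so the symbol is `1`-periodic). -/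
noncomputable def iwSymbol (η : ℝ → ℝ) (N₁ N₂ : ℝ) (ξ : ℝ) : ℝ :=
  ∑ aq ∈ canonicalFractions N₁,
    η (N₂⁻¹ * ((ξ - (aq.1 : ℝ) / aq.2) - round (ξ - (aq.1 : ℝ) / aq.2)))

/-- The convolution kernel of the Ionescu–Wainger projection `Π[≤N₁, ≤N₂]`:
the Fourier coefficients of its symbol. -/
noncomputable def iwKernel (η : ℝ → ℝ) (N₁ N₂ : ℝ) (m : ℤ) : ℂ :=
  ∫ ξ in Set.Ioc (0 : ℝ) 1, (iwSymbol η N₁ N₂ ξ : ℂ) * e2pi (-(ξ * m))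

/-- The Ionescu–Wainger projection `Π[≤N₁, ≤N₂]`, the Fourier multiplier operator on
`ℓ²(ℤ)` with symbol `iwSymbol η N₁ N₂`, realized as convolution with its kernel. -/
noncomputable def iwProj (η : ℝ → ℝ) (N₁ N₂ : ℝ) (f : ℤ → ℂ) (x : ℤ) : ℂ :=
  ∑' y : ℤ, iwKernel η N₁ N₂ y * f (x - y)

/-! ### A noise inequality on finite commutative rings -/

lemma add_pow_le_quadratic (s : ℕ) (a b : ℝ) (ha : 0 ≤ a) (hab : 0 ≤ a + b) (hb : b ≤ 3 * a) :
    (a + b) ^ (s + 2) ≤ a ^ (s + 2) + (s + 2) * a ^ (s + 1) * b + 5 ^ (s + 2) * a ^ s * b ^ 2 := by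
  induction s with
  | zero => norm_num; nlinarith [sq_nonneg b]
  | succ s ih =>
    have h1 := mul_le_mul_of_nonneg_right ih hab
    have h2 : (5 : ℝ) ^ (s + 2) * a ^ s * b ^ 2 * (a + b) ≤ 5 ^ (s + 2) * a ^ s * b ^ 2 * (4 * a) :=
      mul_le_mul_of_nonneg_left (by linarith) (by positivity)
    have h3 : ((s : ℝ) + 2) * (a ^ (s + 1) * b ^ 2) ≤ 5 ^ (s + 2) * (a ^ (s + 1) * b ^ 2) := by
      apply mul_le_mul_of_nonneg_right _ (by positivity)
      have : s + 2 < 5 ^ (s + 2) := Nat.lt_pow_self (by norm_num)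
      exact_mod_cast this.le
    push_cast
    calc (a + b) ^ (s + 1 + 2) = (a + b) ^ (s + 2) * (a + b) := by ring
      _ ≤ _ := h1
      _ ≤ _ := by
        ring_nf at h2 h3 ⊢
        linarith

lemma norm_add_pow_le {E : Type*} [NormedAddCommGroup E] [InnerProductSpace ℂ E] (s : ℕ)
    (v w : E) :
    ‖v + w‖ ^ (2 * (s + 2)) ≤ ‖v‖ ^ (2 * (s + 2))
      + 2 * (s + 2) * ‖v‖ ^ (2 * (s + 1)) * (inner ℂ v w).re
      + 20 * 5 ^ (s + 2) * (‖v‖ ^ (2 * (s + 1)) * ‖w‖ ^ 2 + ‖w‖ ^ (2 * (s + 2))) := by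
  have hT : ‖v + w‖ ^ 2 = ‖v‖ ^ 2 + 2 * (inner ℂ v w).re + ‖w‖ ^ 2 := by
    simpa using @norm_add_sq ℂ E _ _ _ v w
  have hip : |(inner ℂ v w).re| ≤ ‖v‖ * ‖w‖ :=
    (Complex.abs_re_le_norm _).trans (norm_inner_le_norm v w)
  set A := ‖v‖
  set B := ‖w‖
  set i := (inner ℂ v w).re
  have hA : 0 ≤ A := norm_nonneg _
  have hB : 0 ≤ B := norm_nonneg _
  obtain ⟨hi1, hi2⟩ := abs_le.1 hip
  have hs : ((s : ℝ) + 2) ≤ 5 ^ (s + 2) := by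
    have : s + 2 < 5 ^ (s + 2) := Nat.lt_pow_self (by norm_num)
    exact_mod_cast this.le
  rw [pow_mul ‖v + w‖, hT]
  rcases le_total B A with h | h
  · have h1 := add_pow_le_quadratic s (A ^ 2) (2 * i + B ^ 2) (by positivity)
      (by nlinarith) (by nlinarith)
    have h2 : (2 * i + B ^ 2) ^ 2 ≤ 9 * (A ^ 2 * B ^ 2) := by
      have : |2 * i + B ^ 2| ≤ 3 * (A * B) := by
        rw [abs_le]; constructor <;> nlinarith
      calc (2 * i + B ^ 2) ^ 2 = |2 * i + B ^ 2| ^ 2 := (sq_abs _).symm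
        _ ≤ (3 * (A * B)) ^ 2 := by gcongr
        _ = _ := by ring
    have h3 : (5 : ℝ) ^ (s + 2) * (A ^ 2) ^ s * (2 * i + B ^ 2) ^ 2
        ≤ 5 ^ (s + 2) * (A ^ 2) ^ s * (9 * (A ^ 2 * B ^ 2)) := by gcongr
    have h4 : ((s : ℝ) + 2) * (A ^ (2 * (s + 1)) * B ^ 2)
        ≤ 5 ^ (s + 2) * (A ^ (2 * (s + 1)) * B ^ 2) := by gcongr
    have h5 : (0 : ℝ) ≤ 5 ^ (s + 2) * (A ^ (2 * (s + 1)) * B ^ 2) := by positivity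
    have h6 : (0 : ℝ) ≤ 5 ^ (s + 2) * B ^ (2 * (s + 2)) := by positivity
    calc _ = (A ^ 2 + (2 * i + B ^ 2)) ^ (s + 2) := by ring
      _ ≤ _ := h1
      _ ≤ _ := by
        ring_nf at h3 h4 h5 h6 ⊢
        nlinarith
  · have h1 : (A ^ 2 + 2 * i + B ^ 2) ^ (s + 2) ≤ (4 * B ^ 2) ^ (s + 2) := by
      apply pow_le_pow_left₀
      · nlinarith
      · nlinarith
    have h2 : (4 * B ^ 2) ^ (s + 2) ≤ 5 ^ (s + 2) * B ^ (2 * (s + 2)) := by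
      rw [mul_pow, ← pow_mul]; gcongr; norm_num
    have h3 : -(2 * ((s : ℝ) + 2) * A ^ (2 * (s + 1)) * i) ≤ 2 * 5 ^ (s + 2) * B ^ (2 * (s + 2)) := by
      calc -(2 * ((s : ℝ) + 2) * A ^ (2 * (s + 1)) * i)
          = 2 * ((s : ℝ) + 2) * A ^ (2 * (s + 1)) * (-i) := by ring
        _ ≤ 2 * ((s : ℝ) + 2) * A ^ (2 * (s + 1)) * (A * B) := by
          gcongr; linarith
        _ ≤ 2 * 5 ^ (s + 2) * B ^ (2 * (s + 1)) * (B * B) := by gcongr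
        _ = _ := by ring
    have h5 : (0 : ℝ) ≤ 5 ^ (s + 2) * (A ^ (2 * (s + 1)) * B ^ 2) := by positivity
    have h6 : (0 : ℝ) ≤ 5 ^ (s + 2) * B ^ (2 * (s + 2)) := by positivity
    have h7 : (0 : ℝ) ≤ A ^ (2 * (s + 2)) := by positivity
    linarith

lemma sum_mul_pow_le {ι : Type*} (S : Finset ι) (c y : ι → ℝ) (κ : ℝ) (hc : ∀ a ∈ S, 0 ≤ c a)
    (hκ : ∑ a ∈ S, c a ≤ κ) (hy : ∀ a ∈ S, 0 ≤ y a) (n : ℕ) (hn : n ≠ 0) :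
    (∑ a ∈ S, c a * y a) ^ n ≤ κ ^ n * ∑ a ∈ S, y a ^ n := by
  rcases S.eq_empty_or_nonempty with rfl | hS
  · simp [hn]
  obtain ⟨a₀, ha₀, hmax⟩ := Finset.exists_max_image S y hS
  have hκ0 : 0 ≤ κ := (Finset.sum_nonneg hc).trans hκ
  have h1 : ∑ a ∈ S, c a * y a ≤ κ * y a₀ := by
    calc _ ≤ ∑ a ∈ S, c a * y a₀ :=
          Finset.sum_le_sum fun a ha => mul_le_mul_of_nonneg_left (hmax a ha) (hc a ha)
      _ = (∑ a ∈ S, c a) * y a₀ := by rw [Finset.sum_mul]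
      _ ≤ _ := mul_le_mul_of_nonneg_right hκ (hy _ ha₀)
  calc _ ≤ (κ * y a₀) ^ n :=
        pow_le_pow_left₀ (Finset.sum_nonneg fun a ha => mul_nonneg (hc a ha) (hy a ha)) h1 n
    _ = κ ^ n * y a₀ ^ n := mul_pow _ _ _
    _ ≤ _ := by
      gcongr
      exact Finset.single_le_sum (f := fun a => y a ^ n) (fun a ha => pow_nonneg (hy a ha) n) ha₀

lemma sum_norm_add_pow_le {E X ι : Type*} [NormedAddCommGroup E] [InnerProductSpace ℂ E]
    [Fintype X] [Nonempty X] (s : ℕ) (S : Finset ι) (c : ι → ℝ) (κ : ℝ) (hc : ∀ a ∈ S, 0 ≤ c a)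
    (hκ : ∑ a ∈ S, c a ≤ κ) (hκ1 : 20 * 5 ^ (s + 2) * κ ^ 2 ≤ 1)
    (v : E) (w : ι → X → E) (hw : ∀ a ∈ S, ∑ x, w a x = 0) (Y : ℝ)
    (hY : ∑ x, ∑ a ∈ S, ‖w a x‖ ^ 2 = Fintype.card X * Y) :
    ∑ x, ‖v + ∑ a ∈ S, (c a : ℂ) • w a x‖ ^ (2 * (s + 2)) ≤
      Fintype.card X * (‖v‖ ^ 2 + Y) ^ (s + 2)
        + ∑ a ∈ S, ∑ x, ‖w a x‖ ^ (2 * (s + 2)) := by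
  have hκ0 : 0 ≤ κ := (Finset.sum_nonneg hc).trans hκ
  have hcard : (0 : ℝ) < Fintype.card X := by exact_mod_cast Fintype.card_pos
  have hY0 : 0 ≤ Y := by
    have : 0 ≤ (Fintype.card X : ℝ) * Y := by rw [← hY]; positivity
    exact nonneg_of_mul_nonneg_right this hcard
  set W : X → E := fun x => ∑ a ∈ S, (c a : ℂ) • w a x with hW
  have hWsum : ∑ x, W x = 0 := by
    rw [hW, Finset.sum_comm]
    refine Finset.sum_eq_zero fun a ha => ?_
    rw [← Finset.smul_sum, hw a ha, smul_zero]
  have hWn : ∀ x, ‖W x‖ ≤ ∑ a ∈ S, c a * ‖w a x‖ := fun x => by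
    refine (norm_sum_le _ _).trans (Finset.sum_le_sum fun a ha => ?_)
    rw [norm_smul]
    simp [abs_of_nonneg (hc a ha)]
  have hpow : ∀ x n, n ≠ 0 → ‖W x‖ ^ n ≤ κ ^ n * ∑ a ∈ S, ‖w a x‖ ^ n := fun x n hn =>
    (pow_le_pow_left₀ (norm_nonneg _) (hWn x) n).trans
      (sum_mul_pow_le S c _ κ hc hκ (fun a _ => norm_nonneg _) n hn)
  set K : ℝ := 20 * 5 ^ (s + 2) with hK
  have hK1 : 1 ≤ K := by
    have : (1 : ℝ) ≤ 5 ^ (s + 2) := one_le_pow₀ (by norm_num)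
    linarith
  have hκle : κ ≤ 1 := by
    by_contra hh; push Not at hh; nlinarith
  have hKκ : K * κ ^ (2 * (s + 2)) ≤ 1 := by
    refine le_trans (mul_le_mul_of_nonneg_left ?_ (by linarith)) hκ1
    exact pow_le_pow_of_le_one hκ0 hκle (by omega)
  have hpt : ∀ x, ‖v + W x‖ ^ (2 * (s + 2)) ≤ ‖v‖ ^ (2 * (s + 2))
      + 2 * (s + 2) * ‖v‖ ^ (2 * (s + 1)) * (inner ℂ v (W x)).re
      + ‖v‖ ^ (2 * (s + 1)) * (∑ a ∈ S, ‖w a x‖ ^ 2) + ∑ a ∈ S, ‖w a x‖ ^ (2 * (s + 2)) := by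
    intro x
    refine (norm_add_pow_le s v (W x)).trans ?_
    have h2 : K * (‖v‖ ^ (2 * (s + 1)) * ‖W x‖ ^ 2)
        ≤ ‖v‖ ^ (2 * (s + 1)) * (∑ a ∈ S, ‖w a x‖ ^ 2) := by
      calc _ ≤ K * (‖v‖ ^ (2 * (s + 1)) * (κ ^ 2 * ∑ a ∈ S, ‖w a x‖ ^ 2)) := by
            gcongr; exact hpow x 2 (by norm_num)
        _ = (K * κ ^ 2) * (‖v‖ ^ (2 * (s + 1)) * ∑ a ∈ S, ‖w a x‖ ^ 2) := by ring
        _ ≤ _ := mul_le_of_le_one_left (by positivity) hκ1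
    have h3 : K * ‖W x‖ ^ (2 * (s + 2)) ≤ ∑ a ∈ S, ‖w a x‖ ^ (2 * (s + 2)) := by
      calc _ ≤ K * (κ ^ (2 * (s + 2)) * ∑ a ∈ S, ‖w a x‖ ^ (2 * (s + 2))) := by
            gcongr; exact hpow x _ (by omega)
        _ = (K * κ ^ (2 * (s + 2))) * ∑ a ∈ S, ‖w a x‖ ^ (2 * (s + 2)) := by ring
        _ ≤ _ := mul_le_of_le_one_left (by positivity) hKκ
    linarith
  have hlin : ∑ x, (inner ℂ v (W x)).re = 0 := by
    rw [← Complex.re_sum, ← inner_sum, hWsum, inner_zero_right, Complex.zero_re]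
  calc _ ≤ ∑ x, (‖v‖ ^ (2 * (s + 2))
      + 2 * (s + 2) * ‖v‖ ^ (2 * (s + 1)) * (inner ℂ v (W x)).re
      + ‖v‖ ^ (2 * (s + 1)) * (∑ a ∈ S, ‖w a x‖ ^ 2) + ∑ a ∈ S, ‖w a x‖ ^ (2 * (s + 2))) :=
        Finset.sum_le_sum fun x _ => hpt x
    _ = Fintype.card X * (‖v‖ ^ (2 * (s + 2)) + ‖v‖ ^ (2 * (s + 1)) * Y)
        + ∑ a ∈ S, ∑ x, ‖w a x‖ ^ (2 * (s + 2)) := by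
      simp only [Finset.sum_add_distrib, ← Finset.mul_sum, hlin, hY]
      rw [Finset.sum_comm]
      simp; ring
    _ ≤ _ := by
      gcongr
      have h1 : ‖v‖ ^ (2 * (s + 1)) ≤ (‖v‖ ^ 2 + Y) ^ (s + 1) := by
        rw [pow_mul]; gcongr; linarith
      calc ‖v‖ ^ (2 * (s + 2)) + ‖v‖ ^ (2 * (s + 1)) * Y
          = ‖v‖ ^ (2 * (s + 1)) * (‖v‖ ^ 2 + Y) := by ring
        _ ≤ (‖v‖ ^ 2 + Y) ^ (s + 1) * (‖v‖ ^ 2 + Y) := by gcongr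
        _ = _ := by ring

lemma sum_norm_sq_addChar_sum {R : Type*} [CommRing R] [Fintype R] (ψ : AddChar R ℂ)
    (hψ : ψ.IsPrimitive) (A : Finset R) (g : R → ℂ) :
    ∑ x, ‖∑ α ∈ A, ψ (α * x) * g α‖ ^ 2 = Fintype.card R * ∑ α ∈ A, ‖g α‖ ^ 2 := by
  classical
  have key : ∀ α ∈ A, ∀ β ∈ A, ∑ x, ψ (α * x) * g α * (starRingEnd ℂ) (ψ (β * x) * g β)
      = if α = β then (Fintype.card R : ℂ) * (‖g α‖ ^ 2 : ℝ) else 0 := by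
    intro α _ β _
    have h1 : ∀ x, ψ (α * x) * g α * (starRingEnd ℂ) (ψ (β * x) * g β)
        = ψ (x * (α - β)) * (g α * (starRingEnd ℂ) (g β)) := by
      intro x
      rw [map_mul (starRingEnd ℂ), ← AddChar.map_neg_eq_conj,
        show x * (α - β) = α * x + -(β * x) by ring, AddChar.map_add_eq_mul]
      ring
    simp_rw [h1]
    rw [← Finset.sum_mul, AddChar.sum_mulShift _ hψ]
    by_cases h : α = β
    · subst h
      simp [Complex.mul_conj, Complex.normSq_eq_norm_sq]
    · simp [h, sub_eq_zero]
  have : ((∑ x, ‖∑ α ∈ A, ψ (α * x) * g α‖ ^ 2 : ℝ) : ℂ)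
      = ((Fintype.card R * ∑ α ∈ A, ‖g α‖ ^ 2 : ℝ) : ℂ) := by
    push_cast
    simp_rw [← Complex.ofReal_pow, ← Complex.normSq_eq_norm_sq, ← Complex.mul_conj, map_sum,
      Finset.sum_mul_sum]
    rw [Finset.sum_comm]
    rw [Finset.mul_sum]
    refine Finset.sum_congr rfl fun α hα => ?_
    rw [Finset.sum_comm, Finset.sum_congr rfl (fun β hβ => key α hα β hβ)]
    simp [hα, Complex.mul_conj, Complex.normSq_eq_norm_sq]
  exact_mod_cast this

/-- The `L`-th power of the reciprocal of the number of divisors. -/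
noncomputable def divisorWeight (L n : ℕ) : ℝ := ((n.divisors.card : ℝ) ^ L)⁻¹

lemma divisorWeight_mul (L : ℕ) {m n : ℕ} (h : m.Coprime n) :
    divisorWeight L (m * n) = divisorWeight L m * divisorWeight L n := by
  simp [divisorWeight, h.card_divisors_mul, mul_pow, mul_comm]

/-- A noise inequality for functions on a finite ring, expanded in additive characters: the
`2 * r`-th moment of the damped sum is controlled by mixed moments over the unitary parts of the
additive orders. -/
def NoiseBound (R : Type) [CommRing R] [Fintype R] (r L : ℕ) : Prop :=
  ∀ ψ : AddChar R ℂ, ψ.IsPrimitive → ∀ (J : Type) [Fintype J] (F : R → J → ℂ),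
    ∑ x, (∑ j, ‖∑ γ, ψ (γ * x) * ((divisorWeight L (addOrderOf γ) : ℂ) * F γ j)‖ ^ 2) ^ r ≤
      ∑ u ∈ (Fintype.card R).divisors, ∑ x, (∑ j, ∑ β with (addOrderOf β).Coprime u,
        ‖∑ α with addOrderOf α = u, ψ (α * x) * F (α + β) j‖ ^ 2) ^ r

lemma NoiseBound.of_card_eq_prime_pow {R : Type} [CommRing R] [Fintype R] (s L p k : ℕ)
    (hp : p.Prime) (hR : Fintype.card R = p ^ k)
    (hL : ∀ k : ℕ, 20 * 5 ^ (s + 2) * (∑ a ∈ Finset.Icc 1 k, (((a + 1 : ℕ) : ℝ) ^ L)⁻¹) ^ 2 ≤ 1) :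
    NoiseBound R (s + 2) L := by
  classical
  intro ψ hψ J _ F
  set v : EuclideanSpace ℂ J := WithLp.toLp 2 (F 0) with hv
  set w : ℕ → R → EuclideanSpace ℂ J := fun a x =>
    WithLp.toLp 2 (fun j => ∑ α with addOrderOf α = p ^ a, ψ (α * x) * F α j) with hw
  have hwn : ∀ a x, ‖w a x‖ ^ 2 = ∑ j, ‖∑ α with addOrderOf α = p ^ a, ψ (α * x) * F α j‖ ^ 2 :=
    fun a x => EuclideanSpace.norm_sq_eq _
  have hvn : ‖v‖ ^ 2 = ∑ j, ‖F 0 j‖ ^ 2 := EuclideanSpace.norm_sq_eq _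
  have hdw : ∀ a, divisorWeight L (p ^ a) = (((a + 1 : ℕ) : ℝ) ^ L)⁻¹ := by
    intro a
    simp [divisorWeight, Nat.divisors_prime_pow hp]
  have hrange : ∀ h : ℕ → ℝ, ∑ u ∈ (p ^ k).divisors, h u
      = h 1 + ∑ a ∈ Finset.Icc 1 k, h (p ^ a) := by
    intro h
    rw [Nat.divisors_prime_pow hp, Finset.sum_map, Finset.range_eq_Ico,
      Finset.sum_eq_sum_Ico_succ_bot (Nat.succ_pos k)]
    simp [← Finset.Ico_add_one_right_eq_Icc]
  have hrange' : ∀ h : ℕ → ℂ, ∑ u ∈ (p ^ k).divisors, h u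
      = h 1 + ∑ a ∈ Finset.Icc 1 k, h (p ^ a) := by
    intro h
    rw [Nat.divisors_prime_pow hp, Finset.sum_map, Finset.range_eq_Ico,
      Finset.sum_eq_sum_Ico_succ_bot (Nat.succ_pos k)]
    simp [← Finset.Ico_add_one_right_eq_Icc]
  have hone : (Finset.univ.filter fun γ : R => addOrderOf γ = 1) = {0} := by
    ext γ; simp
  have hmaps : ∀ γ ∈ (Finset.univ : Finset R), addOrderOf γ ∈ (p ^ k).divisors := fun γ _ => by
    rw [Nat.mem_divisors, ← hR]
    exact ⟨addOrderOf_dvd_card, Fintype.card_ne_zero⟩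
  have hsplit : ∀ g : R → ℂ, ∑ γ, g γ
      = g 0 + ∑ a ∈ Finset.Icc 1 k, ∑ γ with addOrderOf γ = p ^ a, g γ := by
    intro g
    rw [← Finset.sum_fiberwise_of_maps_to hmaps g, hrange', hone, Finset.sum_singleton]
  have hsplit' : ∀ g : R → ℝ, ∑ γ, g γ
      = g 0 + ∑ a ∈ Finset.Icc 1 k, ∑ γ with addOrderOf γ = p ^ a, g γ := by
    intro g
    rw [← Finset.sum_fiberwise_of_maps_to hmaps g, hrange, hone, Finset.sum_singleton]
  have hwsum : ∀ a ∈ Finset.Icc 1 k, ∑ x, w a x = 0 := by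
    intro a ha
    ext j
    simp only [hw, WithLp.ofLp_sum, Finset.sum_apply, PiLp.zero_apply]
    rw [Finset.sum_comm]
    refine Finset.sum_eq_zero fun α hα => ?_
    rw [← Finset.sum_mul]
    simp_rw [mul_comm α]
    have hα0 : α ≠ 0 := by
      rintro rfl
      simp only [Finset.mem_filter, addOrderOf_zero] at hα
      have := Nat.one_lt_pow (by have := (Finset.mem_Icc.1 ha).1; omega : a ≠ 0) hp.one_lt
      omega
    rw [AddChar.sum_mulShift _ hψ, if_neg hα0]
    simp
  have hY : ∑ x, ∑ a ∈ Finset.Icc 1 k, ‖w a x‖ ^ 2 = Fintype.card R *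
      (∑ j, ∑ a ∈ Finset.Icc 1 k, ∑ α with addOrderOf α = p ^ a, ‖F α j‖ ^ 2) := by
    simp_rw [hwn]
    rw [Finset.sum_comm, Finset.sum_comm (s := (Finset.univ : Finset J)), Finset.mul_sum]
    refine Finset.sum_congr rfl fun a _ => ?_
    rw [Finset.sum_comm, Finset.mul_sum]
    exact Finset.sum_congr rfl fun j _ => sum_norm_sq_addChar_sum ψ hψ _ _
  have main := sum_norm_add_pow_le s (Finset.Icc 1 k) (fun a => (((a + 1 : ℕ) : ℝ) ^ L)⁻¹) _
    (fun a _ => by positivity) le_rfl (hL k) v w hwsum _ hY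
  have hlhs : ∀ x, (∑ j, ‖∑ γ, ψ (γ * x) * ((divisorWeight L (addOrderOf γ) : ℂ) * F γ j)‖ ^ 2)
      ^ (s + 2) = ‖v + ∑ a ∈ Finset.Icc 1 k, (((((a + 1 : ℕ) : ℝ) ^ L)⁻¹ : ℝ) : ℂ) • w a x‖
        ^ (2 * (s + 2)) := by
    intro x
    rw [pow_mul, EuclideanSpace.norm_sq_eq]
    congr 1
    refine Finset.sum_congr rfl fun j _ => ?_
    congr 2
    rw [hsplit]
    simp only [hv, hw, PiLp.add_apply, WithLp.ofLp_sum, Finset.sum_apply, PiLp.smul_apply,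
      smul_eq_mul]
    congr 1
    · simp [divisorWeight]
    · refine Finset.sum_congr rfl fun a _ => ?_
      rw [Finset.mul_sum]
      refine Finset.sum_congr rfl fun γ hγ => ?_
      rw [(Finset.mem_filter.1 hγ).2, hdw]
      ring
  rw [Finset.sum_congr rfl fun x _ => hlhs x]
  refine main.trans ?_
  rw [hR, hrange]
  refine add_le_add (le_of_eq ?_) (Finset.sum_le_sum fun a ha => Finset.sum_le_sum fun x _ => ?_)
  · have h2 : ∀ x : R, (∑ j, ∑ β with (addOrderOf β).Coprime 1,
        ‖∑ α with addOrderOf α = 1, ψ (α * x) * F (α + β) j‖ ^ 2) =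
        ‖v‖ ^ 2 + ∑ j, ∑ a ∈ Finset.Icc 1 k, ∑ α with addOrderOf α = p ^ a, ‖F α j‖ ^ 2 := by
      intro x
      rw [hvn, ← Finset.sum_add_distrib]
      refine Finset.sum_congr rfl fun j _ => ?_
      rw [hone]
      simp only [Nat.coprime_one_right_eq_true, Finset.filter_true, Finset.sum_singleton, zero_mul,
        AddChar.map_zero_eq_one, one_mul, zero_add]
      rw [hsplit' fun γ => ‖F γ j‖ ^ 2]
    rw [Finset.sum_congr rfl fun (x : R) _ => congrArg (· ^ (s + 2)) (h2 x)]
    simp [hR]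
  · rw [pow_mul, hwn]
    refine pow_le_pow_left₀ (by positivity) (Finset.sum_le_sum fun j _ => ?_) _
    refine le_trans (le_of_eq ?_) (Finset.single_le_sum (f := fun β : R =>
      ‖∑ α with addOrderOf α = p ^ a, ψ (α * x) * F (α + β) j‖ ^ 2) (fun _ _ => by positivity)
      (Finset.mem_filter.2 ⟨Finset.mem_univ (0 : R), by simp⟩))
    simp

lemma NoiseBound.prod {R₁ R₂ : Type} [CommRing R₁] [Fintype R₁] [CommRing R₂] [Fintype R₂]
    {r L : ℕ} (h₁ : NoiseBound R₁ r L) (h₂ : NoiseBound R₂ r L)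
    (hc : (Fintype.card R₁).Coprime (Fintype.card R₂)) : NoiseBound (R₁ × R₂) r L := by
  classical
  intro ψ hψ J _ F
  set ψ₁ : AddChar R₁ ℂ := ψ.compAddMonoidHom (AddMonoidHom.inl R₁ R₂) with hψ₁
  set ψ₂ : AddChar R₂ ℂ := ψ.compAddMonoidHom (AddMonoidHom.inr R₁ R₂) with hψ₂
  have hψ₁' : ψ₁.IsPrimitive := by
    intro a ha h
    apply hψ (a := (a, 0)) (by simpa using ha)
    ext ⟨x, y⟩
    have := DFunLike.congr_fun h x
    simpa [hψ₁] using this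
  have hψ₂' : ψ₂.IsPrimitive := by
    intro a ha h
    apply hψ (a := (0, a)) (by simpa using ha)
    ext ⟨x, y⟩
    have := DFunLike.congr_fun h y
    simpa [hψ₂] using this
  have hmul : ∀ a b : R₁ × R₂, ψ (a * b) = ψ₁ (a.1 * b.1) * ψ₂ (a.2 * b.2) := by
    rintro ⟨a₁, a₂⟩ ⟨b₁, b₂⟩
    simp [hψ₁, hψ₂, ← AddChar.map_add_eq_mul]
  have hcop : ∀ (a : R₁) (b : R₂), (addOrderOf a).Coprime (addOrderOf b) := fun a b =>
    Nat.Coprime.of_dvd addOrderOf_dvd_card addOrderOf_dvd_card hc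
  have hord : ∀ a : R₁ × R₂, addOrderOf a = addOrderOf a.1 * addOrderOf a.2 := fun a => by
    rw [Prod.addOrderOf, (hcop _ _).lcm_eq_mul]
  have hdiv : ∀ h : ℕ → ℝ, ∑ u ∈ (Fintype.card (R₁ × R₂)).divisors, h u
      = ∑ u₁ ∈ (Fintype.card R₁).divisors, ∑ u₂ ∈ (Fintype.card R₂).divisors, h (u₁ * u₂) := by
    intro h
    rw [Fintype.card_prod, Nat.divisors_mul, ← Finset.image_mul_product,
      Finset.sum_image hc.mul_injOn_divisors, Finset.sum_product]
  rw [hdiv]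
  set P : R₁ → R₂ → ℝ := fun x₁ x₂ => (∑ j, ‖∑ γ₁, ψ₁ (γ₁ * x₁) *
    ((divisorWeight L (addOrderOf γ₁) : ℂ) * ∑ γ₂, ψ₂ (γ₂ * x₂) *
      ((divisorWeight L (addOrderOf γ₂) : ℂ) * F (γ₁, γ₂) j))‖ ^ 2) ^ r with hP
  have e1 : ∑ x, (∑ j, ‖∑ γ, ψ (γ * x) * ((divisorWeight L (addOrderOf γ) : ℂ) * F γ j)‖ ^ 2) ^ r
      = ∑ x₂, ∑ x₁, P x₁ x₂ := by
    rw [Fintype.sum_prod_type, Finset.sum_comm]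
    refine Finset.sum_congr rfl fun x₂ _ => Finset.sum_congr rfl fun x₁ _ => ?_
    simp only [hP]
    congr 1
    refine Finset.sum_congr rfl fun j _ => ?_
    congr 2
    rw [Fintype.sum_prod_type]
    refine Finset.sum_congr rfl fun γ₁ _ => ?_
    rw [Finset.mul_sum, Finset.mul_sum]
    refine Finset.sum_congr rfl fun γ₂ _ => ?_
    rw [hmul, hord, divisorWeight_mul _ (hcop _ _)]
    push_cast
    ring
  rw [e1]
  set G : R₁ → ℕ → R₂ → J × R₁ → ℂ := fun x₁ u₁ γ₂ jb =>
    if (addOrderOf jb.2).Coprime u₁ then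
      ∑ α with addOrderOf α = u₁, ψ₁ (α * x₁) * F (α + jb.2, γ₂) jb.1 else 0 with hG
  calc ∑ x₂, ∑ x₁, P x₁ x₂
      ≤ ∑ x₂, ∑ u₁ ∈ (Fintype.card R₁).divisors, ∑ x₁, (∑ j, ∑ β with (addOrderOf β).Coprime u₁,
        ‖∑ α with addOrderOf α = u₁, ψ₁ (α * x₁) * ∑ γ₂, ψ₂ (γ₂ * x₂) *
      ((divisorWeight L (addOrderOf γ₂) : ℂ) * F (α + β, γ₂) j)‖ ^ 2) ^ r :=
        Finset.sum_le_sum fun x₂ _ => h₁ ψ₁ hψ₁' J _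
    _ = ∑ u₁ ∈ (Fintype.card R₁).divisors, ∑ x₁, ∑ x₂, (∑ jb, ‖∑ γ₂, ψ₂ (γ₂ * x₂) *
      ((divisorWeight L (addOrderOf γ₂) : ℂ) * G x₁ u₁ γ₂ jb)‖ ^ 2) ^ r := by
        rw [Finset.sum_comm]
        refine Finset.sum_congr rfl fun u₁ _ => ?_
        rw [Finset.sum_comm]
        refine Finset.sum_congr rfl fun x₁ _ => Finset.sum_congr rfl fun x₂ _ => ?_
        congr 1
        rw [Fintype.sum_prod_type]
        refine Finset.sum_congr rfl fun j _ => ?_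
        rw [Finset.sum_filter]
        refine Finset.sum_congr rfl fun β _ => ?_
        by_cases hb : (addOrderOf β).Coprime u₁
        · simp only [hG, if_pos hb]
          congr 2
          simp only [Finset.mul_sum]
          rw [Finset.sum_comm]
          refine Finset.sum_congr rfl fun γ₂ _ => ?_
          refine Finset.sum_congr rfl fun α _ => ?_
          ring
        · simp [hG, hb]
    _ ≤ ∑ u₁ ∈ (Fintype.card R₁).divisors, ∑ x₁, ∑ u₂ ∈ (Fintype.card R₂).divisors, ∑ x₂,
        (∑ jb, ∑ β with (addOrderOf β).Coprime u₂,
        ‖∑ α with addOrderOf α = u₂, ψ₂ (α * x₂) * G x₁ u₁ (α + β) jb‖ ^ 2) ^ r :=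
        Finset.sum_le_sum fun u₁ _ => Finset.sum_le_sum fun x₁ _ => h₂ ψ₂ hψ₂' _ _
    _ = _ := by
        refine Finset.sum_congr rfl fun u₁ hu₁ => ?_
        rw [Finset.sum_comm]
        refine Finset.sum_congr rfl fun u₂ hu₂ => ?_
        rw [Fintype.sum_prod_type]
        have hu₁' := Nat.dvd_of_mem_divisors hu₁
        have hu₂' := Nat.dvd_of_mem_divisors hu₂
        have hfc : ∀ β : R₁ × R₂, (addOrderOf β).Coprime (u₁ * u₂) ↔
            (addOrderOf β.1).Coprime u₁ ∧ (addOrderOf β.2).Coprime u₂ := by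
          intro β
          have a1 : (addOrderOf β.1).Coprime u₂ :=
            Nat.Coprime.of_dvd addOrderOf_dvd_card hu₂' hc
          have a2 : (addOrderOf β.2).Coprime u₁ :=
            Nat.Coprime.of_dvd addOrderOf_dvd_card hu₁' hc.symm
          rw [hord, Nat.coprime_mul_iff_left, Nat.coprime_mul_iff_right, Nat.coprime_mul_iff_right]
          tauto
        have hfe : ∀ α : R₁ × R₂, addOrderOf α = u₁ * u₂ ↔
            addOrderOf α.1 = u₁ ∧ addOrderOf α.2 = u₂ := by
          intro α
          rw [hord]
          constructor
          · intro h
            have := hc.mul_injOn_divisors (x₁ := (addOrderOf α.1, addOrderOf α.2))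
              (x₂ := (u₁, u₂)) (by simp [addOrderOf_dvd_card]) (by simp [hu₁', hu₂']) h
            simpa using this
          · rintro ⟨h, h'⟩
            rw [h, h']
        refine Finset.sum_congr rfl fun x₁ _ => Finset.sum_congr rfl fun x₂ _ => ?_
        congr 1
        rw [Fintype.sum_prod_type]
        refine Finset.sum_congr rfl fun j _ => ?_
        simp_rw [Finset.sum_filter]
        rw [Fintype.sum_prod_type]
        refine Finset.sum_congr rfl fun β₁ _ => Finset.sum_congr rfl fun β₂ _ => ?_
        simp only [hfc, hfe]
        by_cases hb₁ : (addOrderOf β₁).Coprime u₁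
        swap
        · simp [hG, hb₁]
        by_cases hb₂ : (addOrderOf β₂).Coprime u₂
        swap
        · simp [hb₂]
        simp only [hG, if_pos hb₁]
        rw [if_pos hb₂, if_pos ⟨hb₁, hb₂⟩]
        congr 2
        rw [Fintype.sum_prod_type, Finset.sum_comm]
        refine Finset.sum_congr rfl fun α₂ _ => ?_
        by_cases ha₂ : addOrderOf α₂ = u₂
        swap
        · simp [ha₂]
        rw [if_pos ha₂, Finset.sum_filter, Finset.mul_sum]
        refine Finset.sum_congr rfl fun α₁ _ => ?_
        by_cases ha₁ : addOrderOf α₁ = u₁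
        · rw [if_pos ha₁, if_pos ⟨ha₁, ha₂⟩, hmul]
          simp only [Prod.mk_add_mk]
          ring
        · simp [ha₁]

lemma NoiseBound.of_ringEquiv {R S : Type} [CommRing R] [Fintype R] [CommRing S] [Fintype S]
    {r L : ℕ} (e : R ≃+* S) (h : NoiseBound R r L) : NoiseBound S r L := by
  classical
  intro ψ hψ J _ F
  have ho : ∀ a, addOrderOf (e a) = addOrderOf a := e.toAddEquiv.addOrderOf_eq
  have hp : (ψ.compAddMonoidHom (e : R →+ S)).IsPrimitive := by
    intro a ha h
    apply hψ (a := e a) (by simpa using ha)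
    ext x
    have := DFunLike.congr_fun h (e.symm x)
    simpa using this
  have := h _ hp J (fun γ j => F (e γ) j)
  rw [Fintype.card_congr e.toEquiv] at this
  convert this using 1
  · refine (Fintype.sum_equiv e.toEquiv _ _ fun x => ?_).symm
    congr 1
    refine Finset.sum_congr rfl fun j _ => ?_
    congr 2
    refine Fintype.sum_equiv e.toEquiv _ _ fun y => ?_
    simp [ho]
  · refine Finset.sum_congr rfl fun u _ => ?_
    refine (Fintype.sum_equiv e.toEquiv _ _ fun x => ?_).symm
    congr 1
    refine Finset.sum_congr rfl fun j _ => ?_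
    simp_rw [Finset.sum_filter]
    refine Fintype.sum_equiv e.toEquiv _ _ fun y => ?_
    simp only [RingEquiv.toEquiv_eq_coe, EquivLike.coe_coe, ho]
    congr 3
    refine Fintype.sum_equiv e.toEquiv _ _ fun z => ?_
    simp [ho]

lemma noiseBound_zmod (s L : ℕ)
    (hL : ∀ k : ℕ, 20 * 5 ^ (s + 2) * (∑ a ∈ Finset.Icc 1 k, (((a + 1 : ℕ) : ℝ) ^ L)⁻¹) ^ 2 ≤ 1)
    (M : ℕ) [NeZero M] : NoiseBound (ZMod M) (s + 2) L := by
  suffices H : ∀ M : ℕ, ∀ h : M ≠ 0, have : NeZero M := ⟨h⟩; NoiseBound (ZMod M) (s + 2) L from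
    H M (NeZero.ne M)
  clear! M
  intro M
  induction M using Nat.recOnPosPrimePosCoprime with
  | zero => intro h; exact absurd rfl h
  | one =>
    intro _
    exact NoiseBound.of_card_eq_prime_pow s L 2 0 Nat.prime_two (by simp) hL
  | prime_pow p n hp hn =>
    intro h
    have : NeZero (p ^ n) := ⟨h⟩
    exact NoiseBound.of_card_eq_prime_pow s L p n hp (by rw [ZMod.card]) hL
  | coprime a b ha hb hab iha ihb =>
    intro h
    have : NeZero a := ⟨by omega⟩
    have : NeZero b := ⟨by omega⟩
    have : NeZero (a * b) := ⟨h⟩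
    refine NoiseBound.of_ringEquiv (ZMod.chineseRemainder hab).symm
      (NoiseBound.prod (iha (by omega)) (ihb (by omega)) ?_)
    simpa [ZMod.card] using hab

lemma exists_divisorWeight_exponent (s : ℕ) : ∃ L : ℕ, ∀ k : ℕ,
    20 * 5 ^ (s + 2) * (∑ a ∈ Finset.Icc 1 k, (((a + 1 : ℕ) : ℝ) ^ L)⁻¹) ^ 2 ≤ 1 := by
  obtain ⟨K, hK⟩ := pow_unbounded_of_one_lt (20 * 5 ^ (s + 2) : ℝ) (one_lt_two)
  refine ⟨K + 2, fun k => ?_⟩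
  have h1 : ∀ k : ℕ, ∑ a ∈ Finset.Icc 1 k, (((a + 1 : ℕ) : ℝ) ^ 2)⁻¹ ≤ 1 - 1 / (k + 1) := by
    intro k
    induction k with
    | zero => simp
    | succ n ih =>
      rw [Finset.sum_Icc_succ_top (by omega)]
      have : (((n + 1 + 1 : ℕ) : ℝ) ^ 2)⁻¹ ≤ 1 / ((n : ℝ) + 1) - 1 / ((n + 1 : ℕ) + 1) := by
        push_cast
        rw [div_sub_div _ _ (by positivity) (by positivity), inv_eq_one_div,
          div_le_div_iff₀ (by positivity) (by positivity)]
        nlinarith [(Nat.cast_nonneg n : (0 : ℝ) ≤ n)]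
      linarith
  have h2 : ∑ a ∈ Finset.Icc 1 k, (((a + 1 : ℕ) : ℝ) ^ (K + 2))⁻¹ ≤ (2 ^ K)⁻¹ := by
    calc ∑ a ∈ Finset.Icc 1 k, (((a + 1 : ℕ) : ℝ) ^ (K + 2))⁻¹
        ≤ ∑ a ∈ Finset.Icc 1 k, (2 ^ K)⁻¹ * (((a + 1 : ℕ) : ℝ) ^ 2)⁻¹ := by
          refine Finset.sum_le_sum fun a ha => ?_
          rw [pow_add, mul_inv]
          gcongr
          have := (Finset.mem_Icc.1 ha).1
          exact_mod_cast (by omega : 2 ≤ a + 1)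
      _ ≤ (2 ^ K)⁻¹ * 1 := by
          rw [← Finset.mul_sum]
          gcongr
          exact (h1 k).trans (by simp; positivity)
      _ = _ := mul_one _
  have h3 : (0 : ℝ) ≤ ∑ a ∈ Finset.Icc 1 k, (((a + 1 : ℕ) : ℝ) ^ (K + 2))⁻¹ := by positivity
  have h4 : (1 : ℝ) ≤ 2 ^ K := one_le_pow₀ one_le_two
  calc _ ≤ (2 : ℝ) ^ K * ((2 ^ K)⁻¹) ^ 2 := by gcongr
    _ ≤ 1 := by
      rw [sq, ← mul_assoc, mul_inv_cancel₀ (by positivity), one_mul]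
      exact inv_le_one_of_one_le₀ h4

lemma e2pi_add (x y : ℝ) : e2pi (x + y) = e2pi x * e2pi y := by
  simp [e2pi, ← Complex.exp_add, mul_add]

lemma norm_e2pi (x : ℝ) : ‖e2pi x‖ = 1 := by
  have : (2 * Real.pi * Complex.I * x : ℂ) = ((2 * Real.pi * x : ℝ) : ℂ) * Complex.I := by
    push_cast; ring
  rw [e2pi, this, Complex.norm_exp_ofReal_mul_I]

lemma e2pi_int (n : ℤ) : e2pi n = 1 := by
  rw [e2pi, Complex.exp_eq_one_iff]
  exact ⟨n, by push_cast; ring⟩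

lemma e2pi_zero : e2pi 0 = 1 := by simp [e2pi]

lemma conj_e2pi (x : ℝ) : (starRingEnd ℂ) (e2pi x) = e2pi (-x) := by
  simp [e2pi, ← Complex.exp_conj, Complex.conj_ofNat]

@[fun_prop]
lemma continuous_e2pi : Continuous e2pi := by unfold e2pi; fun_prop

lemma integral_e2pi_int (n : ℤ) : ∫ τ in (0 : ℝ)..1, e2pi (n * τ) = if n = 0 then 1 else 0 := by
  split_ifs with h
  · simp [h, e2pi_zero]
  · have h1 : (2 * Real.pi * Complex.I * n : ℂ) ≠ 0 := by
      simp [h, Real.pi_ne_zero]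
    have h2 : ∀ τ : ℝ, e2pi (n * τ) = Complex.exp ((2 * Real.pi * Complex.I * n) * τ) := by
      intro τ; rw [e2pi]; push_cast; ring_nf
    simp_rw [h2]
    rw [integral_exp_mul_complex h1]
    have h3 : Complex.exp (2 * Real.pi * Complex.I * n) = 1 := by
      have := e2pi_int n
      simpa [e2pi] using this
    simp [h3]

/-- The Fourier series of a sequence. -/
noncomputable def fourierSum (h : ℤ → ℂ) (ξ : ℝ) : ℂ := ∑' n : ℤ, h n * e2pi (n * ξ)

lemma summable_mul_e2pi {h : ℤ → ℂ} (hh : Summable fun n => ‖h n‖) (ξ : ℝ) :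
    Summable fun n : ℤ => h n * e2pi (n * ξ) :=
  Summable.of_norm (by simpa [norm_e2pi] using hh)

lemma continuous_fourierSum {h : ℤ → ℂ} (hh : Summable fun n => ‖h n‖) :
    Continuous (fourierSum h) := by
  refine continuous_tsum (fun n => by fun_prop) hh fun n ξ => ?_
  simp [norm_e2pi]

lemma norm_fourierSum_le {h : ℤ → ℂ} (hh : Summable fun n => ‖h n‖) (ξ : ℝ) :
    ‖fourierSum h ξ‖ ≤ ∑' n, ‖h n‖ := by
  have := norm_tsum_le_tsum_norm (f := fun n : ℤ => h n * e2pi (n * ξ))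
    (by simpa [norm_e2pi] using hh)
  simpa [norm_e2pi, fourierSum] using this

lemma integral_e2pi_mul_fourierSum {h : ℤ → ℂ} (hh : Summable fun n => ‖h n‖) (ξ : ℝ) (n : ℤ) :
    ∫ τ in (0 : ℝ)..1, e2pi (n * τ) * fourierSum h (ξ - τ) = h n * e2pi (n * ξ) := by
  have H := intervalIntegral.hasSum_integral_of_dominated_convergence (a := 0) (b := 1)
    (μ := volume) (F := fun (m : ℤ) τ => e2pi (n * τ) * (h m * e2pi (m * (ξ - τ))))
    (f := fun τ => e2pi (n * τ) * fourierSum h (ξ - τ)) (fun m _ => ‖h m‖)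
    (fun m => Continuous.aestronglyMeasurable (by fun_prop))
    (fun m => by filter_upwards with τ _; simp [norm_e2pi])
    (by filter_upwards with τ _; exact hh) (by simp)
    (by filter_upwards with τ _; exact (summable_mul_e2pi hh (ξ - τ)).hasSum.mul_left _)
  rw [← H.tsum_eq]
  have : ∀ m : ℤ, ∫ τ in (0 : ℝ)..1, e2pi (n * τ) * (h m * e2pi (m * (ξ - τ)))
      = if m = n then h n * e2pi (n * ξ) else 0 := by
    intro m
    have h1 : ∀ τ : ℝ, e2pi (n * τ) * (h m * e2pi (m * (ξ - τ)))
        = (h m * e2pi (m * ξ)) * e2pi ((n - m : ℤ) * τ) := by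
      intro τ
      rw [show ((m : ℝ) * (ξ - τ)) = m * ξ + (-(m * τ)) by ring, e2pi_add,
        show (((n - m : ℤ) : ℝ) * τ) = n * τ + (-(m * τ)) by push_cast; ring, e2pi_add]
      ring
    simp_rw [h1]
    rw [intervalIntegral.integral_const_mul, integral_e2pi_int]
    by_cases hmn : m = n
    · simp [hmn]
    · rw [if_neg (by omega), if_neg hmn, mul_zero]
  simp_rw [this]
  simp

lemma fourierSum_mul {h h' : ℤ → ℂ} (hh : Summable fun n => ‖h n‖)
    (hh' : Summable fun n => ‖h' n‖) (ξ : ℝ) :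
    fourierSum (fun n => h n * h' n) ξ
      = ∫ τ in (0 : ℝ)..1, fourierSum h τ * fourierSum h' (ξ - τ) := by
  have H := intervalIntegral.hasSum_integral_of_dominated_convergence (a := 0) (b := 1)
    (μ := volume) (F := fun (m : ℤ) τ => (h m * e2pi (m * τ)) * fourierSum h' (ξ - τ))
    (f := fun τ => fourierSum h τ * fourierSum h' (ξ - τ)) (fun m _ => ‖h m‖ * ∑' n, ‖h' n‖)
    (fun m => Continuous.aestronglyMeasurable (by have := continuous_fourierSum hh'; fun_prop))
    (fun m => by
      filter_upwards with τ _
      rw [norm_mul, norm_mul, norm_e2pi, mul_one]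
      exact mul_le_mul_of_nonneg_left (norm_fourierSum_le hh' _) (norm_nonneg _))
    (by filter_upwards with τ _; exact hh.mul_right _) (by simp)
    (by filter_upwards with τ _; exact (summable_mul_e2pi hh τ).hasSum.mul_right _)
  rw [← H.tsum_eq, fourierSum]
  refine tsum_congr fun n => ?_
  simp_rw [mul_assoc]
  rw [intervalIntegral.integral_const_mul, integral_e2pi_mul_fourierSum hh']

lemma tsum_norm_sq_eq_integral {h : ℤ → ℂ} (hh : Summable fun n => ‖h n‖) :
    ∑' n, ‖h n‖ ^ 2 = ∫ τ in (0 : ℝ)..1, ‖fourierSum h τ‖ ^ 2 := by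
  have h1 := fourierSum_mul hh (h' := fun n => (starRingEnd ℂ) (h n)) (by simpa using hh) 0
  have h2 : ∀ τ, fourierSum (fun n => (starRingEnd ℂ) (h n)) (0 - τ)
      = (starRingEnd ℂ) (fourierSum h τ) := by
    intro τ
    rw [fourierSum, fourierSum, Complex.conj_tsum]
    refine tsum_congr fun n => ?_
    rw [map_mul (starRingEnd ℂ), conj_e2pi]
    ring_nf
  simp_rw [h2, Complex.mul_conj, Complex.normSq_eq_norm_sq] at h1
  rw [fourierSum, intervalIntegral.integral_ofReal] at h1
  simp only [mul_zero, e2pi_zero, mul_one] at h1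
  rw [← Complex.ofReal_tsum] at h1
  exact_mod_cast h1

/-- Absolutely summable sequences whose Fourier series vanishes at distance at least `s` from the
integers. -/
def BandLimited (s : ℝ) (h : ℤ → ℂ) : Prop :=
  (Summable fun n => ‖h n‖) ∧ ∀ ξ : ℝ, (∀ k : ℤ, s ≤ |ξ - k|) → fourierSum h ξ = 0

lemma BandLimited.zero (s : ℝ) : BandLimited s 0 := 
  ⟨by simp, by simp [fourierSum]⟩

lemma BandLimited.mul {s s' : ℝ} {h h' : ℤ → ℂ} (H : BandLimited s h) (H' : BandLimited s' h') :
    BandLimited (s + s') (fun n => h n * h' n) := by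
  constructor
  · simp_rw [norm_mul]
    refine Summable.of_nonneg_of_le (fun n => by positivity) (fun n => ?_)
      (H.1.mul_right (∑' n, ‖h' n‖))
    exact mul_le_mul_of_nonneg_left (H'.1.le_tsum n fun _ _ => norm_nonneg _) (norm_nonneg _)
  · intro ξ hξ
    rw [fourierSum_mul H.1 H'.1]
    have : ∀ τ, fourierSum h τ * fourierSum h' (ξ - τ) = 0 := by
      intro τ
      by_contra hne
      have h1 : ¬ ∀ k : ℤ, s ≤ |τ - k| := fun h => hne (by rw [H.2 τ h, zero_mul])
      have h2 : ¬ ∀ k : ℤ, s' ≤ |ξ - τ - k| := fun h => hne (by rw [H'.2 _ h, mul_zero])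
      push Not at h1 h2
      obtain ⟨k, hk⟩ := h1
      obtain ⟨l, hl⟩ := h2
      have h3 := hξ (k + l)
      have h4 := abs_add_le (τ - k) (ξ - τ - l)
      rw [show τ - k + (ξ - τ - l) = ξ - (k + l : ℤ) by push_cast; ring] at h4
      linarith
    simp [this]

lemma BandLimited.const_mul {s : ℝ} {h : ℤ → ℂ} (H : BandLimited s h) (c : ℂ) :
    BandLimited s (fun n => c * h n) := by
  refine ⟨by simpa using H.1.mul_left ‖c‖, fun ξ hξ => ?_⟩
  have := H.2 ξ hξ
  simp only [fourierSum, mul_assoc] at this ⊢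
  rw [tsum_mul_left, this, mul_zero]

lemma BandLimited.add {s : ℝ} {h h' : ℤ → ℂ} (H : BandLimited s h) (H' : BandLimited s h') :
    BandLimited s (fun n => h n + h' n) := by
  refine ⟨Summable.of_nonneg_of_le (fun n => by positivity) (fun n => norm_add_le _ _)
    (H.1.add H'.1), fun ξ hξ => ?_⟩
  have h1 := H.2 ξ hξ
  have h2 := H'.2 ξ hξ
  simp only [fourierSum, add_mul] at h1 h2 ⊢
  rw [Summable.tsum_add (summable_mul_e2pi H.1 ξ) (summable_mul_e2pi H'.1 ξ), h1, h2, add_zero]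

lemma BandLimited.sum {s : ℝ} {ι : Type*} (A : Finset ι) {h : ι → ℤ → ℂ}
    (H : ∀ i ∈ A, BandLimited s (h i)) : BandLimited s (fun n => ∑ i ∈ A, h i n) := by
  classical
  induction A using Finset.induction_on with
  | empty => simp only [Finset.sum_empty]; exact BandLimited.zero s
  | insert a A ha ih =>
    simp_rw [Finset.sum_insert ha]
    exact (H a (Finset.mem_insert_self _ _)).add
      (ih fun i hi => H i (Finset.mem_insert_of_mem hi))

lemma BandLimited.conj {s : ℝ} {h : ℤ → ℂ} (H : BandLimited s h) :
    BandLimited s (fun n => (starRingEnd ℂ) (h n)) := by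
  refine ⟨by simpa using H.1, fun ξ hξ => ?_⟩
  have h1 := H.2 (-ξ) fun k => by
    have := hξ (-k)
    rwa [← abs_neg, show -(ξ - (-k : ℤ)) = -ξ - k by push_cast; ring] at this
  have h2 : fourierSum (fun n => (starRingEnd ℂ) (h n)) ξ
      = (starRingEnd ℂ) (fourierSum h (-ξ)) := by
    rw [fourierSum, fourierSum, Complex.conj_tsum]
    refine tsum_congr fun n => ?_
    rw [map_mul (starRingEnd ℂ), conj_e2pi]
    ring_nf
  rw [h2, h1, map_zero]

lemma fourierSum_translate (h : ℤ → ℂ) (m : ℤ) (ξ : ℝ) :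
    fourierSum (fun n => h (n - m)) ξ = e2pi (m * ξ) * fourierSum h ξ := by
  rw [fourierSum, fourierSum, ← tsum_mul_left, ← (Equiv.addRight m).tsum_eq]
  refine tsum_congr fun n => ?_
  simp only [Equiv.coe_addRight, add_sub_cancel_right]
  rw [show (((n + m : ℤ) : ℝ) * ξ) = m * ξ + n * ξ by push_cast; ring, e2pi_add]
  ring

lemma BandLimited.translate {s : ℝ} {h : ℤ → ℂ} (H : BandLimited s h) (m : ℤ) :
    BandLimited s (fun n => h (n - m)) := by
  refine ⟨?_, fun ξ hξ => by rw [fourierSum_translate, H.2 ξ hξ, mul_zero]⟩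
  exact (Equiv.subRight m).summable_iff.2 H.1

lemma stdAddChar_mul_intCast {M : ℕ} [NeZero M] (γ : ZMod M) (n : ℤ) :
    ZMod.stdAddChar (γ * (n : ZMod M)) = e2pi (n * (γ.val / M)) := by
  have : γ * (n : ZMod M) = ((γ.val * n : ℤ) : ZMod M) := by simp
  rw [this, ZMod.stdAddChar_coe, e2pi]
  push_cast
  ring_nf

lemma norm_stdAddChar {M : ℕ} [NeZero M] (γ : ZMod M) : ‖ZMod.stdAddChar γ‖ = 1 := by
  have := stdAddChar_mul_intCast γ 1
  simp only [Int.cast_one, mul_one, one_mul] at this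
  rw [this, norm_e2pi]

lemma one_le_addOrderOf_mul_abs {M : ℕ} [NeZero M] {γ : ZMod M} (hγ : γ ≠ 0) (k : ℤ) :
    1 ≤ addOrderOf γ * |((γ.val : ℝ) / M) - k| := by
  have h1 : M ∣ addOrderOf γ * γ.val := by
    rw [← ZMod.natCast_eq_zero_iff]
    have := addOrderOf_nsmul_eq_zero γ
    simpa using this
  obtain ⟨t, ht⟩ := h1
  have hM : (0 : ℝ) < M := Nat.cast_pos.2 (NeZero.pos M)
  have ho : 0 < addOrderOf γ := addOrderOf_pos γ
  have h2 : (addOrderOf γ : ℝ) * (γ.val / M) = t := by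
    have : (addOrderOf γ : ℝ) * γ.val = M * t := by exact_mod_cast ht
    rw [← mul_div_assoc, this]
    field_simp
  have h3 : (addOrderOf γ : ℝ) * |((γ.val : ℝ) / M) - k| = |((t - addOrderOf γ * k : ℤ) : ℝ)| := by
    have h0 : |(addOrderOf γ : ℝ)| = addOrderOf γ := abs_of_pos (by positivity)
    nth_rewrite 1 [← h0]
    rw [← abs_mul, mul_sub, h2]
    push_cast
    rfl
  rw [h3]
  have h4 : (t - addOrderOf γ * k : ℤ) ≠ 0 := by
    intro h
    have h5 : ((γ.val : ℝ) / M) = k := by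
      have h6 : (t : ℝ) = addOrderOf γ * k := by exact_mod_cast (sub_eq_zero.1 h)
      rw [h6] at h2
      exact mul_left_cancel₀ (by positivity) h2
    have h7 : (0 : ℝ) < γ.val := by
      have : γ.val ≠ 0 := by simpa using hγ
      positivity
    have h8 : (γ.val : ℝ) < M := by exact_mod_cast ZMod.val_lt γ
    have h9 : (0 : ℝ) < k := by rw [← h5]; positivity
    have h10 : (k : ℝ) < 1 := by rw [← h5, div_lt_one hM]; exact h8
    have h11 : 0 < k := by exact_mod_cast h9
    have h12 : k < 1 := by exact_mod_cast h10
    omega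
  exact_mod_cast Int.one_le_abs h4

/-- Functions on `ℤ × ZMod M` whose expansion in the twisted characters of the second variable is
supported on characters of order at most `R` and has coefficients band limited to `s`. -/
def TwistedBandLimited {M : ℕ} [NeZero M] (R : ℕ) (s : ℝ) (h : ℤ → ZMod M → ℂ) : Prop :=
  ∃ c : ZMod M → ℤ → ℂ, (∀ γ, BandLimited s (c γ)) ∧ (∀ γ n, R < addOrderOf γ → c γ n = 0) ∧
    ∀ n x, h n x = ∑ γ, ZMod.stdAddChar (γ * (x - (n : ZMod M))) * c γ n

section Transference

variable {M : ℕ} [NeZero M]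

lemma TwistedBandLimited.mul {R R' : ℕ} {s s' : ℝ} {h h' : ℤ → ZMod M → ℂ}
    (H : TwistedBandLimited R s h) (H' : TwistedBandLimited R' s' h') :
    TwistedBandLimited (R * R') (s + s') (fun n x => h n x * h' n x) := by
  obtain ⟨c, hc, hcR, hch⟩ := H
  obtain ⟨c', hc', hcR', hch'⟩ := H'
  refine ⟨fun δ n => ∑ γ, c γ n * c' (δ - γ) n, fun δ => BandLimited.sum _ fun γ _ =>
    (hc γ).mul (hc' (δ - γ)), fun δ n hδ => Finset.sum_eq_zero fun γ _ => ?_, fun n x => ?_⟩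
  · by_contra hne
    have h1 : addOrderOf γ ≤ R := by
      by_contra h; exact hne (by rw [hcR γ n (by omega), zero_mul])
    have h2 : addOrderOf (δ - γ) ≤ R' := by
      by_contra h; exact hne (by rw [hcR' _ n (by omega), mul_zero])
    have h3 := Nat.le_of_dvd (Nat.mul_pos (addOrderOf_pos γ) (addOrderOf_pos (δ - γ)))
      ((AddCommute.all γ (δ - γ)).addOrderOf_add_dvd_mul_addOrderOf)
    rw [add_sub_cancel] at h3
    have := Nat.mul_le_mul h1 h2
    omega
  · beta_reduce
    rw [hch, hch', Finset.sum_mul_sum]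
    simp_rw [Finset.mul_sum]
    conv_rhs => rw [Finset.sum_comm]
    refine Finset.sum_congr rfl fun γ _ => ?_
    refine Fintype.sum_equiv (Equiv.addRight γ) _ _ fun δ => ?_
    simp only [Equiv.coe_addRight, add_sub_cancel_right, add_mul, AddChar.map_add_eq_mul]
    ring

lemma TwistedBandLimited.conj {R : ℕ} {s : ℝ} {h : ℤ → ZMod M → ℂ}
    (H : TwistedBandLimited R s h) :
    TwistedBandLimited R s (fun n x => (starRingEnd ℂ) (h n x)) := by
  obtain ⟨c, hc, hcR, hch⟩ := H
  refine ⟨fun γ n => (starRingEnd ℂ) (c (-γ) n), fun γ => (hc (-γ)).conj, fun γ n hγ => ?_,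
    fun n x => ?_⟩
  · beta_reduce
    rw [hcR (-γ) n (by rwa [addOrderOf_neg]), map_zero]
  · beta_reduce
    rw [hch, map_sum]
    refine Fintype.sum_equiv (Equiv.neg _) _ _ fun γ => ?_
    simp only [Equiv.neg_apply, neg_neg]
    rw [map_mul (starRingEnd ℂ), ← AddChar.map_neg_eq_conj, neg_mul]

lemma TwistedBandLimited.pow_succ {R : ℕ} {s : ℝ} {h : ℤ → ZMod M → ℂ}
    (H : TwistedBandLimited R s h) (r : ℕ) :
    TwistedBandLimited (R ^ (r + 1)) ((r + 1 : ℕ) * s) (fun n x => h n x ^ (r + 1)) := by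
  induction r with
  | zero => simpa using H
  | succ r ih =>
    have := ih.mul H
    convert this using 1
    · rw [_root_.pow_succ]
    · push_cast; ring
    · funext n x; rw [_root_.pow_succ]

lemma TwistedBandLimited.summable {R : ℕ} {s : ℝ} {h : ℤ → ZMod M → ℂ}
    (H : TwistedBandLimited R s h) (x : ZMod M) : Summable fun n => h n x := by
  obtain ⟨c, hc, hcR, hch⟩ := H
  simp_rw [hch]
  refine summable_sum fun γ _ => Summable.of_norm ?_
  simp_rw [norm_mul, norm_stdAddChar, one_mul]
  exact (hc γ).1

lemma TwistedBandLimited.tsum_eq {R : ℕ} {s : ℝ} {h : ℤ → ZMod M → ℂ}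
    (H : TwistedBandLimited R s h) (hRs : R * s ≤ 1) (x : ZMod M) :
    ∑' n, h n x = ∑' n, h n 0 := by
  obtain ⟨c, hc, hcR, hch⟩ := H
  suffices H : ∀ x, ∑' n, h n x = ∑' n, c 0 n by rw [H x, H 0]
  intro x
  simp_rw [hch]
  have hs : ∀ γ ∈ (Finset.univ : Finset (ZMod M)),
      Summable fun n : ℤ => ZMod.stdAddChar (γ * (x - (n : ZMod M))) * c γ n := by
    intro γ _
    refine Summable.of_norm ?_
    simp_rw [norm_mul, norm_stdAddChar, one_mul]
    exact (hc γ).1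
  rw [Summable.tsum_finsetSum hs, Finset.sum_eq_single 0 _ (by simp)]
  · simp
  · intro γ _ hγ
    have h1 : ∀ n : ℤ, ZMod.stdAddChar (γ * (x - (n : ZMod M))) * c γ n
        = ZMod.stdAddChar (γ * x) * (c γ n * e2pi (n * (-(γ.val / M)))) := by
      intro n
      rw [mul_sub, sub_eq_add_neg, AddChar.map_add_eq_mul, AddChar.map_neg_eq_conj,
        stdAddChar_mul_intCast, conj_e2pi]
      ring_nf
    simp_rw [h1]
    rw [tsum_mul_left]
    by_cases hR : R < addOrderOf γ
    · simp [hcR γ _ hR]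
    have h2 := (hc γ).2 (-(γ.val / M)) fun k => ?_
    · rw [fourierSum] at h2
      rw [h2, mul_zero]
    have h3 := one_le_addOrderOf_mul_abs hγ (-k)
    have h4 : |-((γ.val : ℝ) / M) - k| = |((γ.val : ℝ) / M) - (-k : ℤ)| := by
      rw [← abs_neg]; push_cast; ring_nf
    rw [h4]
    have h5 : (addOrderOf γ : ℝ) ≤ R := by exact_mod_cast not_lt.1 hR
    have h6 : 1 ≤ (R : ℝ) * |((γ.val : ℝ) / M) - (-k : ℤ)| :=
      h3.trans (mul_le_mul_of_nonneg_right h5 (abs_nonneg _))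
    have h7 : (0 : ℝ) < R := lt_of_lt_of_le (by exact_mod_cast addOrderOf_pos γ) h5
    exact le_of_mul_le_mul_left (hRs.trans h6) h7

/-- Exact transference from the integers to a finite cyclic group. -/
lemma hasSum_transference {q r : ℕ} {s : ℝ} {F : ZMod M → ℤ → ℂ} (hF : ∀ γ, BandLimited s (F γ))
    (hFq : ∀ γ n, q < addOrderOf γ → F γ n = 0) (hr : 1 ≤ r)
    (hqs : ((q * q) ^ r : ℕ) * (r * (s + s)) ≤ 1) :
    (Summable fun n : ℤ => ‖∑ γ, ZMod.stdAddChar (γ * (-(n : ZMod M))) * F γ n‖ ^ (2 * r)) ∧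
    HasSum (fun n : ℤ => ∑ x, ‖∑ γ, ZMod.stdAddChar (γ * x) * F γ n‖ ^ (2 * r))
      (M * ∑' n : ℤ, ‖∑ γ, ZMod.stdAddChar (γ * (-(n : ZMod M))) * F γ n‖ ^ (2 * r)) := by
  obtain ⟨r, rfl⟩ := Nat.exists_eq_add_of_le' hr
  set h : ℤ → ZMod M → ℂ := fun n x => ∑ γ, ZMod.stdAddChar (γ * (x - (n : ZMod M))) * F γ n with hh
  have H : TwistedBandLimited q s h := ⟨F, hF, hFq, fun n x => rfl⟩
  have H2 := (H.mul H.conj).pow_succ r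
  have e1 : ∀ n x, (h n x * (starRingEnd ℂ) (h n x)) ^ (r + 1)
      = ((‖h n x‖ ^ (2 * (r + 1)) : ℝ) : ℂ) := by
    intro n x
    rw [Complex.mul_conj, Complex.normSq_eq_norm_sq, pow_mul]
    push_cast
    rfl
  simp_rw [e1] at H2
  have hsum : ∀ x, Summable fun n => ‖h n x‖ ^ (2 * (r + 1)) := fun x => by
    have := H2.summable x
    exact_mod_cast this
  have htsum : ∀ x, ∑' n, ‖h n x‖ ^ (2 * (r + 1)) = ∑' n, ‖h n 0‖ ^ (2 * (r + 1)) := fun x => by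
    have := H2.tsum_eq (by simpa using hqs) x
    rw [← Complex.ofReal_tsum, ← Complex.ofReal_tsum] at this
    exact_mod_cast this
  have e0 : ∀ n : ℤ, h n 0 = ∑ γ, ZMod.stdAddChar (γ * (-(n : ZMod M))) * F γ n := by
    intro n; simp [hh]
  have e2 : ∀ n : ℤ, ∑ x, ‖∑ γ, ZMod.stdAddChar (γ * x) * F γ n‖ ^ (2 * (r + 1))
      = ∑ x, ‖h n x‖ ^ (2 * (r + 1)) := by
    intro n
    refine (Fintype.sum_equiv (Equiv.subRight (n : ZMod M)) _ _ fun x => ?_).symm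
    simp [hh]
  simp_rw [e2, ← e0]
  refine ⟨hsum 0, ?_⟩
  have := hasSum_sum (s := (Finset.univ : Finset (ZMod M))) fun x _ => (hsum x).hasSum
  simpa [htsum] using this

end Transference

/-- A smooth cutoff with values in `[0, 1]` supported in `(-1/2, 1/2)`. -/
structure IsCutoff (η : ℝ → ℝ) : Prop where
  smooth : ContDiff ℝ (⊤ : ℕ∞) η
  mem_Icc : ∀ x, η x ∈ Set.Icc (0 : ℝ) 1
  eq_zero : ∀ x, x ∉ Set.Ioo (-(1 / 2) : ℝ) (1 / 2) → η x = 0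

/-- The Fourier transform at the integers of the dilated cutoff `η (· / W)`. -/
noncomputable def dilatedCoeff (η : ℝ → ℝ) (W : ℝ) (k : ℤ) : ℂ :=
  FourierTransform.fourier (fun x : ℝ => (η (W⁻¹ * x) : ℂ)) (k : ℝ)

namespace IsCutoff

variable {η : ℝ → ℝ} (hη : IsCutoff η)
include hη

lemma hasCompactSupport {W : ℝ} (hW : 0 < W) :
    HasCompactSupport (fun x : ℝ => (η (W⁻¹ * x) : ℂ)) := by
  refine HasCompactSupport.intro (isCompact_Icc (a := -W) (b := W)) fun x hx => ?_
  rw [hη.eq_zero, Complex.ofReal_zero]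
  rintro ⟨h1, h2⟩
  apply hx
  rw [inv_mul_eq_div, lt_div_iff₀ hW] at h1
  rw [inv_mul_eq_div, div_lt_iff₀ hW] at h2
  constructor <;> linarith

lemma contDiff_dilate (W : ℝ) :
    ContDiff ℝ (⊤ : ℕ∞) (fun x : ℝ => (η (W⁻¹ * x) : ℂ)) :=
  Complex.ofRealCLM.contDiff.comp (hη.smooth.comp (contDiff_const.mul contDiff_id))

/-- The dilated cutoff as a Schwartz function. -/
noncomputable def schwartz {W : ℝ} (hW : 0 < W) : SchwartzMap ℝ ℂ :=
  (hη.hasCompactSupport hW).toSchwartzMap (hη.contDiff_dilate W)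

lemma schwartz_apply {W : ℝ} (hW : 0 < W) (x : ℝ) : hη.schwartz hW x = η (W⁻¹ * x) := rfl

omit hη in
lemma dilatedCoeff_eq {W : ℝ} (hW : 0 < W) (k : ℤ) :
    dilatedCoeff η W k = W * FourierTransform.fourier (fun x : ℝ => (η x : ℂ)) (W * k) := by
  rw [dilatedCoeff, Real.fourier_real_eq, Real.fourier_real_eq]
  have := Measure.integral_comp_mul_left (fun y : ℝ => Real.fourierChar (-(y * (W * k))) •
    (η y : ℂ)) W⁻¹
  rw [inv_inv, abs_of_pos hW] at this
  rw [Complex.real_smul] at this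
  rw [← this]
  congr 1
  ext x
  congr 3
  field_simp

lemma exists_norm_dilatedCoeff_le : ∃ A : ℝ, 0 < A ∧ ∀ W : ℝ, 0 < W → ∀ k : ℤ,
    ‖dilatedCoeff η W k‖ ≤ A * W / (1 + (W * k) ^ 2) := by
  set g : SchwartzMap ℝ ℂ := FourierTransform.fourier (hη.schwartz one_pos) with hg
  obtain ⟨C0, hC0, h0⟩ := g.decay 0 0
  obtain ⟨C2, hC2, h2⟩ := g.decay 2 0
  refine ⟨C0 + C2, by positivity, fun W hW k => ?_⟩
  have hgW : g (W * k) = FourierTransform.fourier (fun x : ℝ => (η x : ℂ)) (W * k) := by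
    have h1 : ⇑(hη.schwartz one_pos) = fun x : ℝ => (η x : ℂ) := by
      ext x
      simp [schwartz_apply]
    rw [hg, SchwartzMap.fourier_coe, h1]
  rw [dilatedCoeff_eq hW, norm_mul, Complex.norm_real, Real.norm_of_nonneg hW.le, ← hgW,
    le_div_iff₀ (by positivity)]
  have a0 := h0 (W * k)
  have a2 := h2 (W * k)
  simp only [norm_iteratedFDeriv_zero, pow_zero, one_mul, Real.norm_eq_abs, sq_abs] at a0 a2
  have : ‖g (W * k)‖ * (1 + (W * k) ^ 2) ≤ C0 + C2 := by linarith
  calc _ = W * (‖g (W * k)‖ * (1 + (W * k) ^ 2)) := by ring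
    _ ≤ W * (C0 + C2) := by gcongr
    _ = _ := by ring

lemma summable_norm_dilatedCoeff {W : ℝ} (hW : 0 < W) :
    Summable fun k => ‖dilatedCoeff η W k‖ := by
  obtain ⟨A, hA, h⟩ := hη.exists_norm_dilatedCoeff_le
  have h1 : Summable fun k : ℤ => A * W⁻¹ * (1 / (k : ℝ) ^ 2) :=
    (Real.summable_one_div_int_pow.2 one_lt_two).mul_left _
  refine Summable.of_norm_bounded_eventually h1 ?_
  filter_upwards [(Set.finite_singleton (0 : ℤ)).compl_mem_cofinite] with k hk
  have hk0 : (k : ℝ) ≠ 0 := by exact_mod_cast hk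
  rw [norm_norm]
  refine (h W hW k).trans ?_
  have : A * W⁻¹ * (1 / (k : ℝ) ^ 2) = A * W / (W * k) ^ 2 := by field_simp
  rw [this]
  gcongr
  linarith

lemma fourierSum_dilatedCoeff {W : ℝ} (hW : 0 < W) (ξ : ℝ) :
    fourierSum (dilatedCoeff η W) ξ = ∑' n : ℤ, (η (W⁻¹ * (ξ + n)) : ℂ) := by
  have := (hη.schwartz hW).tsum_eq_tsum_fourier ξ
  simp only [schwartz_apply] at this
  rw [this, fourierSum]
  refine tsum_congr fun n => ?_
  rw [fourier_coe_apply, SchwartzMap.fourier_coe, e2pi]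
  congr 2
  push_cast
  ring

lemma eta_eq_zero {W : ℝ} (hW : 0 < W) {x : ℝ} (hx : W / 2 ≤ |x|) : η (W⁻¹ * x) = 0 := by
  refine hη.eq_zero _ ?_
  rintro ⟨h1, h2⟩
  rw [inv_mul_eq_div, lt_div_iff₀ hW] at h1
  rw [inv_mul_eq_div, div_lt_iff₀ hW] at h2
  have := abs_lt.2 ⟨(by linarith : -(W / 2) < x), (by linarith : x < W / 2)⟩
  linarith

lemma bandLimited {W : ℝ} (hW : 0 < W) : BandLimited (W / 2) (dilatedCoeff η W) := by
  refine ⟨hη.summable_norm_dilatedCoeff hW, fun ξ hξ => ?_⟩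
  rw [hη.fourierSum_dilatedCoeff hW]
  have : ∀ n : ℤ, (η (W⁻¹ * (ξ + n)) : ℂ) = 0 := fun n => by
    rw [hη.eta_eq_zero hW, Complex.ofReal_zero]
    have := hξ (-n)
    rwa [Int.cast_neg, sub_neg_eq_add] at this
  simp [this]

lemma fourierSum_dilatedCoeff_eq {W : ℝ} (hW : 0 < W) (hW1 : W ≤ 1) (ξ : ℝ) :
    fourierSum (dilatedCoeff η W) ξ = (η (W⁻¹ * (ξ - round ξ)) : ℂ) := by
  rw [hη.fourierSum_dilatedCoeff hW, tsum_eq_single (-round ξ)]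
  · push_cast; rw [sub_eq_add_neg]
  · intro n hn
    rw [hη.eta_eq_zero hW, Complex.ofReal_zero]
    have h1 := abs_sub_round ξ
    have h2 : (1 : ℝ) ≤ |((round ξ + n : ℤ) : ℝ)| := by
      exact_mod_cast Int.one_le_abs (fun h => hn (by omega))
    have h3 : |((round ξ + n : ℤ) : ℝ)| ≤ |ξ + n| + |ξ - round ξ| := by
      rw [show ((round ξ + n : ℤ) : ℝ) = (ξ + n) - (ξ - round ξ) by push_cast; ring]
      exact abs_sub _ _
    linarith

lemma iwSymbol_eq {W : ℝ} (hW : 0 < W) (hW1 : W ≤ 1) (Q ξ : ℝ) :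
    (iwSymbol η Q W ξ : ℂ) = ∑ aq ∈ canonicalFractions Q,
      fourierSum (dilatedCoeff η W) (ξ - (aq.1 : ℝ) / aq.2) := by
  simp_rw [hη.fourierSum_dilatedCoeff_eq hW hW1, iwSymbol]
  push_cast
  rfl

lemma iwKernel_eq {W : ℝ} (hW : 0 < W) (hW1 : W ≤ 1) (Q : ℝ) (m : ℤ) :
    iwKernel η Q W m = ∑ aq ∈ canonicalFractions Q,
      e2pi (-(m * ((aq.1 : ℝ) / aq.2))) * dilatedCoeff η W m := by
  have hs := hη.summable_norm_dilatedCoeff hW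
  rw [iwKernel, ← intervalIntegral.integral_of_le zero_le_one]
  simp_rw [hη.iwSymbol_eq hW hW1, Finset.sum_mul]
  rw [intervalIntegral.integral_finsetSum]
  · refine Finset.sum_congr rfl fun aq _ => ?_
    set θ : ℝ := (aq.1 : ℝ) / aq.2
    have h1 := integral_e2pi_mul_fourierSum (h := fun n => dilatedCoeff η W (-n))
      ((Equiv.neg ℤ).summable_iff.2 hs) θ (-m)
    have h2 : ∀ τ, fourierSum (fun n => dilatedCoeff η W (-n)) (θ - τ)
        = fourierSum (dilatedCoeff η W) (τ - θ) := by
      intro τ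
      rw [fourierSum, fourierSum, ← (Equiv.neg ℤ).tsum_eq]
      refine tsum_congr fun n => ?_
      simp only [Equiv.neg_apply, neg_neg]
      congr 2
      push_cast
      ring
    simp_rw [h2] at h1
    rw [neg_neg] at h1
    rw [mul_comm, show (-(m * θ)) = ((-m : ℤ) : ℝ) * θ by push_cast; ring, ← h1]
    congr 1
    ext τ
    rw [mul_comm]
    congr 2
    push_cast
    ring
  · intro aq _
    have := continuous_fourierSum hs
    exact Continuous.intervalIntegrable (by fun_prop) _ _

end IsCutoff

lemma sum_canonicalFractions {M : ℕ} [NeZero M] {Q : ℝ}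
    (hM : ∀ n ∈ Finset.Icc 1 ⌊Q⌋₊, n ∣ M) (h : ℝ → ℂ) :
    ∑ aq ∈ canonicalFractions Q, h ((aq.1 : ℝ) / aq.2)
      = ∑ γ : ZMod M with addOrderOf γ ≤ ⌊Q⌋₊, h ((γ.val : ℝ) / M) := by
  have hMpos : 0 < M := NeZero.pos M
  have hord : ∀ γ : ZMod M, addOrderOf γ = M / M.gcd γ.val := by
    intro γ
    conv_lhs => rw [← ZMod.natCast_zmod_val γ]
    rw [ZMod.addOrderOf_coe _ (NeZero.ne M)]
  symm
  refine Finset.sum_nbij (fun γ => (γ.val / M.gcd γ.val, M / M.gcd γ.val)) ?_ ?_ ?_ ?_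
  · intro γ hγ
    have hγ := (Finset.mem_filter.1 hγ).2
    have hg : 0 < M.gcd γ.val := Nat.gcd_pos_of_pos_left _ hMpos
    have h1 : γ.val / M.gcd γ.val < M / M.gcd γ.val :=
      Nat.div_lt_div_of_lt_of_dvd (Nat.gcd_dvd_left _ _) (ZMod.val_lt γ)
    rw [hord] at hγ
    simp only [canonicalFractions, Finset.mem_filter, Finset.mem_product, Finset.mem_range,
      Finset.mem_Icc]
    refine ⟨⟨Nat.lt_succ_of_lt (h1.trans_le hγ), (Nat.zero_le _).trans_lt h1, hγ⟩, h1, ?_⟩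
    rw [Nat.gcd_comm]
    exact Nat.coprime_div_gcd_div_gcd hg
  · intro γ _ γ' _ he
    have hg : ∀ γ : ZMod M, 0 < M.gcd γ.val := fun γ => Nat.gcd_pos_of_pos_left _ hMpos
    simp only [Prod.mk.injEq] at he
    have hgg : M.gcd γ.val = M.gcd γ'.val := by
      have h1 := Nat.div_mul_cancel (Nat.gcd_dvd_left M γ.val)
      have h2 := Nat.div_mul_cancel (Nat.gcd_dvd_left M γ'.val)
      rw [he.2] at h1
      have h3 : 0 < M / M.gcd γ'.val :=
        Nat.div_pos (Nat.gcd_le_left _ hMpos) (hg _)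
      exact Nat.eq_of_mul_eq_mul_left h3 (h1.trans h2.symm)
    apply ZMod.val_injective M
    rw [← Nat.div_mul_cancel (Nat.gcd_dvd_right M γ.val), he.1, hgg,
      Nat.div_mul_cancel (Nat.gcd_dvd_right M γ'.val)]
  · rintro ⟨a, n⟩ han
    simp only [Finset.mem_coe, canonicalFractions, Finset.mem_filter, Finset.mem_product,
      Finset.mem_range, Finset.mem_Icc] at han
    obtain ⟨⟨-, hn1, hnq⟩, hlt, hcop⟩ := han
    obtain ⟨t, ht⟩ := hM n (Finset.mem_Icc.2 ⟨hn1, hnq⟩)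
    have ht0 : 0 < t := Nat.pos_of_ne_zero (by rintro rfl; omega)
    have hval : ((a * t : ℕ) : ZMod M).val = a * t := by
      rw [ZMod.val_natCast, Nat.mod_eq_of_lt]
      rw [ht]
      exact Nat.mul_lt_mul_of_pos_right hlt ht0
    have hgcd : M.gcd (a * t) = t := by
      rw [ht, Nat.gcd_mul_right, Nat.gcd_comm, hcop, one_mul]
    refine ⟨((a * t : ℕ) : ZMod M), ?_, ?_⟩
    · simp only [Finset.coe_filter, Finset.mem_univ, true_and, Set.mem_ofPred_eq]
      rw [hord, hval, hgcd, ht, Nat.mul_div_cancel _ ht0]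
      exact hnq
    · simp only [hval, hgcd]
      rw [ht, Nat.mul_div_cancel _ ht0, Nat.mul_div_cancel _ ht0]
  · intro γ _
    have hg : 0 < M.gcd γ.val := Nat.gcd_pos_of_pos_left _ hMpos
    dsimp only
    rw [Nat.cast_div (Nat.gcd_dvd_right _ _) (by positivity),
      Nat.cast_div (Nat.gcd_dvd_left _ _) (by positivity)]
    rw [div_div_div_cancel_right₀ (by positivity)]

lemma iwSymbol_mem_Icc {η : ℝ → ℝ} (hη : IsCutoff η) {W Q : ℝ} (hW : 0 < W)
    (hWQ : W * (⌊Q⌋₊ * ⌊Q⌋₊) ≤ 1) (ξ : ℝ) : iwSymbol η Q W ξ ∈ Set.Icc (0 : ℝ) 1 := by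
  have hnn : ∀ aq ∈ canonicalFractions Q, 0 ≤ η (W⁻¹ * ((ξ - (aq.1 : ℝ) / aq.2)
      - round (ξ - (aq.1 : ℝ) / aq.2))) := fun aq _ => (hη.mem_Icc _).1
  refine ⟨Finset.sum_nonneg hnn, ?_⟩
  by_cases hall : ∀ aq ∈ canonicalFractions Q, η (W⁻¹ * ((ξ - (aq.1 : ℝ) / aq.2)
      - round (ξ - (aq.1 : ℝ) / aq.2))) = 0
  · rw [iwSymbol, Finset.sum_eq_zero hall]
    exact zero_le_one
  push Not at hall
  obtain ⟨⟨a, n⟩, han, hne⟩ := hall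
  rw [iwSymbol, Finset.sum_eq_single (a, n)]
  · exact (hη.mem_Icc _).2
  · rintro ⟨b, m⟩ hbm hbmne
    by_contra hne'
    apply hbmne
    simp only [canonicalFractions, Finset.mem_filter, Finset.mem_product,
      Finset.mem_range, Finset.mem_Icc] at han hbm
    obtain ⟨⟨-, hn1, hnq⟩, hlt, hcop⟩ := han
    obtain ⟨⟨-, hm1, hmq⟩, hlt', hcop'⟩ := hbm
    have d1 : |(ξ - (a : ℝ) / n) - round (ξ - (a : ℝ) / n)| < W / 2 := by
      by_contra hcon; exact hne (hη.eta_eq_zero hW (not_lt.1 hcon))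
    have d2 : |(ξ - (b : ℝ) / m) - round (ξ - (b : ℝ) / m)| < W / 2 := by
      by_contra hcon; exact hne' (hη.eta_eq_zero hW (not_lt.1 hcon))
    set k := round (ξ - (a : ℝ) / n)
    set l := round (ξ - (b : ℝ) / m)
    have d3 : |(b : ℝ) / m - a / n + (l - k)| < W := by
      rw [show (b : ℝ) / m - a / n + (l - k) = (ξ - a / n - k) - (ξ - b / m - l) by ring]
      exact (abs_sub _ _).trans_lt (by linarith)
    have hn0 : (0 : ℝ) < n := by exact_mod_cast hn1
    have hm0 : (0 : ℝ) < m := by exact_mod_cast hm1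
    have d4 : |((b * n - a * m + (l - k) * (n * m) : ℤ) : ℝ)| < 1 := by
      have : ((b * n - a * m + (l - k) * (n * m) : ℤ) : ℝ)
          = ((b : ℝ) / m - a / n + (l - k)) * (n * m) := by
        push_cast
        field_simp
      rw [this, abs_mul, abs_of_pos (by positivity : (0 : ℝ) < n * m)]
      have h1 : (n : ℝ) ≤ ⌊Q⌋₊ := by exact_mod_cast hnq
      have h2 : (m : ℝ) ≤ ⌊Q⌋₊ := by exact_mod_cast hmq
      calc _ < W * (n * m) := by gcongr
        _ ≤ W * (⌊Q⌋₊ * ⌊Q⌋₊) := by gcongr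
        _ ≤ 1 := hWQ
    have d5 : (b * n - a * m + (l - k) * (n * m) : ℤ) = 0 := by
      by_contra hcon
      have : (1 : ℝ) ≤ |((b * n - a * m + (l - k) * (n * m) : ℤ) : ℝ)| := by
        exact_mod_cast Int.one_le_abs hcon
      linarith
    have d6 : l - k = 0 := by
      have e1 : (b : ℤ) * n < m * n := by
        have : b * n < m * n := Nat.mul_lt_mul_of_pos_right hlt' hn1
        exact_mod_cast this
      have e2 : (a : ℤ) * m < n * m := by
        have : a * m < n * m := Nat.mul_lt_mul_of_pos_right hlt hm1
        exact_mod_cast this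
      have e3 : (0 : ℤ) ≤ (b : ℤ) * n := by positivity
      have e4 : (0 : ℤ) ≤ (a : ℤ) * m := by positivity
      have e5 : (0 : ℤ) < n * m := by exact_mod_cast Nat.mul_pos hn1 hm1
      have e6 : -1 < l - k := by
        by_contra hcon
        have : (l - k) * (n * m : ℤ) ≤ (-1) * (n * m) :=
          mul_le_mul_of_nonneg_right (by omega) e5.le
        nlinarith
      have e7 : l - k < 1 := by
        by_contra hcon
        have : 1 * (n * m : ℤ) ≤ (l - k) * (n * m) :=
          mul_le_mul_of_nonneg_right (by omega) e5.le
        nlinarith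
      omega
    rw [d6, zero_mul, add_zero, sub_eq_zero] at d5
    have d7 : b * n = a * m := by exact_mod_cast d5
    have hmn : m ∣ n := (Nat.Coprime.symm hcop').dvd_of_dvd_mul_left ⟨a, by rw [d7]; ring⟩
    have hnm : n ∣ m := (Nat.Coprime.symm hcop).dvd_of_dvd_mul_left ⟨b, by rw [← d7]; ring⟩
    have hmn' := Nat.dvd_antisymm hmn hnm
    subst hmn'
    have := Nat.eq_of_mul_eq_mul_right hm1 d7
    rw [this]
  · intro h
    exact absurd han h

section FiniteSupport

variable {η : ℝ → ℝ} {W Q : ℝ} (S : Finset ℤ) (f : ℤ → ℂ)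

/-- The projection applied to the restriction of `f` to a finite set. -/
noncomputable def finProj (η : ℝ → ℝ) (Q W : ℝ) (S : Finset ℤ) (f : ℤ → ℂ) (n : ℤ) : ℂ :=
  ∑ m ∈ S, iwKernel η Q W (n - m) * f m

/-- The component of the restriction of `f` to a finite set at the frequency `γ / M`. -/
noncomputable def freqPart (η : ℝ → ℝ) (W : ℝ) (S : Finset ℤ) (f : ℤ → ℂ) {M : ℕ} [NeZero M]
    (γ : ZMod M) (n : ℤ) : ℂ :=
  ∑ m ∈ S, dilatedCoeff η W (n - m) * (ZMod.stdAddChar (γ * (m : ZMod M)) * f m)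

lemma bandLimited_freqPart (hη : IsCutoff η) (hW : 0 < W) {M : ℕ} [NeZero M] (γ : ZMod M) :
    BandLimited (W / 2) (freqPart η W S f γ) := by
  refine BandLimited.sum S fun m _ => ?_
  have := ((hη.bandLimited hW).translate m).const_mul (ZMod.stdAddChar (γ * (m : ZMod M)) * f m)
  simpa only [mul_comm] using this

lemma finProj_eq (hη : IsCutoff η) (hW : 0 < W) (hW1 : W ≤ 1) {M : ℕ} [NeZero M]
    (hM : ∀ n ∈ Finset.Icc 1 ⌊Q⌋₊, n ∣ M) (n : ℤ) :
    finProj η Q W S f n = ∑ γ : ZMod M with addOrderOf γ ≤ ⌊Q⌋₊,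
      ZMod.stdAddChar (γ * (-(n : ZMod M))) * freqPart η W S f γ n := by
  have hterm : ∀ m ∈ S, iwKernel η Q W (n - m) * f m
      = ∑ γ : ZMod M with addOrderOf γ ≤ ⌊Q⌋₊,
        e2pi (-(((n - m : ℤ) : ℝ) * (γ.val / M))) * dilatedCoeff η W (n - m) * f m := by
    intro m _
    rw [hη.iwKernel_eq hW hW1, sum_canonicalFractions hM
      (fun θ => e2pi (-(((n - m : ℤ) : ℝ) * θ)) * dilatedCoeff η W (n - m)), Finset.sum_mul]
  rw [finProj, Finset.sum_congr rfl hterm]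
  rw [Finset.sum_comm]
  refine Finset.sum_congr rfl fun γ _ => ?_
  rw [freqPart, Finset.mul_sum]
  refine Finset.sum_congr rfl fun m _ => ?_
  rw [mul_neg, AddChar.map_neg_eq_conj, stdAddChar_mul_intCast, stdAddChar_mul_intCast, conj_e2pi,
    show -(((n - m : ℤ) : ℝ) * (γ.val / M)) = -(n * (γ.val / M)) + m * (γ.val / M) by
      push_cast; ring, e2pi_add]
  ring

lemma summable_norm_iwKernel (hη : IsCutoff η) (hW : 0 < W) (hW1 : W ≤ 1) :
    Summable fun n => ‖iwKernel η Q W n‖ := by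
  have hs := hη.summable_norm_dilatedCoeff hW
  refine Summable.of_nonneg_of_le (fun n => norm_nonneg _) (fun n => ?_)
    (hs.mul_left ((canonicalFractions Q).card : ℝ))
  rw [hη.iwKernel_eq hW hW1]
  refine (norm_sum_le _ _).trans ?_
  simp [norm_e2pi]

lemma fourierSum_iwKernel (hη : IsCutoff η) (hW : 0 < W) (hW1 : W ≤ 1) (ξ : ℝ) :
    fourierSum (iwKernel η Q W) ξ = iwSymbol η Q W ξ := by
  have hs := hη.summable_norm_dilatedCoeff hW
  rw [hη.iwSymbol_eq hW hW1, fourierSum]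
  simp_rw [hη.iwKernel_eq hW hW1, Finset.sum_mul]
  have hterm : ∀ (θ : ℝ) (n : ℤ), e2pi (-(n * θ)) * dilatedCoeff η W n * e2pi (n * ξ)
      = dilatedCoeff η W n * e2pi (n * (ξ - θ)) := by
    intro θ n
    rw [show (n : ℝ) * (ξ - θ) = -(n * θ) + n * ξ by ring, e2pi_add]
    ring
  simp_rw [hterm]
  rw [Summable.tsum_finsetSum fun aq _ => summable_mul_e2pi hs _]
  rfl

lemma summable_norm_finProj (hη : IsCutoff η) (hW : 0 < W) (hW1 : W ≤ 1) :
    Summable fun n => ‖finProj η Q W S f n‖ := by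
  refine Summable.of_nonneg_of_le (fun n => norm_nonneg _) (fun n => norm_sum_le _ _) ?_
  refine summable_sum fun m _ => ?_
  simp_rw [norm_mul]
  exact ((Equiv.subRight m).summable_iff.2 (summable_norm_iwKernel hη hW hW1)).mul_right _

lemma fourierSum_finProj (hη : IsCutoff η) (hW : 0 < W) (hW1 : W ≤ 1) (ξ : ℝ) :
    fourierSum (finProj η Q W S f) ξ
      = iwSymbol η Q W ξ * ∑ m ∈ S, f m * e2pi (m * ξ) := by
  have hs := summable_norm_iwKernel (Q := Q) hη hW hW1
  have h1 : ∀ m : ℤ, Summable fun n => iwKernel η Q W (n - m) * e2pi (n * ξ) := fun m =>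
    summable_mul_e2pi (h := fun n => iwKernel η Q W (n - m))
      ((Equiv.subRight m).summable_iff.2 hs) ξ
  rw [fourierSum]
  simp_rw [finProj, Finset.sum_mul]
  rw [Summable.tsum_finsetSum fun m _ => by
    simpa only [mul_right_comm] using (h1 m).mul_right (f m)]
  rw [Finset.mul_sum]
  refine Finset.sum_congr rfl fun m _ => ?_
  have h2 := fourierSum_translate (iwKernel η Q W) m ξ
  rw [fourierSum_iwKernel hη hW hW1, fourierSum] at h2
  simp_rw [mul_right_comm _ (f m)]
  rw [tsum_mul_right, h2]
  ring

lemma tsum_norm_sq_finProj_le (hη : IsCutoff η) (hW : 0 < W) (hW1 : W ≤ 1)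
    (hWQ : W * (⌊Q⌋₊ * ⌊Q⌋₊) ≤ 1) :
    ∑' n, ‖finProj η Q W S f n‖ ^ 2 ≤ ∑ m ∈ S, ‖f m‖ ^ 2 := by
  classical
  set g : ℤ → ℂ := fun m => if m ∈ S then f m else 0 with hg
  have hgs : Summable fun m => ‖g m‖ :=
    summable_of_ne_finset_zero (s := S) fun m hm => by simp [hg, hm]
  have hgf : ∀ ξ, fourierSum g ξ = ∑ m ∈ S, f m * e2pi (m * ξ) := by
    intro ξ
    rw [fourierSum, tsum_eq_sum (s := S) fun m hm => by simp [hg, hm]]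
    exact Finset.sum_congr rfl fun m hm => by simp [hg, hm]
  have hsq : ∑' n, ‖g n‖ ^ 2 = ∑ m ∈ S, ‖f m‖ ^ 2 := by
    rw [tsum_eq_sum (s := S) fun m hm => by simp [hg, hm]]
    exact Finset.sum_congr rfl fun m hm => by simp [hg, hm]
  rw [← hsq, tsum_norm_sq_eq_integral (summable_norm_finProj S f hη hW hW1),
    tsum_norm_sq_eq_integral hgs]
  refine intervalIntegral.integral_mono_on zero_le_one ?_ ?_ fun τ _ => ?_
  · have := continuous_fourierSum (summable_norm_finProj (Q := Q) S f hη hW hW1)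
    exact Continuous.intervalIntegrable (by fun_prop) _ _
  · have := continuous_fourierSum hgs
    exact Continuous.intervalIntegrable (by fun_prop) _ _
  · rw [fourierSum_finProj S f hη hW hW1, ← hgf, norm_mul, Complex.norm_real]
    have := iwSymbol_mem_Icc hη hW hWQ τ
    have h1 : ‖iwSymbol η Q W τ‖ ≤ 1 := by
      rw [Real.norm_of_nonneg this.1]; exact this.2
    refine pow_le_pow_left₀ (by positivity) ?_ 2
    exact mul_le_of_le_one_left (norm_nonneg _) h1

end FiniteSupport

lemma lintegral_rpow_mul_indicator_lt {e t : ℝ} (he : 0 < e) (ht : 0 ≤ t) :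
    ∫⁻ l in Set.Ioi (0 : ℝ), ENNReal.ofReal (l ^ (e - 1)) * (if l < t then 1 else 0)
      = ENNReal.ofReal (t ^ e / e) := by
  have h1 : ∀ l : ℝ, ENNReal.ofReal (l ^ (e - 1)) * (if l < t then 1 else 0)
      = (Set.Iio t).indicator (fun l => ENNReal.ofReal (l ^ (e - 1))) l := by
    intro l
    by_cases hl : l < t
    · simp [hl]
    · simp [hl]
  simp_rw [h1]
  rw [setLIntegral_indicator measurableSet_Iio, Set.inter_comm, Set.Ioi_inter_Iio,
    setLIntegral_congr Ioo_ae_eq_Ioc]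
  have hi : IntervalIntegrable (fun l : ℝ => l ^ (e - 1)) volume 0 t :=
    intervalIntegral.intervalIntegrable_rpow' (by linarith)
  rw [← ofReal_integral_eq_lintegral_ofReal
    ((intervalIntegrable_iff_integrableOn_Ioc_of_le ht).1 hi)
    ((ae_restrict_iff' measurableSet_Ioc).2 (ae_of_all _ fun l hl => Real.rpow_nonneg hl.1.le _)),
    ← intervalIntegral.integral_of_le ht, integral_rpow (Or.inl (by linarith))]
  simp [Real.zero_rpow he.ne']

lemma lintegral_rpow_mul_indicator_not_lt {e t : ℝ} (he : e < 0) (ht : 0 < t) :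
    ∫⁻ l in Set.Ioi (0 : ℝ), ENNReal.ofReal (l ^ (e - 1)) * (if ¬ l < t then 1 else 0)
      = ENNReal.ofReal (t ^ e / (-e)) := by
  have h1 : ∀ l : ℝ, ENNReal.ofReal (l ^ (e - 1)) * (if ¬ l < t then 1 else 0)
      = (Set.Ici t).indicator (fun l => ENNReal.ofReal (l ^ (e - 1))) l := by
    intro l
    by_cases hl : l < t
    · simp [hl]
    · simp [hl, not_lt.1 hl]
  simp_rw [h1]
  rw [setLIntegral_indicator measurableSet_Ici,
    Set.inter_eq_left.2 (Set.Ici_subset_Ioi.2 ht), setLIntegral_congr Ioi_ae_eq_Ici.symm]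
  rw [← ofReal_integral_eq_lintegral_ofReal
    (integrableOn_Ioi_rpow_of_lt (by linarith) ht)
    ((ae_restrict_iff' measurableSet_Ioi).2
      (ae_of_all _ fun l hl => Real.rpow_nonneg (ht.trans hl).le _)),
    integral_Ioi_rpow_of_lt (by linarith) ht]
  simp [neg_div, div_neg]

/-- Marcinkiewicz interpolation: a bound on the distribution function of `g` in terms of the
truncations of `a` gives a bound for the `p`-th power sum of `g`. -/
lemma tsum_rpow_le_of_distribution {Y : Type*} [Countable Y] {g : Y → ℝ} (hg : ∀ y, 0 ≤ g y)
    {p s K₁ K₂ c : ℝ} (hp : 2 < p) (hs : p < s) (hK₁ : 0 ≤ K₁) (hK₂ : 0 ≤ K₂) (hc : 0 < c)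
    (S : Finset ℤ) {a : ℤ → ℝ} (ha : ∀ m, 0 ≤ a m)
    (h : ∀ l : ℝ, 0 < l → ∑' y, (if l < g y then (1 : ℝ≥0∞) else 0)
      ≤ ENNReal.ofReal (K₁ * l ^ (-2 : ℝ) * ∑ m ∈ S with l < c * a m, a m ^ (2 : ℝ)
        + K₂ * l ^ (-s) * ∑ m ∈ S with ¬ l < c * a m, a m ^ s)) :
    ∑' y, ENNReal.ofReal (g y ^ p)
      ≤ ENNReal.ofReal (p * (K₁ * c ^ (p - 2) / (p - 2) + K₂ * c ^ (p - s) / (s - p))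
        * ∑ m ∈ S, a m ^ p) := by
  have hp0 : 0 < p := by linarith
  have hmeas : ∀ e : ℝ, Measurable fun l : ℝ => ENNReal.ofReal (l ^ (e - 1)) := fun e => by fun_prop
  have hind : ∀ t : ℝ, Measurable fun l : ℝ => if l < t then (1 : ℝ≥0∞) else 0 := fun t =>
    Measurable.ite measurableSet_Iio measurable_const measurable_const
  have hind' : ∀ t : ℝ, Measurable fun l : ℝ => if ¬ l < t then (1 : ℝ≥0∞) else 0 := fun t =>
    Measurable.ite measurableSet_Iio.compl measurable_const measurable_const
  calc ∑' y, ENNReal.ofReal (g y ^ p)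
      = ∑' y, ENNReal.ofReal p * ∫⁻ l in Set.Ioi (0 : ℝ),
          ENNReal.ofReal (l ^ (p - 1)) * (if l < g y then 1 else 0) := by
        refine tsum_congr fun y => ?_
        rw [lintegral_rpow_mul_indicator_lt hp0 (hg y), ← ENNReal.ofReal_mul hp0.le,
          mul_div_cancel₀ _ hp0.ne']
    _ = ENNReal.ofReal p * ∫⁻ l in Set.Ioi (0 : ℝ),
          ENNReal.ofReal (l ^ (p - 1)) * ∑' y, (if l < g y then 1 else 0) := by
        have m0 : ∀ y, AEMeasurable (fun l : ℝ => ENNReal.ofReal (l ^ (p - 1)) *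
            (if l < g y then 1 else 0)) (volume.restrict (Set.Ioi 0)) := fun y =>
          ((hmeas p).mul (hind (g y))).aemeasurable
        rw [ENNReal.tsum_mul_left, ← lintegral_tsum m0]
        simp_rw [ENNReal.tsum_mul_left]
    _ ≤ ENNReal.ofReal p * ∫⁻ l in Set.Ioi (0 : ℝ), ∑ m ∈ S,
          (ENNReal.ofReal (K₁ * a m ^ (2 : ℝ)) *
              (ENNReal.ofReal (l ^ (p - 2 - 1)) * (if l < c * a m then 1 else 0))
            + ENNReal.ofReal (K₂ * a m ^ s) *
              (ENNReal.ofReal (l ^ (p - s - 1)) * (if ¬ l < c * a m then 1 else 0))) := by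
        refine mul_le_mul_right ?_ _
        refine setLIntegral_mono' measurableSet_Ioi fun l hl => ?_
        have hl : 0 < l := hl
        refine (mul_le_mul_right (h l hl) _).trans ?_
        rw [← ENNReal.ofReal_mul (by positivity), mul_add, ENNReal.ofReal_add (by
            refine mul_nonneg (by positivity) (mul_nonneg (by positivity)
              (Finset.sum_nonneg fun m _ => Real.rpow_nonneg (ha m) _))) (by
            refine mul_nonneg (by positivity) (mul_nonneg (by positivity)
              (Finset.sum_nonneg fun m _ => Real.rpow_nonneg (ha m) _))), Finset.sum_add_distrib]
        have e1 : ∀ e : ℝ, l ^ (p - 1) * l ^ (-e) = l ^ (p - e - 1) := by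
          intro e
          rw [← Real.rpow_add hl]
          ring_nf
        refine add_le_add (le_of_eq ?_) (le_of_eq ?_)
        · rw [Finset.sum_filter, show ∀ b : ℝ, l ^ (p - 1) * (K₁ * l ^ (-2 : ℝ) * b)
            = (K₁ * l ^ (p - 2 - 1)) * b from fun b => by rw [← e1]; ring, Finset.mul_sum,
            ENNReal.ofReal_sum_of_nonneg]
          · refine Finset.sum_congr rfl fun m _ => ?_
            split_ifs
            · rw [mul_one, ← ENNReal.ofReal_mul (mul_nonneg hK₁ (Real.rpow_nonneg (ha m) _))]
              ring_nf
            · simp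
          · intro m _
            have := Real.rpow_nonneg (ha m) 2
            split_ifs <;> positivity
        · rw [Finset.sum_filter, show ∀ b : ℝ, l ^ (p - 1) * (K₂ * l ^ (-s : ℝ) * b)
            = (K₂ * l ^ (p - s - 1)) * b from fun b => by rw [← e1]; ring, Finset.mul_sum,
            ENNReal.ofReal_sum_of_nonneg]
          · refine Finset.sum_congr rfl fun m _ => ?_
            by_cases hm : l < c * a m
            · simp [hm]
            · rw [if_pos hm, if_pos hm]
              rw [mul_one, ← ENNReal.ofReal_mul (mul_nonneg hK₂ (Real.rpow_nonneg (ha m) _))]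
              ring_nf
          · intro m _
            have := Real.rpow_nonneg (ha m) s
            split_ifs <;> positivity
    _ = ENNReal.ofReal p * ∑ m ∈ S, ((∫⁻ l in Set.Ioi (0 : ℝ),
          ENNReal.ofReal (K₁ * a m ^ (2 : ℝ)) *
              (ENNReal.ofReal (l ^ (p - 2 - 1)) * (if l < c * a m then 1 else 0)))
            + ∫⁻ l in Set.Ioi (0 : ℝ), ENNReal.ofReal (K₂ * a m ^ s) *
              (ENNReal.ofReal (l ^ (p - s - 1)) * (if ¬ l < c * a m then 1 else 0))) := by
        have m1 : ∀ m, Measurable fun l : ℝ => ENNReal.ofReal (K₁ * a m ^ (2 : ℝ)) *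
              (ENNReal.ofReal (l ^ (p - 2 - 1)) * (if l < c * a m then 1 else 0)) := fun m =>
          measurable_const.mul ((hmeas _).mul (hind _))
        have m2 : ∀ m, Measurable fun l : ℝ => ENNReal.ofReal (K₂ * a m ^ s) *
              (ENNReal.ofReal (l ^ (p - s - 1)) * (if ¬ l < c * a m then 1 else 0)) := fun m =>
          measurable_const.mul ((hmeas _).mul (hind' _))
        rw [lintegral_finsetSum S (f := fun m (l : ℝ) =>
          ENNReal.ofReal (K₁ * a m ^ (2 : ℝ)) *
              (ENNReal.ofReal (l ^ (p - 2 - 1)) * (if l < c * a m then 1 else 0))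
            + ENNReal.ofReal (K₂ * a m ^ s) *
              (ENNReal.ofReal (l ^ (p - s - 1)) * (if ¬ l < c * a m then 1 else 0)))
          fun m _ => (m1 m).add (m2 m)]
        congr 1
        exact Finset.sum_congr rfl fun m _ => lintegral_add_left (m1 m) _
    _ ≤ ENNReal.ofReal p * ∑ m ∈ S, ENNReal.ofReal
          ((K₁ * c ^ (p - 2) / (p - 2) + K₂ * c ^ (p - s) / (s - p)) * a m ^ p) := by
        gcongr with m hm
        rw [lintegral_const_mul' _ _ ENNReal.ofReal_ne_top,
          lintegral_const_mul' _ _ ENNReal.ofReal_ne_top,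
          lintegral_rpow_mul_indicator_lt (by linarith) (mul_nonneg hc.le (ha m)),
          ← ENNReal.ofReal_mul (mul_nonneg hK₁ (Real.rpow_nonneg (ha m) _))]
        rcases (ha m).eq_or_lt with h0 | h0
        · rw [← h0]
          simp [Real.zero_rpow, hp0.ne', (hp0.trans hs).ne', (sub_pos.2 hp).ne']
        · rw [lintegral_rpow_mul_indicator_not_lt (by linarith) (mul_pos hc h0),
            ← ENNReal.ofReal_mul (by positivity), ← ENNReal.ofReal_add
              (by have := sub_pos.2 hp; positivity)
              (by have := sub_pos.2 hs; rw [neg_sub]; positivity)]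
          refine le_of_eq (congrArg _ ?_)
          have e2 : ∀ e, a m ^ e * (c * a m) ^ (p - e) = c ^ (p - e) * a m ^ p := by
            intro e
            rw [Real.mul_rpow hc.le h0.le, mul_left_comm, ← Real.rpow_add h0]
            ring_nf
          rw [neg_sub, add_mul, ← mul_div_assoc, ← mul_div_assoc, mul_assoc, e2, mul_assoc K₂, e2]
          ring
    _ = _ := by
        have hA : 0 ≤ K₁ * c ^ (p - 2) / (p - 2) + K₂ * c ^ (p - s) / (s - p) := by
          have := sub_pos.2 hp
          have := sub_pos.2 hs
          positivity
        rw [← ENNReal.ofReal_sum_of_nonneg fun m _ => mul_nonneg hA (Real.rpow_nonneg (ha m) _),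
          ← Finset.mul_sum, ← ENNReal.ofReal_mul hp0.le, mul_assoc]

/-- Chebyshev's inequality for sums. -/
lemma tsum_indicator_le {Y : Type*} {g h : Y → ℝ} {l e : ℝ} (hl : 0 < l)
    (he : 0 < e) (hgh : ∀ y, l < g y → l ≤ h y) :
    ∑' y, (if l < g y then (1 : ℝ≥0∞) else 0)
      ≤ ENNReal.ofReal (l ^ (-e)) * ∑' y, ENNReal.ofReal (h y ^ e) := by
  rw [← ENNReal.tsum_mul_left]
  refine ENNReal.tsum_le_tsum fun y => ?_
  split_ifs with hy
  · rw [← ENNReal.ofReal_mul (by positivity), Real.rpow_neg hl.le, ENNReal.one_le_ofReal,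
      inv_mul_eq_div, one_le_div (by positivity)]
    exact Real.rpow_le_rpow hl.le (hgh y hy) he.le
  · exact zero_le

/-- The weight `1 / (1 + t²(y - c)²)`. -/
noncomputable def cauchyWeight (t c y : ℝ) : ℝ := (1 + (t * (y - c)) ^ 2)⁻¹

lemma cauchyWeight_pos (t c y : ℝ) : 0 < cauchyWeight t c y := by
  unfold cauchyWeight; positivity

lemma mul_cauchyWeight_le {t : ℝ} (ht : 0 < t) (ht1 : t ≤ 1) (c y : ℝ) :
    t * cauchyWeight t c y
      ≤ 3 * (Real.arctan (t * (y + 1 - c)) - Real.arctan (t * (y - c))) := by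
  obtain ⟨x, hx, hd⟩ := exists_hasDerivAt_eq_slope Real.arctan (fun x => 1 / (1 + x ^ 2))
    (show t * (y - c) < t * (y + 1 - c) by nlinarith) Real.continuous_arctan.continuousOn
    (fun x _ => Real.hasDerivAt_arctan x)
  have h1 : t * (y + 1 - c) - t * (y - c) = t := by ring
  rw [h1, eq_div_iff ht.ne'] at hd
  rw [← hd, cauchyWeight, ← div_eq_mul_inv, one_div_mul_eq_div, ← mul_div_assoc,
    div_le_div_iff₀ (by positivity) (by positivity)]
  have h2 : (x - t * (y - c)) ^ 2 ≤ 1 := by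
    have := hx.1
    have := hx.2
    rw [sq_le_one_iff_abs_le_one, abs_le]
    constructor <;> linarith
  have h3 : 1 + x ^ 2 ≤ 3 * (1 + (t * (y - c)) ^ 2) := by
    nlinarith [sq_nonneg (x - 2 * (t * (y - c)))]
  nlinarith

lemma sum_cauchyWeight_le {t : ℝ} (ht : 0 < t) (ht1 : t ≤ 1) (c : ℝ) (U : Finset ℤ) :
    ∑ j ∈ U, cauchyWeight t c j ≤ 10 / t := by
  obtain ⟨N, hN⟩ : ∃ N : ℕ, ∀ j ∈ U, |j| < N := by
    refine ⟨(U.sup fun j => j.natAbs) + 1, fun j hj => ?_⟩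
    have := Finset.le_sup (f := fun j : ℤ => j.natAbs) hj
    rw [Int.abs_eq_natAbs]
    push_cast
    have h2 : (j.natAbs : ℤ) ≤ ((U.sup fun j => j.natAbs : ℕ) : ℤ) := by exact_mod_cast this
    linarith
  have hsub : U ⊆ (Finset.range (2 * N)).image fun i : ℕ => (-N + i : ℤ) := by
    intro j hj
    have := abs_lt.1 (hN j hj)
    exact Finset.mem_image.2 ⟨(j + N).toNat, Finset.mem_range.2 (by omega), by omega⟩
  have h1 : ∑ j ∈ U, t * cauchyWeight t c j ≤ 3 * (Real.arctan (t * ((-N : ℝ) + (2 * N : ℕ) - c))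
      - Real.arctan (t * ((-N : ℝ) + (0 : ℕ) - c))) := by
    calc _ ≤ ∑ j ∈ (Finset.range (2 * N)).image fun i : ℕ => (-N + i : ℤ),
          t * cauchyWeight t c j :=
          Finset.sum_le_sum_of_subset_of_nonneg hsub fun j _ _ =>
            mul_nonneg ht.le (cauchyWeight_pos _ _ _).le
      _ = ∑ i ∈ Finset.range (2 * N), t * cauchyWeight t c (-N + i : ℤ) :=
          Finset.sum_image fun i _ i' _ h => by simpa using h
      _ ≤ ∑ i ∈ Finset.range (2 * N), 3 * (Real.arctan (t * ((-N : ℝ) + (i + 1 : ℕ) - c))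
            - Real.arctan (t * ((-N : ℝ) + i - c))) := by
          refine Finset.sum_le_sum fun i _ => (mul_cauchyWeight_le ht ht1 c _).trans (le_of_eq ?_)
          push_cast
          rw [add_assoc (-(N : ℝ))]
      _ = _ := by
          rw [← Finset.mul_sum, Finset.sum_range_sub
            fun i : ℕ => Real.arctan (t * ((-N : ℝ) + i - c))]
  rw [← Finset.mul_sum] at h1
  rw [le_div_iff₀' ht]
  have h2 := Real.arctan_lt_pi_div_two (t * ((-N : ℝ) + (2 * N : ℕ) - c))
  have h3 := Real.neg_pi_div_two_lt_arctan (t * ((-N : ℝ) + (0 : ℕ) - c))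
  generalize Real.arctan (t * ((-N : ℝ) + (2 * N : ℕ) - c)) = x at h1 h2
  generalize Real.arctan (t * ((-N : ℝ) + (0 : ℕ) - c)) = y at h1 h3
  have := Real.pi_lt_d2
  norm_num at this
  linarith

lemma summable_cauchyWeight {t : ℝ} (ht : 0 < t) (ht1 : t ≤ 1) (c : ℝ) :
    Summable fun j : ℤ => cauchyWeight t c j :=
  summable_of_sum_le (fun _ => (cauchyWeight_pos _ _ _).le) (sum_cauchyWeight_le ht ht1 c)

lemma tsum_cauchyWeight_le {t : ℝ} (ht : 0 < t) (ht1 : t ≤ 1) (c : ℝ) :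
    ∑' j : ℤ, cauchyWeight t c j ≤ 10 / t :=
  Real.tsum_le_of_sum_le (fun _ => (cauchyWeight_pos _ _ _).le) (sum_cauchyWeight_le ht ht1 c)

lemma abs_cauchyWeight_sub_le {t : ℝ} (ht : 0 < t) (ht1 : t ≤ 1) (c y : ℝ) :
    |cauchyWeight t c y - cauchyWeight t c (y - 1)| ≤ 2 * t * cauchyWeight t c y := by
  set a := t * (y - c) with ha
  have hb : t * (y - 1 - c) = a - t := by rw [ha]; ring
  rw [cauchyWeight, cauchyWeight, hb, ← ha]
  have h1 : (1 + a ^ 2)⁻¹ - (1 + (a - t) ^ 2)⁻¹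
      = (1 + a ^ 2)⁻¹ * (t * (t - 2 * a) * (1 + (a - t) ^ 2)⁻¹) := by
    field_simp
    ring
  rw [h1, abs_mul, abs_of_pos (by positivity), mul_comm (2 * t)]
  refine mul_le_mul_of_nonneg_left ?_ (by positivity)
  rw [abs_mul, abs_mul, abs_of_pos ht, abs_of_pos (by positivity : 0 < (1 + (a - t) ^ 2)⁻¹),
    ← div_eq_mul_inv, div_le_iff₀ (by positivity), mul_comm 2 t, mul_assoc]
  refine mul_le_mul_of_nonneg_left ?_ ht.le
  rw [abs_le]
  constructor <;> nlinarith [sq_nonneg (a - t - 1), sq_nonneg (a - t + 1), sq_nonneg (a - t)]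

lemma norm_fourierSum_cauchyWeight_mul_le {t : ℝ} (ht : 0 < t) (ht1 : t ≤ 1) (c θ : ℝ) :
    ‖fourierSum (fun j => (cauchyWeight t c j : ℂ)) θ‖ * ‖1 - e2pi θ‖ ≤ 20 := by
  have hs := summable_cauchyWeight ht ht1 c
  have hs1 : Summable fun j : ℤ => ‖(cauchyWeight t c j : ℂ)‖ := by
    simpa only [Complex.norm_real, Real.norm_of_nonneg (cauchyWeight_pos _ _ _).le] using hs
  have hs2 : Summable fun j : ℤ => ‖(cauchyWeight t c (j - 1 : ℤ) : ℂ)‖ :=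
    (Equiv.subRight (1 : ℤ)).summable_iff.2 hs1
  have h1 := fourierSum_translate (fun j => (cauchyWeight t c j : ℂ)) 1 θ
  have h2 : fourierSum (fun j => (cauchyWeight t c j : ℂ)) θ * (1 - e2pi θ)
      = fourierSum (fun j => ((cauchyWeight t c j - cauchyWeight t c (j - 1) : ℝ) : ℂ)) θ := by
    rw [Int.cast_one, one_mul] at h1
    rw [mul_sub, mul_one, mul_comm _ (e2pi θ), ← h1, fourierSum, fourierSum,
      ← (summable_mul_e2pi hs1 θ).tsum_sub (summable_mul_e2pi hs2 θ)]
    refine tsum_congr fun j => ?_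
    push_cast
    ring
  rw [← norm_mul, h2]
  have hb : ∀ j : ℤ, ‖((cauchyWeight t c j - cauchyWeight t c (j - 1) : ℝ) : ℂ)‖
      ≤ 2 * t * cauchyWeight t c j := fun j => by
    rw [Complex.norm_real]
    exact abs_cauchyWeight_sub_le ht ht1 c j
  have hs3 : Summable fun j : ℤ => ‖((cauchyWeight t c j - cauchyWeight t c (j - 1) : ℝ) : ℂ)‖ :=
    Summable.of_nonneg_of_le (fun _ => norm_nonneg _) hb (hs.mul_left _)
  refine (norm_fourierSum_le hs3 θ).trans ?_
  calc _ ≤ ∑' j : ℤ, 2 * t * cauchyWeight t c j := hs3.tsum_le_tsum hb (hs.mul_left _)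
    _ ≤ 2 * t * (10 / t) := by
        rw [tsum_mul_left]
        exact mul_le_mul_of_nonneg_left (tsum_cauchyWeight_le ht ht1 c) (by positivity)
    _ = 20 := by field_simp; norm_num

lemma four_mul_le_norm_one_sub_e2pi {θ a : ℝ} (h : ∀ k : ℤ, a ≤ |θ - k|) :
    4 * a ≤ ‖1 - e2pi θ‖ := by
  have h1 : e2pi θ = Complex.exp (Complex.I * ((2 * π * (θ - round θ) : ℝ) : ℂ)) := by
    have h2 : e2pi θ = e2pi (θ - round θ) := by
      conv_lhs => rw [show θ = (θ - round θ) + (round θ : ℤ) by ring, e2pi_add, e2pi_int, mul_one]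
    rw [h2, e2pi]
    congr 1
    push_cast
    ring
  rw [norm_sub_rev, h1, Complex.norm_exp_I_mul_ofReal_sub_one, norm_mul, Real.norm_ofNat,
    Real.norm_eq_abs]
  have h3 := abs_sub_round θ
  have h4 : |2 * π * (θ - round θ) / 2| = π * |θ - round θ| := by
    rw [show 2 * π * (θ - round θ) / 2 = π * (θ - round θ) by ring, abs_mul,
      abs_of_pos Real.pi_pos]
  have h5 := Real.mul_abs_le_abs_sin (x := 2 * π * (θ - round θ) / 2) (by
    rw [h4]; nlinarith [Real.pi_pos])
  rw [h4, ← mul_assoc, div_mul_cancel₀ _ Real.pi_ne_zero] at h5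
  have := h (round θ)
  linarith

lemma sum_norm_sq_le_of_dual {ι : Type*} (B : Finset ι) (P : Finset ℤ) {v : ℤ → ℝ}
    (hv : ∀ m ∈ P, 0 ≤ v m) {χ : ι → ℤ → ℂ} {E a : ℝ} (hE0 : 0 ≤ E)
    (hE : ∀ b : ι → ℂ, ∑ m ∈ P, v m * ‖∑ β ∈ B, b β * χ β m‖ ^ 2 ≤ E * ∑ β ∈ B, ‖b β‖ ^ 2)
    {g : ℤ → ℂ} (hg : ∀ m ∈ P, ‖g m‖ ≤ a * v m) :
    ∑ β ∈ B, ‖∑ m ∈ P, g m * χ β m‖ ^ 2 ≤ a ^ 2 * E * ∑ m ∈ P, v m := by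
  set b : ι → ℂ := fun β => ∑ m ∈ P, g m * χ β m with hb
  set X := ∑ β ∈ B, ‖b β‖ ^ 2 with hX
  have hX0 : 0 ≤ X := Finset.sum_nonneg fun _ _ => by positivity
  set y : ℤ → ℝ := fun m => ‖∑ β ∈ B, (starRingEnd ℂ) (b β) * χ β m‖ with hy
  have h1 : X ≤ a * ∑ m ∈ P, v m * y m := by
    have h2 : (X : ℂ) = ∑ m ∈ P, g m * ∑ β ∈ B, (starRingEnd ℂ) (b β) * χ β m := by
      rw [hX]
      push_cast
      simp_rw [← Complex.conj_mul', Finset.mul_sum]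
      rw [Finset.sum_comm]
      refine Finset.sum_congr rfl fun β _ => ?_
      conv_lhs => rw [hb]
      simp only
      rw [Finset.mul_sum]
      exact Finset.sum_congr rfl fun m _ => by ring
    have h3 : X = ‖(X : ℂ)‖ := by rw [Complex.norm_real, Real.norm_of_nonneg hX0]
    rw [h3, h2, Finset.mul_sum]
    refine (norm_sum_le _ _).trans (Finset.sum_le_sum fun m hm => ?_)
    rw [norm_mul, ← mul_assoc]
    exact mul_le_mul_of_nonneg_right (hg m hm) (norm_nonneg _)
  have h4 : (∑ m ∈ P, v m * y m) ^ 2 ≤ (∑ m ∈ P, v m) * (E * X) := by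
    have h5 : (∑ m ∈ P, v m * y m) ^ 2
        ≤ (∑ m ∈ P, v m) * ∑ m ∈ P, v m * y m ^ 2 :=
      Finset.sum_sq_le_sum_mul_sum_of_sq_le_mul _ hv
        (fun m hm => mul_nonneg (hv m hm) (sq_nonneg _)) fun m _ => by
          rw [mul_pow]; nlinarith
    refine h5.trans (mul_le_mul_of_nonneg_left ?_ (Finset.sum_nonneg hv))
    have := hE fun β => (starRingEnd ℂ) (b β)
    simpa only [RCLike.norm_conj] using this
  have h6 : X ^ 2 ≤ (a ^ 2 * E * ∑ m ∈ P, v m) * X := by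
    calc X ^ 2 ≤ (a * ∑ m ∈ P, v m * y m) ^ 2 := pow_le_pow_left₀ hX0 h1 2
      _ = a ^ 2 * (∑ m ∈ P, v m * y m) ^ 2 := by ring
      _ ≤ a ^ 2 * ((∑ m ∈ P, v m) * (E * X)) := by gcongr
      _ = _ := by ring
  rcases hX0.eq_or_lt with h0 | h0
  · rw [← h0]
    exact mul_nonneg (mul_nonneg (sq_nonneg _) hE0) (Finset.sum_nonneg hv)
  · rw [sq] at h6
    exact le_of_mul_le_mul_right h6 h0

section Progression

variable {M : ℕ} [NeZero M] {d q : ℕ} {W : ℝ}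

lemma sum_le_tsum_progression (hd : 0 < d) {m₀ : ℤ} {P : Finset ℤ}
    (hP : ∀ m ∈ P, (d : ℤ) ∣ m - m₀) {F : ℤ → ℝ} (hF : ∀ m, 0 ≤ F m)
    (hs : Summable fun j : ℤ => F (m₀ + d * j)) : ∑ m ∈ P, F m ≤ ∑' j : ℤ, F (m₀ + d * j) := by
  have hd' : (d : ℤ) ≠ 0 := by exact_mod_cast hd.ne'
  have h1 : ∀ m ∈ P, m₀ + d * ((m - m₀) / d) = m := fun m hm => by
    rw [Int.mul_ediv_cancel' (hP m hm)]; ring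
  have h2 : ∑ m ∈ P, F m = ∑ j ∈ P.image fun m => (m - m₀) / d, F (m₀ + d * j) := by
    rw [Finset.sum_image fun m hm m' hm' h => by
      rw [← h1 m hm, ← h1 m' hm', h]]
    exact Finset.sum_congr rfl fun m hm => by rw [h1 m hm]
  rw [h2]
  exact hs.sum_le_tsum _ fun j _ => hF _

lemma cauchyWeight_progression (hd : 0 < d) (n m₀ j : ℤ) :
    cauchyWeight W n (m₀ + d * j : ℤ) = cauchyWeight (W * d) ((n - m₀) / d) j := by
  have hd' : (d : ℝ) ≠ 0 := by exact_mod_cast hd.ne'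
  rw [cauchyWeight, cauchyWeight]
  congr 3
  push_cast
  field_simp
  ring

lemma sum_cauchyWeight_progression_le (hW : 0 < W) (hd : 0 < d) (hWd : W * d ≤ 1) (n : ℤ) {m₀ : ℤ}
    {P : Finset ℤ} (hP : ∀ m ∈ P, (d : ℤ) ∣ m - m₀) :
    ∑ m ∈ P, cauchyWeight W n m ≤ 10 / (W * d) := by
  have ht : 0 < W * d := by positivity
  refine (sum_le_tsum_progression hd hP (F := fun m => cauchyWeight W n m)
    (fun m => (cauchyWeight_pos _ _ _).le) ?_).trans ?_
  · simp_rw [cauchyWeight_progression hd]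
    exact summable_cauchyWeight ht hWd _
  · simp_rw [cauchyWeight_progression hd]
    exact tsum_cauchyWeight_le ht hWd _

lemma norm_fourierSum_cauchyWeight_le_of_order (hW : 0 < W) (hW1 : W ≤ 1) (c : ℝ) {γ : ZMod M}
    (hγ0 : γ ≠ 0) (hγ : addOrderOf γ ≤ q * q) :
    ‖fourierSum (fun j => (cauchyWeight W c j : ℂ)) (γ.val / M)‖ ≤ 5 * (q * q) := by
  have ho : (0 : ℝ) < addOrderOf γ := by exact_mod_cast addOrderOf_pos γ
  have ho' : (addOrderOf γ : ℝ) ≤ q * q := by exact_mod_cast hγ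
  have h1 : 4 * (1 / (q * q : ℝ)) ≤ ‖1 - e2pi (γ.val / M)‖ := by
    refine four_mul_le_norm_one_sub_e2pi fun k => ?_
    have := one_le_addOrderOf_mul_abs hγ0 k
    rw [div_le_iff₀' (ho.trans_le ho')]
    exact this.trans (mul_le_mul_of_nonneg_right ho' (abs_nonneg _))
  have h2 := norm_fourierSum_cauchyWeight_mul_le hW hW1 c (γ.val / M)
  set X := ‖fourierSum (fun j => (cauchyWeight W c j : ℂ)) (γ.val / M)‖
  have h3 : X * (4 * (1 / (q * q : ℝ))) ≤ 20 :=
    (mul_le_mul_of_nonneg_left h1 (norm_nonneg _)).trans h2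
  have hq : (0 : ℝ) < q * q := ho.trans_le ho'
  rw [← mul_assoc, mul_one_div, div_le_iff₀ hq] at h3
  linarith

/-- A large sieve inequality along an arithmetic progression, for frequencies whose order is
coprime to the common difference. -/
lemma sum_cauchyWeight_mul_norm_sq_le (hW : 0 < W) (hd : 0 < d) (hWd : W * d ≤ 1) (n : ℤ) {m₀ : ℤ}
    {P : Finset ℤ} (hP : ∀ m ∈ P, (d : ℤ) ∣ m - m₀) {B : Finset (ZMod M)}
    (hB : ∀ β ∈ B, addOrderOf β ≤ q ∧ (addOrderOf β).Coprime d) (b : ZMod M → ℂ) :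
    ∑ m ∈ P, cauchyWeight W n m * ‖∑ β ∈ B, b β * ZMod.stdAddChar (β * (m : ZMod M))‖ ^ 2
      ≤ (10 / (W * d) + 5 * (q * q) * B.card) * ∑ β ∈ B, ‖b β‖ ^ 2 := by
  have ht : 0 < W * d := by positivity
  set c : ℝ := (n - m₀) / d with hc
  set Φ : ZMod M → ℂ := fun γ =>
    fourierSum (fun j => (cauchyWeight (W * d) c j : ℂ)) (γ.val / M) with hΦ
  have hs := summable_cauchyWeight ht hWd c
  have hs1 : Summable fun j : ℤ => ‖(cauchyWeight (W * d) c j : ℂ)‖ := by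
    simpa only [Complex.norm_real, Real.norm_of_nonneg (cauchyWeight_pos _ _ _).le] using hs
  have hbd : ∀ m : ℤ, ‖∑ β ∈ B, b β * ZMod.stdAddChar (β * (m : ZMod M))‖ ^ 2
      ≤ (∑ β ∈ B, ‖b β‖) ^ 2 := by
    intro m
    refine pow_le_pow_left₀ (norm_nonneg _) ((norm_sum_le _ _).trans (le_of_eq ?_)) 2
    simp
  have hs2 : Summable fun j : ℤ => cauchyWeight W n (m₀ + d * j : ℤ)
      * ‖∑ β ∈ B, b β * ZMod.stdAddChar (β * ((m₀ + d * j : ℤ) : ZMod M))‖ ^ 2 := by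
    simp_rw [cauchyWeight_progression hd]
    exact Summable.of_nonneg_of_le (fun j => mul_nonneg (cauchyWeight_pos _ _ _).le (sq_nonneg _))
      (fun j => mul_le_mul_of_nonneg_left (hbd _) (cauchyWeight_pos _ _ _).le) (hs.mul_right _)
  refine (sum_le_tsum_progression hd hP (F := fun m => cauchyWeight W n m
    * ‖∑ β ∈ B, b β * ZMod.stdAddChar (β * (m : ZMod M))‖ ^ 2)
    (fun m => mul_nonneg (cauchyWeight_pos _ _ _).le (sq_nonneg _)) hs2).trans ?_
  have hexp : ((∑' j : ℤ, cauchyWeight W n (m₀ + d * j : ℤ)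
      * ‖∑ β ∈ B, b β * ZMod.stdAddChar (β * ((m₀ + d * j : ℤ) : ZMod M))‖ ^ 2 : ℝ) : ℂ)
      = ∑ β ∈ B, ∑ β' ∈ B, b β * (starRingEnd ℂ) (b β')
        * ZMod.stdAddChar ((β - β') * (m₀ : ZMod M)) * Φ (d * (β - β')) := by
    have hterm : ∀ β β' : ZMod M, ∀ j : ℤ, (cauchyWeight (W * d) c j : ℂ)
        * (b β * ZMod.stdAddChar (β * ((m₀ + d * j : ℤ) : ZMod M))
          * ((starRingEnd ℂ) (b β' * ZMod.stdAddChar (β' * ((m₀ + d * j : ℤ) : ZMod M)))))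
        = b β * (starRingEnd ℂ) (b β') * ZMod.stdAddChar ((β - β') * (m₀ : ZMod M))
          * ((cauchyWeight (W * d) c j : ℂ) * e2pi (j * ((d * (β - β') : ZMod M).val / M))) := by
      intro β β' j
      rw [map_mul (starRingEnd ℂ), ← AddChar.map_neg_eq_conj, ← stdAddChar_mul_intCast]
      have : (ZMod.stdAddChar (β * ((m₀ + d * j : ℤ) : ZMod M)) : ℂ)
          * ZMod.stdAddChar (-(β' * ((m₀ + d * j : ℤ) : ZMod M)))
          = ZMod.stdAddChar ((β - β') * (m₀ : ZMod M))
            * ZMod.stdAddChar ((d * (β - β') : ZMod M) * (j : ZMod M)) := by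
        rw [← AddChar.map_add_eq_mul, ← AddChar.map_add_eq_mul]
        congr 1
        push_cast
        ring
      linear_combination (cauchyWeight (W * d) c j : ℂ) * b β * (starRingEnd ℂ) (b β') * this
    rw [Complex.ofReal_tsum]
    simp_rw [cauchyWeight_progression hd]
    push_cast
    simp_rw [← Complex.mul_conj', map_sum, Finset.sum_mul_sum, Finset.mul_sum]
    have hs3 : ∀ β β' : ZMod M, Summable fun j : ℤ => (cauchyWeight (W * d) c j : ℂ)
        * (b β * ZMod.stdAddChar (β * ((m₀ + d * j : ℤ) : ZMod M))
          * ((starRingEnd ℂ) (b β' * ZMod.stdAddChar (β' * ((m₀ + d * j : ℤ) : ZMod M))))) := by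
      intro β β'
      simp_rw [hterm]
      exact (summable_mul_e2pi hs1 _).mul_left _
    have := Summable.tsum_finsetSum (s := B) fun β _ =>
      summable_sum (s := B) fun β' _ => hs3 β β'
    push_cast at this hterm hs3
    rw [this]
    refine Finset.sum_congr rfl fun β _ => ?_
    rw [Summable.tsum_finsetSum fun β' _ => hs3 β β']
    refine Finset.sum_congr rfl fun β' _ => ?_
    simp_rw [hterm]
    rw [tsum_mul_left]
    rfl
  have hΦ0 : ‖Φ 0‖ ≤ 10 / (W * d) := by
    refine (norm_fourierSum_le hs1 _).trans ?_
    simp_rw [Complex.norm_real, Real.norm_of_nonneg (cauchyWeight_pos _ _ _).le]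
    exact tsum_cauchyWeight_le ht hWd c
  have hΦ1 : ∀ β ∈ B, ∀ β' ∈ B, β ≠ β' → ‖Φ (d * (β - β'))‖ ≤ 5 * (q * q) := by
    intro β hβ β' hβ' hne
    have hdvd : addOrderOf (β - β') ∣ addOrderOf β * addOrderOf β' := by
      rw [sub_eq_add_neg]
      simpa using (AddCommute.all β (-β')).addOrderOf_add_dvd_mul_addOrderOf
    have hcop : (addOrderOf (β - β')).Coprime d :=
      Nat.Coprime.coprime_dvd_left hdvd (((hB β hβ).2).mul_left (hB β' hβ').2)
    have hord : addOrderOf ((d : ZMod M) * (β - β')) = addOrderOf (β - β') := by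
      rw [← nsmul_eq_mul]
      exact hcop.addOrderOf_nsmul
    refine norm_fourierSum_cauchyWeight_le_of_order ht hWd c ?_ ?_
    · intro h0
      rw [h0, addOrderOf_zero] at hord
      exact hne (sub_eq_zero.1 (AddMonoid.addOrderOf_eq_one_iff.1 hord.symm))
    · rw [hord]
      exact (Nat.le_of_dvd (Nat.mul_pos (addOrderOf_pos _) (addOrderOf_pos _)) hdvd).trans
        (Nat.mul_le_mul (hB β hβ).1 (hB β' hβ').1)
  have hX0 : 0 ≤ ∑' j : ℤ, cauchyWeight W n (m₀ + d * j : ℤ)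
      * ‖∑ β ∈ B, b β * ZMod.stdAddChar (β * ((m₀ + d * j : ℤ) : ZMod M))‖ ^ 2 :=
    tsum_nonneg fun j => mul_nonneg (cauchyWeight_pos _ _ _).le (sq_nonneg _)
  rw [← Real.norm_of_nonneg hX0, ← Complex.norm_real, hexp]
  have hK : ∀ β ∈ B, ∀ β' ∈ B, ‖b β * (starRingEnd ℂ) (b β')
        * ZMod.stdAddChar ((β - β') * (m₀ : ZMod M)) * Φ (d * (β - β'))‖
      ≤ (if β = β' then 10 / (W * d) * ‖b β‖ ^ 2 else 0) + 5 * (q * q) * (‖b β‖ * ‖b β'‖) := by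
    intro β hβ β' hβ'
    rw [norm_mul, norm_mul, norm_mul, RCLike.norm_conj, norm_stdAddChar, mul_one]
    split_ifs with h
    · subst h
      rw [sub_self, mul_zero]
      have : ‖b β‖ * ‖b β‖ * ‖Φ 0‖ ≤ ‖b β‖ * ‖b β‖ * (10 / (W * d)) :=
        mul_le_mul_of_nonneg_left hΦ0 (by positivity)
      have : 0 ≤ 5 * (q * q) * (‖b β‖ * ‖b β‖) := by positivity
      linarith
    · have : ‖b β‖ * ‖b β'‖ * ‖Φ (d * (β - β'))‖ ≤ ‖b β‖ * ‖b β'‖ * (5 * (q * q)) :=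
        mul_le_mul_of_nonneg_left (hΦ1 β hβ β' hβ' h) (by positivity)
      linarith
  calc _ ≤ ∑ β ∈ B, ∑ β' ∈ B, ((if β = β' then 10 / (W * d) * ‖b β‖ ^ 2 else 0)
        + 5 * (q * q) * (‖b β‖ * ‖b β'‖)) :=
        (norm_sum_le _ _).trans (Finset.sum_le_sum fun β hβ =>
          (norm_sum_le _ _).trans (Finset.sum_le_sum fun β' hβ' => hK β hβ β' hβ'))
    _ = 10 / (W * d) * ∑ β ∈ B, ‖b β‖ ^ 2 + 5 * (q * q) * (∑ β ∈ B, ‖b β‖) ^ 2 := by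
        simp_rw [Finset.sum_add_distrib]
        congr 1
        · rw [Finset.mul_sum]
          exact Finset.sum_congr rfl fun β hβ => by rw [Finset.sum_ite_eq, if_pos hβ]
        · rw [sq, Finset.sum_mul_sum, Finset.mul_sum]
          exact Finset.sum_congr rfl fun β _ => by rw [Finset.mul_sum]
    _ ≤ _ := by
        have := sq_sum_le_card_mul_sum_sq (s := B) (f := fun β => ‖b β‖)
        rw [add_mul, mul_assoc (5 * (q * q : ℝ))]
        gcongr

lemma sum_norm_sq_progression_le (hW : 0 < W) (hd : 0 < d) (hWd : W * d ≤ 1) (n : ℤ) {m₀ : ℤ}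
    {P : Finset ℤ} (hP : ∀ m ∈ P, (d : ℤ) ∣ m - m₀) {B : Finset (ZMod M)}
    (hB : ∀ β ∈ B, addOrderOf β ≤ q ∧ (addOrderOf β).Coprime d)
    (hWB : W * d * (q * q * B.card) ≤ 1) {a : ℝ} {g : ℤ → ℂ}
    (hg : ∀ m ∈ P, ‖g m‖ ≤ a * W * cauchyWeight W n m) :
    ∑ β ∈ B, ‖∑ m ∈ P, g m * ZMod.stdAddChar (β * (m : ZMod M))‖ ^ 2 ≤ (15 * a / d) ^ 2 := by
  have hd0 : (0 : ℝ) < d := by exact_mod_cast hd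
  have hE : 10 / (W * d) + 5 * (q * q) * B.card ≤ 15 / (W * d) := by
    have : (q * q * B.card : ℝ) ≤ 1 / (W * d) := by
      rw [le_div_iff₀ (by positivity)]; linarith
    have e : 15 / (W * d) = 10 / (W * d) + 5 * (1 / (W * d)) := by ring
    rw [e]
    linarith
  refine (sum_norm_sq_le_of_dual B P (v := fun m => cauchyWeight W n m)
    (fun m _ => (cauchyWeight_pos _ _ _).le) (by positivity)
    (sum_cauchyWeight_mul_norm_sq_le hW hd hWd n hP hB) hg).trans ?_
  calc _ ≤ (a * W) ^ 2 * (15 / (W * d)) * (15 / (W * d)) := by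
        gcongr
        · exact Finset.sum_nonneg fun m _ => (cauchyWeight_pos _ _ _).le
        · refine (sum_cauchyWeight_progression_le hW hd hWd n hP).trans ?_
          gcongr
          norm_num
    _ = _ := by field_simp

end Progression

lemma sqrt_sum_norm_add_sq_le {ι E : Type*} [SeminormedAddCommGroup E] (B : Finset ι)
    (a b : ι → E) : √(∑ i ∈ B, ‖a i + b i‖ ^ 2) ≤ √(∑ i ∈ B, ‖a i‖ ^ 2) + √(∑ i ∈ B, ‖b i‖ ^ 2) := by
  refine Real.sqrt_le_left (by positivity) |>.2 ?_
  have h1 := Real.sum_mul_le_sqrt_mul_sqrt B (fun i => ‖a i‖) (fun i => ‖b i‖)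
  have h2 : ∑ i ∈ B, ‖a i + b i‖ ^ 2
      ≤ ∑ i ∈ B, ‖a i‖ ^ 2 + 2 * ∑ i ∈ B, ‖a i‖ * ‖b i‖ + ∑ i ∈ B, ‖b i‖ ^ 2 := by
    rw [Finset.mul_sum, ← Finset.sum_add_distrib, ← Finset.sum_add_distrib]
    refine Finset.sum_le_sum fun i _ => ?_
    have := pow_le_pow_left₀ (norm_nonneg _) (norm_add_le (a i) (b i)) 2
    linarith
  have h3 : (√(∑ i ∈ B, ‖a i‖ ^ 2)) ^ 2 = ∑ i ∈ B, ‖a i‖ ^ 2 := Real.sq_sqrt (by positivity)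
  have h4 : (√(∑ i ∈ B, ‖b i‖ ^ 2)) ^ 2 = ∑ i ∈ B, ‖b i‖ ^ 2 := Real.sq_sqrt (by positivity)
  nlinarith

lemma sqrt_sum_norm_sum_sq_le {ι κ E : Type*} [SeminormedAddCommGroup E] (B : Finset ι)
    (D : Finset κ) (a : κ → ι → E) :
    √(∑ i ∈ B, ‖∑ k ∈ D, a k i‖ ^ 2) ≤ ∑ k ∈ D, √(∑ i ∈ B, ‖a k i‖ ^ 2) := by
  classical
  induction D using Finset.induction_on with
  | empty => simp
  | insert k D hk ih =>
    simp_rw [Finset.sum_insert hk]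
    exact (sqrt_sum_norm_add_sq_le _ _ _).trans (by gcongr)

section Frequencies

variable {M : ℕ} [NeZero M]

/-- The square function attached to the frequencies of order `u`, where the frequencies of order
coprime to `u` are combined in `ℓ²`. -/
noncomputable def orderSquare (F : ZMod M → ℂ) (u : ℕ) (x : ZMod M) : ℝ :=
  √(∑ β : ZMod M with (addOrderOf β).Coprime u,
    ‖∑ α : ZMod M with addOrderOf α = u, ZMod.stdAddChar (α * x) * F (α + β)‖ ^ 2)

lemma orderSquare_nonneg (F : ZMod M → ℂ) (u : ℕ) (x : ZMod M) : 0 ≤ orderSquare F u x :=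
  Real.sqrt_nonneg _

lemma orderSquare_sq (F : ZMod M → ℂ) (u : ℕ) (x : ZMod M) : orderSquare F u x ^ 2
    = ∑ β : ZMod M with (addOrderOf β).Coprime u,
      ‖∑ α : ZMod M with addOrderOf α = u, ZMod.stdAddChar (α * x) * F (α + β)‖ ^ 2 :=
  Real.sq_sqrt (Finset.sum_nonneg fun _ _ => by positivity)

lemma orderSquare_add_le (F F' : ZMod M → ℂ) (u : ℕ) (x : ZMod M) :
    orderSquare (fun γ => F γ + F' γ) u x ≤ orderSquare F u x + orderSquare F' u x := by
  unfold orderSquare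
  simp_rw [mul_add, Finset.sum_add_distrib]
  exact sqrt_sum_norm_add_sq_le _ _ _

lemma sum_norm_pow_le_sum_orderSquare {q r L : ℕ} {T : ℝ} (hNB : NoiseBound (ZMod M) r L)
    (hT : ∀ k ∈ Finset.Icc 1 q, (k.divisors.card : ℝ) ≤ T) {F : ZMod M → ℂ}
    (hF : ∀ γ, q < addOrderOf γ → F γ = 0) :
    ∑ x, ‖∑ γ, ZMod.stdAddChar (γ * x) * F γ‖ ^ (2 * r)
      ≤ T ^ (2 * (L * r)) * ∑ u ∈ M.divisors, ∑ x, orderSquare F u x ^ (2 * r) := by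
  have h := hNB ZMod.stdAddChar (ZMod.isPrimitive_stdAddChar M) Unit
    fun γ _ => ((addOrderOf γ).divisors.card : ℂ) ^ L * F γ
  have hc : ∀ γ : ZMod M, ((addOrderOf γ).divisors.card : ℂ) ≠ 0 := fun γ => by
    have : 0 < addOrderOf γ := addOrderOf_pos γ
    have : (addOrderOf γ).divisors.card ≠ 0 := by
      rw [Finset.card_ne_zero]; exact ⟨1, by simp [this.ne']⟩
    exact_mod_cast this
  have hcancel : ∀ γ : ZMod M, (divisorWeight L (addOrderOf γ) : ℂ)
      * (((addOrderOf γ).divisors.card : ℂ) ^ L * F γ) = F γ := fun γ => by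
    rw [divisorWeight]
    push_cast
    rw [inv_mul_cancel_left₀ (pow_ne_zero _ (hc γ))]
  simp only [Finset.univ_unique, Finset.sum_singleton, ZMod.card, hcancel] at h
  simp_rw [← pow_mul] at h
  refine h.trans ?_
  rw [Finset.mul_sum]
  refine Finset.sum_le_sum fun u hu => ?_
  rw [Finset.mul_sum]
  refine Finset.sum_le_sum fun x _ => ?_
  rw [pow_mul (orderSquare F u x), orderSquare_sq, show T ^ (2 * (L * r)) = (T ^ (2 * L)) ^ r by
    rw [← pow_mul]; ring_nf, ← mul_pow, Finset.mul_sum]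
  refine pow_le_pow_left₀ (Finset.sum_nonneg fun _ _ => by positivity)
    (Finset.sum_le_sum fun β hβ => ?_) r
  have hβ := (Finset.mem_filter.1 hβ).2
  have hord : ∀ α ∈ (Finset.univ.filter fun α : ZMod M => addOrderOf α = u),
      addOrderOf (α + β) = u * addOrderOf β := fun α hα => by
    have hα := (Finset.mem_filter.1 hα).2
    rw [(AddCommute.all α β).addOrderOf_add_eq_mul_addOrderOf_of_coprime
      (by rw [hα]; exact hβ.symm), hα]
  have h1 : ∑ α : ZMod M with addOrderOf α = u, ZMod.stdAddChar (α * x)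
        * (((addOrderOf (α + β)).divisors.card : ℂ) ^ L * F (α + β))
      = ((u * addOrderOf β).divisors.card : ℂ) ^ L
        * ∑ α : ZMod M with addOrderOf α = u, ZMod.stdAddChar (α * x) * F (α + β) := by
    rw [Finset.mul_sum]
    refine Finset.sum_congr rfl fun α hα => ?_
    rw [hord α hα]
    ring
  rw [h1]
  by_cases hq : q < u * addOrderOf β
  · rw [Finset.sum_eq_zero fun α hα => by rw [hF _ (by rw [hord α hα]; exact hq), mul_zero]]
    simp
  · have hu0 : 0 < u := Nat.pos_of_mem_divisors hu
    have h2 := hT _ (Finset.mem_Icc.2 ⟨Nat.mul_pos hu0 (addOrderOf_pos β), not_lt.1 hq⟩)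
    rw [norm_mul, mul_pow, norm_pow, Complex.norm_natCast, ← pow_mul, mul_comm L]
    gcongr

lemma sum_orderSquare_sq_le {q : ℕ} {T : ℝ}
    (hT : ∀ k ∈ Finset.Icc 1 q, (k.divisors.card : ℝ) ≤ T) {F : ZMod M → ℂ}
    (hF : ∀ γ, q < addOrderOf γ → F γ = 0) :
    ∑ u ∈ M.divisors, ∑ x, orderSquare F u x ^ 2
      ≤ T * ∑ x, ‖∑ γ, ZMod.stdAddChar (γ * x) * F γ‖ ^ 2 := by
  have hprim := ZMod.isPrimitive_stdAddChar M
  have h1 : ∀ u ∈ M.divisors, ∑ x, orderSquare F u x ^ 2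
      ≤ M * ∑ γ : ZMod M, if u ∈ (addOrderOf γ).divisors then ‖F γ‖ ^ 2 else 0 := by
    intro u hu
    simp_rw [orderSquare_sq]
    rw [Finset.sum_comm]
    simp_rw [sum_norm_sq_addChar_sum _ hprim, ZMod.card]
    rw [← Finset.mul_sum]
    refine mul_le_mul_of_nonneg_left ?_ (Nat.cast_nonneg _)
    rw [← Finset.sum_filter, ← Finset.sum_product']
    have hinj : Set.InjOn (fun z : ZMod M × ZMod M => z.2 + z.1)
        ↑((Finset.univ.filter fun β : ZMod M => (addOrderOf β).Coprime u) ×ˢ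
          (Finset.univ.filter fun α : ZMod M => addOrderOf α = u)) := by
      rintro ⟨β, α⟩ h ⟨β', α'⟩ h' heq
      simp only [Finset.coe_product, Finset.coe_filter, Finset.mem_univ, true_and, Set.mem_prod,
        Set.mem_ofPred_eq] at h h' heq
      have e1 : u • α = 0 := by rw [← h.2]; exact addOrderOf_nsmul_eq_zero α
      have e2 : u • α' = 0 := by rw [← h'.2]; exact addOrderOf_nsmul_eq_zero α'
      have e3 : β - β' = α' - α := by linear_combination heq
      have e4 : addOrderOf (β - β') ∣ u := by
        rw [e3]
        exact addOrderOf_dvd_of_nsmul_eq_zero (by rw [nsmul_sub, e1, e2, sub_zero])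
      have e5 : addOrderOf (β - β') ∣ addOrderOf β * addOrderOf β' := by
        rw [sub_eq_add_neg]
        simpa using (AddCommute.all β (-β')).addOrderOf_add_dvd_mul_addOrderOf
      have e6 : β - β' = 0 := AddMonoid.addOrderOf_eq_one_iff.1
        (Nat.eq_one_of_dvd_coprimes ((h.1.mul_left h'.1)) e5 e4)
      have e7 := sub_eq_zero.1 e6
      rw [e6] at e3
      rw [e7, sub_eq_zero.1 e3.symm]
    rw [← Finset.sum_image (f := fun γ => ‖F γ‖ ^ 2) hinj]
    refine Finset.sum_le_sum_of_subset_of_nonneg ?_ fun _ _ _ => by positivity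
    intro γ hγ
    obtain ⟨⟨β, α⟩, h, rfl⟩ := Finset.mem_image.1 hγ
    simp only [Finset.mem_product, Finset.mem_filter, Finset.mem_univ, true_and] at h ⊢
    rw [Nat.mem_divisors]
    refine ⟨?_, (addOrderOf_pos _).ne'⟩
    rw [(AddCommute.all α β).addOrderOf_add_eq_mul_addOrderOf_of_coprime
      (by rw [h.2]; exact h.1.symm), h.2]
    exact dvd_mul_right _ _
  refine (Finset.sum_le_sum h1).trans ?_
  rw [sum_norm_sq_addChar_sum _ hprim Finset.univ, ZMod.card, ← Finset.mul_sum, Finset.sum_comm,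
    mul_left_comm]
  refine mul_le_mul_of_nonneg_left ?_ (Nat.cast_nonneg _)
  rw [Finset.mul_sum]
  refine Finset.sum_le_sum fun γ _ => ?_
  rw [← Finset.sum_filter, Finset.sum_const, nsmul_eq_mul]
  by_cases hq : q < addOrderOf γ
  · simp [hF γ hq]
  · refine mul_le_mul_of_nonneg_right ?_ (by positivity)
    refine le_trans ?_ (hT _ (Finset.mem_Icc.2 ⟨addOrderOf_pos γ, not_lt.1 hq⟩))
    exact_mod_cast Finset.card_le_card fun u hu => (Finset.mem_filter.1 hu).2

open Classical in
lemma sum_stdAddChar_torsion (d : ℕ) (y : ZMod M) :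
    ∑ α : ZMod M with d • α = 0, ZMod.stdAddChar (α * y)
      = if ∀ α : ZMod M, d • α = 0 → α * y = 0 then
        ((Finset.univ.filter fun α : ZMod M => d • α = 0).card : ℂ) else 0 := by
  split_ifs with h
  · rw [Finset.sum_congr rfl fun α hα => by
      rw [h α (Finset.mem_filter.1 hα).2, AddChar.map_zero_eq_one]]
    simp
  · push Not at h
    obtain ⟨α₀, h0, hne⟩ := h
    have h1 : ∑ α : ZMod M with d • α = 0, ZMod.stdAddChar (α * y)
        = ZMod.stdAddChar (α₀ * y) * ∑ α : ZMod M with d • α = 0, ZMod.stdAddChar (α * y) := by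
      rw [Finset.mul_sum]
      refine Finset.sum_bij' (fun α _ => α - α₀) (fun α _ => α + α₀) ?_ ?_ ?_ ?_ ?_
      · intro α hα
        have := (Finset.mem_filter.1 hα).2
        simp [nsmul_sub, this, h0, -nsmul_eq_mul]
      · intro α hα
        have := (Finset.mem_filter.1 hα).2
        simp [this, h0, -nsmul_eq_mul]
      · intro α _; ring
      · intro α _; ring
      · intro α _
        rw [← AddChar.map_add_eq_mul]
        congr 1
        ring
    have h2 : (ZMod.stdAddChar (α₀ * y) : ℂ) ≠ 1 := by
      rw [← AddChar.map_zero_eq_one (ZMod.stdAddChar (N := M))]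
      exact fun h => hne (ZMod.injective_stdAddChar h)
    by_contra h3
    exact h2 (mul_right_cancel₀ h3 (by rw [one_mul]; exact h1.symm))

lemma sum_stdAddChar_order {u : ℕ} (hu : 0 < u) (y : ZMod M) :
    ∑ α : ZMod M with addOrderOf α = u, (ZMod.stdAddChar (α * y) : ℂ)
      = ∑ z ∈ u.divisorsAntidiagonal, (ArithmeticFunction.moebius z.1 : ℂ)
        * ∑ α : ZMod M with z.2 • α = 0, ZMod.stdAddChar (α * y) := by
  symm
  refine (ArithmeticFunction.sum_eq_iff_sum_mul_moebius_eq (R := ℂ)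
    (f := fun k => ∑ α : ZMod M with addOrderOf α = k, (ZMod.stdAddChar (α * y) : ℂ))
    (g := fun k => ∑ α : ZMod M with k • α = 0, (ZMod.stdAddChar (α * y) : ℂ))).1 ?_ u hu
  intro n hn
  rw [← Finset.sum_fiberwise_of_maps_to (s := Finset.univ.filter fun α : ZMod M => n • α = 0)
    (t := n.divisors) (g := addOrderOf)]
  · refine Finset.sum_congr rfl fun k hk => ?_
    refine Finset.sum_congr ?_ fun _ _ => rfl
    ext α
    simp only [Finset.mem_filter, Finset.mem_univ, true_and]
    refine ⟨fun h => ⟨?_, h⟩, fun h => h.2⟩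
    exact addOrderOf_dvd_iff_nsmul_eq_zero.1 (by rw [h]; exact Nat.dvd_of_mem_divisors hk)
  · intro α hα
    exact Nat.mem_divisors.2
      ⟨addOrderOf_dvd_of_nsmul_eq_zero (Finset.mem_filter.1 hα).2, hn.ne'⟩

lemma dvd_sub_of_torsion_mul_eq_zero {d : ℕ} (hd : d ∣ M) {x : ZMod M} {m m' : ℤ}
    (h : ∀ α : ZMod M, d • α = 0 → α * (x + (m : ZMod M)) = 0)
    (h' : ∀ α : ZMod M, d • α = 0 → α * (x + (m' : ZMod M)) = 0) : (d : ℤ) ∣ m - m' := by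
  obtain ⟨t, ht⟩ := hd
  have h0 : d • (t : ZMod M) = 0 := by
    rw [nsmul_eq_mul]
    exact_mod_cast (show ((d * t : ℕ) : ZMod M) = 0 by rw [← ht]; exact ZMod.natCast_self M)
  have h1 : ((t * (m - m') : ℤ) : ZMod M) = 0 := by
    push_cast
    linear_combination h t h0 - h' t h0
  rw [ZMod.intCast_zmod_eq_zero_iff_dvd, ht] at h1
  have ht0 : (t : ℤ) ≠ 0 := by
    rintro h
    have : t = 0 := by exact_mod_cast h
    exact NeZero.ne M (by rw [ht, this, mul_zero])
  push_cast at h1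
  rw [mul_comm] at h1
  exact Int.dvd_of_mul_dvd_mul_left ht0 h1

end Frequencies

section ArcPart

variable {M : ℕ} [NeZero M] {η : ℝ → ℝ} {W : ℝ} {q : ℕ}

lemma card_addOrderOf_le (q : ℕ) :
    (Finset.univ.filter fun γ : ZMod M => addOrderOf γ ≤ q).card ≤ q * q := by
  classical
  have h1 : (Finset.univ.filter fun γ : ZMod M => addOrderOf γ ≤ q)
      ⊆ (Finset.Icc 1 q).biUnion fun k => Finset.univ.filter fun γ : ZMod M => k • γ = 0 := by
    intro γ hγ
    refine Finset.mem_biUnion.2 ⟨addOrderOf γ,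
      Finset.mem_Icc.2 ⟨addOrderOf_pos γ, (Finset.mem_filter.1 hγ).2⟩, ?_⟩
    exact Finset.mem_filter.2 ⟨Finset.mem_univ _, addOrderOf_nsmul_eq_zero γ⟩
  refine (Finset.card_le_card h1).trans (Finset.card_biUnion_le.trans ?_)
  calc _ ≤ ∑ k ∈ Finset.Icc 1 q, q := Finset.sum_le_sum fun k hk =>
        (IsAddCyclic.card_nsmul_eq_zero_le (Finset.mem_Icc.1 hk).1).trans (Finset.mem_Icc.1 hk).2
    _ = q * q := by simp

/-- The frequency components, restricted to the frequencies of order at most `q`. -/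
noncomputable def arcPart (η : ℝ → ℝ) (W : ℝ) (q : ℕ) (f : ℤ → ℂ) (n : ℤ) (S : Finset ℤ)
    (γ : ZMod M) : ℂ :=
  if addOrderOf γ ≤ q then freqPart η W S f γ n else 0

lemma arcPart_eq_zero (f : ℤ → ℂ) (n : ℤ) (S : Finset ℤ) (γ : ZMod M) (h : q < addOrderOf γ) :
    arcPart η W q f n S γ = 0 := if_neg (not_le.2 h)

lemma arcPart_filter_add (f : ℤ → ℂ) (n : ℤ) (S : Finset ℤ) (P : ℤ → Prop) [DecidablePred P]
    (γ : ZMod M) : arcPart η W q f n S γ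
      = arcPart η W q f n (S.filter P) γ + arcPart η W q f n (S.filter fun m => ¬ P m) γ := by
  unfold arcPart freqPart
  split_ifs
  · rw [Finset.sum_filter_add_sum_filter_not]
  · simp

open Classical in
lemma sum_stdAddChar_mul_freqPart (f : ℤ → ℂ) (n : ℤ) (S : Finset ℤ) {u : ℕ} (hu : 0 < u)
    (x β : ZMod M) :
    ∑ α : ZMod M with addOrderOf α = u, ZMod.stdAddChar (α * x) * freqPart η W S f (α + β) n
      = ∑ z ∈ u.divisorsAntidiagonal,
        ∑ m ∈ S.filter fun m : ℤ => ∀ α : ZMod M, z.2 • α = 0 → α * (x + (m : ZMod M)) = 0,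
          ((ArithmeticFunction.moebius z.1 : ℂ)
            * ((Finset.univ.filter fun α : ZMod M => z.2 • α = 0).card : ℂ)
            * (dilatedCoeff η W (n - m) * f m)) * ZMod.stdAddChar (β * (m : ZMod M)) := by
  have h1 : ∀ m : ℤ, ∀ α : ZMod M, (ZMod.stdAddChar (α * x) : ℂ)
      * (dilatedCoeff η W (n - m) * (ZMod.stdAddChar ((α + β) * (m : ZMod M)) * f m))
      = dilatedCoeff η W (n - m) * f m * ZMod.stdAddChar (β * (m : ZMod M))
        * ZMod.stdAddChar (α * (x + (m : ZMod M))) := by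
    intro m α
    rw [add_mul, mul_add, AddChar.map_add_eq_mul, AddChar.map_add_eq_mul]
    ring
  simp_rw [freqPart, Finset.mul_sum]
  rw [Finset.sum_comm]
  simp_rw [h1, ← Finset.mul_sum, sum_stdAddChar_order hu, sum_stdAddChar_torsion, Finset.mul_sum]
  rw [Finset.sum_comm]
  refine Finset.sum_congr rfl fun z _ => ?_
  rw [Finset.sum_filter]
  refine Finset.sum_congr rfl fun m _ => ?_
  split_ifs
  · ring
  · simp

lemma orderSquare_arcPart_le {A a : ℝ} (hA : 0 < A)
    (hφ : ∀ k, ‖dilatedCoeff η W k‖ ≤ A * W / (1 + (W * k) ^ 2)) (hW : 0 < W)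
    (hWq : W * q * (q * q * (q * q)) ≤ 1) (f : ℤ → ℂ) (n : ℤ) (S : Finset ℤ) (ha : 0 ≤ a)
    (hf : ∀ m ∈ S, ‖f m‖ ≤ a) {u : ℕ} (hu : u ∈ M.divisors) (x : ZMod M) :
    orderSquare (arcPart η W q f n S) u x ≤ u.divisors.card * (15 * (A * a)) := by
  classical
  have hu0 : 0 < u := Nat.pos_of_mem_divisors hu
  set B : Finset (ZMod M) := Finset.univ.filter fun β : ZMod M =>
    (addOrderOf β).Coprime u ∧ u * addOrderOf β ≤ q with hB
  have h1 : orderSquare (arcPart η W q f n S) u x = √(∑ β ∈ B,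
      ‖∑ α : ZMod M with addOrderOf α = u,
        ZMod.stdAddChar (α * x) * freqPart η W S f (α + β) n‖ ^ 2) := by
    rw [orderSquare, hB, ← Finset.filter_filter, Finset.sum_filter (s := Finset.filter _ _)]
    congr 1
    refine Finset.sum_congr rfl fun β hβ => ?_
    have hβ := (Finset.mem_filter.1 hβ).2
    have hord : ∀ α ∈ (Finset.univ.filter fun α : ZMod M => addOrderOf α = u),
        addOrderOf (α + β) = u * addOrderOf β := fun α hα => by
      have hα := (Finset.mem_filter.1 hα).2
      rw [(AddCommute.all α β).addOrderOf_add_eq_mul_addOrderOf_of_coprime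
        (by rw [hα]; exact hβ.symm), hα]
    split_ifs with hq
    · congr 2
      refine Finset.sum_congr rfl fun α hα => ?_
      rw [arcPart, hord α hα, if_pos hq]
    · rw [Finset.sum_eq_zero fun α hα => by
        rw [arcPart, hord α hα, if_neg hq, mul_zero]]
      simp
  rw [h1]
  have hpos : 0 ≤ (u.divisors.card : ℝ) * (15 * (A * a)) := by positivity
  rcases B.eq_empty_or_nonempty with hBe | ⟨β₀, hβ₀⟩
  · rw [hBe]
    simpa using hpos
  have huq : u ≤ q := by
    have := ((Finset.mem_filter.1 hβ₀).2).2
    exact (Nat.le_mul_of_pos_right u (addOrderOf_pos β₀)).trans this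
  simp_rw [sum_stdAddChar_mul_freqPart f n S hu0 x]
  refine (sqrt_sum_norm_sum_sq_le _ _ _).trans ?_
  have hcard : (u.divisorsAntidiagonal.card : ℝ) = u.divisors.card := by
    rw [← Nat.map_div_right_divisors, Finset.card_map]
  rw [← hcard, ← nsmul_eq_mul]
  refine Finset.sum_le_card_nsmul _ _ _ fun z hz => ?_
  obtain ⟨hz1, -⟩ := Nat.mem_divisorsAntidiagonal.1 hz
  set d := z.2 with hd
  have hdu : d ∣ u := ⟨z.1, by rw [← hz1]; ring⟩
  have hd0 : 0 < d := Nat.pos_of_dvd_of_pos hdu hu0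
  have hdq : d ≤ q := (Nat.le_of_dvd hu0 hdu).trans huq
  have hdM : d ∣ M := hdu.trans (Nat.dvd_of_mem_divisors hu)
  have hdq' : (d : ℝ) ≤ q := by exact_mod_cast hdq
  have hq1 : (1 : ℝ) ≤ q := by exact_mod_cast (Nat.succ_le_of_lt hd0).trans hdq
  set P := S.filter fun m : ℤ => ∀ α : ZMod M, d • α = 0 → α * (x + (m : ZMod M)) = 0 with hP
  obtain ⟨m₀, hm₀⟩ : ∃ m₀ : ℤ, ∀ m ∈ P, (d : ℤ) ∣ m - m₀ := by
    rcases P.eq_empty_or_nonempty with he | ⟨m₀, hm₀⟩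
    · exact ⟨0, by simp [he]⟩
    · exact ⟨m₀, fun m hm => dvd_sub_of_torsion_mul_eq_zero hdM
        (Finset.mem_filter.1 hm).2 (Finset.mem_filter.1 hm₀).2⟩
  have hBB : ∀ β ∈ B, addOrderOf β ≤ q ∧ (addOrderOf β).Coprime d := fun β hβ => by
    have := (Finset.mem_filter.1 hβ).2
    exact ⟨(Nat.le_mul_of_pos_left _ hu0).trans this.2, Nat.Coprime.coprime_dvd_right hdu this.1⟩
  have hBc : (B.card : ℝ) ≤ q * q := by
    have : B.card ≤ q * q := (Finset.card_le_card fun β hβ =>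
      Finset.mem_filter.2 ⟨Finset.mem_univ _, (hBB β hβ).1⟩).trans (card_addOrderOf_le (M := M) q)
    exact_mod_cast this
  have hWd : W * d ≤ 1 := by
    calc W * d ≤ W * q := by gcongr
      _ ≤ W * q * (q * q * (q * q)) := le_mul_of_one_le_right (by positivity) (by
          have : (1 : ℝ) ≤ q * q := by nlinarith
          nlinarith)
      _ ≤ 1 := hWq
  have hWB : W * d * (q * q * B.card) ≤ 1 := by
    refine le_trans ?_ hWq
    gcongr
  refine Real.sqrt_le_left (by positivity) |>.2 ?_
  refine (sum_norm_sq_progression_le (M := M) (q := q) hW hd0 hWd n hm₀ hBB hWB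
    (a := d * (A * a)) (g := fun m => (ArithmeticFunction.moebius z.1 : ℂ)
      * ((Finset.univ.filter fun α : ZMod M => d • α = 0).card : ℂ)
      * (dilatedCoeff η W (n - m) * f m)) ?_).trans (le_of_eq ?_)
  · intro m hm
    have hmu : ‖(ArithmeticFunction.moebius z.1 : ℂ)‖ ≤ 1 := by
      rw [Complex.norm_intCast]
      exact_mod_cast ArithmeticFunction.abs_moebius_le_one
    have hk : ‖((Finset.univ.filter fun α : ZMod M => d • α = 0).card : ℂ)‖ ≤ d := by
      rw [Complex.norm_natCast]
      exact_mod_cast IsAddCyclic.card_nsmul_eq_zero_le (α := ZMod M) hd0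
    have hfm := hf m (Finset.mem_filter.1 hm).1
    have hc : ‖dilatedCoeff η W (n - m)‖ ≤ A * W * cauchyWeight W n m := by
      refine (hφ (n - m)).trans (le_of_eq ?_)
      rw [cauchyWeight, div_eq_mul_inv]
      congr 3
      push_cast
      ring
    rw [norm_mul, norm_mul, norm_mul]
    have := (cauchyWeight_pos W n m).le
    calc _ ≤ 1 * d * (A * W * cauchyWeight W n m * a) := by gcongr
      _ = _ := by ring
  · have : (d : ℝ) ≠ 0 := by exact_mod_cast hd0.ne'
    field_simp

lemma sum_stdAddChar_mul_arcPart (hη : IsCutoff η) (hW : 0 < W) (hW1 : W ≤ 1) {Q : ℝ}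
    (hM : ∀ k ∈ Finset.Icc 1 ⌊Q⌋₊, k ∣ M) (f : ℤ → ℂ) (n : ℤ) (S : Finset ℤ) :
    ∑ γ : ZMod M, ZMod.stdAddChar (γ * (-(n : ZMod M))) * arcPart η W ⌊Q⌋₊ f n S γ
      = finProj η Q W S f n := by
  rw [finProj_eq S f hη hW hW1 hM, Finset.sum_filter]
  refine Finset.sum_congr rfl fun γ _ => ?_
  unfold arcPart
  split_ifs <;> simp

lemma hasSum_arcPart (hη : IsCutoff η) (hW : 0 < W) (hW1 : W ≤ 1) {Q : ℝ}
    (hM : ∀ k ∈ Finset.Icc 1 ⌊Q⌋₊, k ∣ M) (f : ℤ → ℂ) (S : Finset ℤ) {r : ℕ} (hr : 1 ≤ r)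
    (hqW : (((⌊Q⌋₊ * ⌊Q⌋₊) ^ r : ℕ) : ℝ) * (r * W) ≤ 1) :
    (Summable fun n => ‖finProj η Q W S f n‖ ^ (2 * r)) ∧
      HasSum (fun n => ∑ x, ‖∑ γ : ZMod M, ZMod.stdAddChar (γ * x) * arcPart η W ⌊Q⌋₊ f n S γ‖
        ^ (2 * r)) (M * ∑' n, ‖finProj η Q W S f n‖ ^ (2 * r)) := by
  have h := hasSum_transference (M := M) (q := ⌊Q⌋₊) (r := r) (s := W / 2)
    (F := fun γ n => arcPart η W ⌊Q⌋₊ f n S γ) (fun γ => by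
      by_cases hγ : addOrderOf γ ≤ ⌊Q⌋₊
      · simpa only [arcPart, if_pos hγ] using bandLimited_freqPart S f hη hW γ
      · simp only [arcPart, if_neg hγ]
        exact BandLimited.zero _)
    (fun γ n hγ => arcPart_eq_zero f n S γ hγ) hr (by rw [add_halves]; exact hqW)
  simpa only [sum_stdAddChar_mul_arcPart hη hW hW1 hM] using h

end ArcPart

lemma tsum_prod_ofReal {ι : Type*} [Fintype ι] {g : ℤ × ι → ℝ} (hg : ∀ y, 0 ≤ g y) :
    ∑' y, ENNReal.ofReal (g y) = ∑' n, ENNReal.ofReal (∑ i, g (n, i)) := by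
  rw [ENNReal.tsum_prod']
  refine tsum_congr fun n => ?_
  rw [tsum_fintype, ENNReal.ofReal_sum_of_nonneg fun i _ => hg _]

section Interpolation

variable {M : ℕ} [NeZero M] {η : ℝ → ℝ} {W Q T A : ℝ}

lemma orderSquare_arcPart_le_mul {q : ℕ} {a : ℝ} (hA : 0 < A)
    (hφ : ∀ k, ‖dilatedCoeff η W k‖ ≤ A * W / (1 + (W * k) ^ 2)) (hW : 0 < W)
    (hWq : W * q * (q * q * (q * q)) ≤ 1)
    (hT0 : 0 ≤ T) (hT : ∀ k ∈ Finset.Icc 1 q, (k.divisors.card : ℝ) ≤ T)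
    (f : ℤ → ℂ) (n : ℤ) (S : Finset ℤ) (ha : 0 ≤ a)
    (hf : ∀ m ∈ S, ‖f m‖ ≤ a) {u : ℕ} (hu : u ∈ M.divisors) (x : ZMod M) :
    orderSquare (arcPart η W q f n S) u x ≤ T * (15 * (A * a)) := by
  have hu0 : 0 < u := Nat.pos_of_mem_divisors hu
  rcases le_or_gt u q with h | h
  · refine (orderSquare_arcPart_le hA hφ hW hWq f n S ha hf hu x).trans ?_
    have := hT u (Finset.mem_Icc.2 ⟨hu0, h⟩)
    gcongr
  · have h0 : orderSquare (arcPart η W q f n S) u x = 0 := by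
      rw [orderSquare, Finset.sum_eq_zero, Real.sqrt_zero]
      intro β hβ
      have hβ := (Finset.mem_filter.1 hβ).2
      rw [Finset.sum_eq_zero, norm_zero, zero_pow two_ne_zero]
      intro α hα
      have hα := (Finset.mem_filter.1 hα).2
      rw [arcPart_eq_zero, mul_zero]
      rw [(AddCommute.all α β).addOrderOf_add_eq_mul_addOrderOf_of_coprime
        (by rw [hα]; exact hβ.symm), hα]
      exact h.trans_le (Nat.le_mul_of_pos_right u (addOrderOf_pos β))
    rw [h0]
    positivity

lemma tsum_orderSquare_sq_le (hη : IsCutoff η) (hW : 0 < W) (hW1 : W ≤ 1)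
    (hM : ∀ k ∈ Finset.Icc 1 ⌊Q⌋₊, k ∣ M) (hWQ : W * (⌊Q⌋₊ * ⌊Q⌋₊) ≤ 1)
    (hT0 : 0 ≤ T) (hT : ∀ k ∈ Finset.Icc 1 ⌊Q⌋₊, (k.divisors.card : ℝ) ≤ T)
    (f : ℤ → ℂ) (S : Finset ℤ) :
    ∑' y : ℤ × (M.divisors × ZMod M),
        ENNReal.ofReal (orderSquare (arcPart η W ⌊Q⌋₊ f y.1 S) y.2.1 y.2.2 ^ 2)
      ≤ ENNReal.ofReal (T * (M * ∑ m ∈ S, ‖f m‖ ^ 2)) := by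
  rw [tsum_prod_ofReal fun y => by positivity]
  obtain ⟨-, h2⟩ := hasSum_arcPart (M := M) (r := 1) hη hW hW1 hM f S le_rfl (by
    push_cast; rw [pow_one, one_mul, mul_comm]; exact hWQ)
  simp only [mul_one] at h2
  have h3 := h2.mul_left T
  calc _ ≤ ∑' n, ENNReal.ofReal (T * ∑ x, ‖∑ γ : ZMod M,
          ZMod.stdAddChar (γ * x) * arcPart η W ⌊Q⌋₊ f n S γ‖ ^ 2) := by
        refine ENNReal.tsum_le_tsum fun n => ENNReal.ofReal_le_ofReal ?_
        rw [Fintype.sum_prod_type, Finset.sum_coe_sort M.divisors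
          fun u => ∑ x, orderSquare (arcPart η W ⌊Q⌋₊ f n S) u x ^ 2]
        exact sum_orderSquare_sq_le hT fun γ hγ => arcPart_eq_zero f n S γ hγ
    _ = ENNReal.ofReal (T * (M * ∑' n, ‖finProj η Q W S f n‖ ^ 2)) := by
        rw [← h3.tsum_eq, ENNReal.ofReal_tsum_of_nonneg (fun n => by positivity) h3.summable]
    _ ≤ _ := by
        refine ENNReal.ofReal_le_ofReal ?_
        have := tsum_norm_sq_finProj_le S f hη hW hW1 hWQ
        gcongr

lemma tsum_orderSquare_rpow_le (hη : IsCutoff η) (hA : 0 < A)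
    (hφ : ∀ k, ‖dilatedCoeff η W k‖ ≤ A * W / (1 + (W * k) ^ 2)) (hW : 0 < W) (hW1 : W ≤ 1)
    (hM : ∀ k ∈ Finset.Icc 1 ⌊Q⌋₊, k ∣ M) (hWQ : W * (⌊Q⌋₊ * ⌊Q⌋₊) ≤ 1)
    (hWq : W * ⌊Q⌋₊ * (⌊Q⌋₊ * ⌊Q⌋₊ * (⌊Q⌋₊ * ⌊Q⌋₊)) ≤ 1)
    (hT0 : 0 < T) (hT : ∀ k ∈ Finset.Icc 1 ⌊Q⌋₊, (k.divisors.card : ℝ) ≤ T)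
    {p : ℝ} (hp : 2 < p) (f : ℤ → ℂ) (S : Finset ℤ) :
    ∑' y : ℤ × (M.divisors × ZMod M),
        ENNReal.ofReal (orderSquare (arcPart η W ⌊Q⌋₊ f y.1 S) y.2.1 y.2.2 ^ p)
      ≤ ENNReal.ofReal (p * (4 * T * M * (30 * A * T) ^ (p - 2) / (p - 2)) *
        ∑ m ∈ S, ‖f m‖ ^ p) := by
  have h := tsum_rpow_le_of_distribution (Y := ℤ × (M.divisors × ZMod M))
    (g := fun y => orderSquare (arcPart η W ⌊Q⌋₊ f y.1 S) y.2.1 y.2.2)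
    (fun y => orderSquare_nonneg _ _ _) (p := p) (s := p + 1) (K₁ := 4 * T * M) (K₂ := 0)
    (c := 30 * A * T) hp (by linarith) (by positivity) le_rfl (by positivity) S
    (a := fun m => ‖f m‖) (fun m => norm_nonneg _) ?_
  · simpa only [zero_mul, zero_div, add_zero] using h
  intro l hl
  set S₁ := S.filter fun m => l < 30 * A * T * ‖f m‖ with hS₁
  set S₂ := S.filter fun m => ¬ l < 30 * A * T * ‖f m‖ with hS₂
  refine (tsum_indicator_le (e := 2) (h := fun y : ℤ × (M.divisors × ZMod M) =>
    2 * orderSquare (arcPart η W ⌊Q⌋₊ f y.1 S₁) y.2.1 y.2.2) hl two_pos ?_).trans ?_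
  · rintro ⟨n, u, x⟩ hy
    simp only at hy ⊢
    have h1 : orderSquare (arcPart η W ⌊Q⌋₊ f n S) u x
        ≤ orderSquare (arcPart η W ⌊Q⌋₊ f n S₁) u x
          + orderSquare (arcPart η W ⌊Q⌋₊ f n S₂) u x := by
      rw [show arcPart η W ⌊Q⌋₊ f n S = fun γ : ZMod M => arcPart η W ⌊Q⌋₊ f n S₁ γ
        + arcPart η W ⌊Q⌋₊ f n S₂ γ from funext fun γ => arcPart_filter_add f n S _ γ]
      exact orderSquare_add_le _ _ _ _
    have h2 := orderSquare_arcPart_le_mul (a := l / (30 * A * T)) hA hφ hW hWq hT0.le hT f n S₂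
      (by positivity) (fun m hm => by
        rw [le_div_iff₀ (by positivity), mul_comm]
        exact not_lt.1 (Finset.mem_filter.1 hm).2) u.2 x
    have h3 : T * (15 * (A * (l / (30 * A * T)))) = l / 2 := by
      field_simp
      norm_num
    linarith
  · have h4 : ∀ y : ℤ × (M.divisors × ZMod M),
        ENNReal.ofReal ((2 * orderSquare (arcPart η W ⌊Q⌋₊ f y.1 S₁) y.2.1 y.2.2) ^ (2 : ℝ))
        = ENNReal.ofReal 4
          * ENNReal.ofReal (orderSquare (arcPart η W ⌊Q⌋₊ f y.1 S₁) y.2.1 y.2.2 ^ 2) := by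
      intro y
      rw [← ENNReal.ofReal_mul (by norm_num), Real.rpow_two]
      congr 1
      ring
    simp_rw [h4]
    rw [ENNReal.tsum_mul_left]
    have h5 := tsum_orderSquare_sq_le (M := M) hη hW hW1 hM hWQ hT0.le hT f S₁
    calc _ ≤ ENNReal.ofReal (l ^ (-2 : ℝ)) * (ENNReal.ofReal 4
          * ENNReal.ofReal (T * (M * ∑ m ∈ S₁, ‖f m‖ ^ 2))) := by gcongr
      _ = _ := by
        rw [← ENNReal.ofReal_mul (by norm_num), ← ENNReal.ofReal_mul (by positivity)]
        congr 1
        simp only [Real.rpow_two, zero_mul, add_zero]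
        ring

lemma tsum_norm_pow_finProj_le (hη : IsCutoff η) (hA : 0 < A)
    (hφ : ∀ k, ‖dilatedCoeff η W k‖ ≤ A * W / (1 + (W * k) ^ 2)) (hW : 0 < W) (hW1 : W ≤ 1)
    (hM : ∀ k ∈ Finset.Icc 1 ⌊Q⌋₊, k ∣ M) (hWQ : W * (⌊Q⌋₊ * ⌊Q⌋₊) ≤ 1)
    (hWq : W * ⌊Q⌋₊ * (⌊Q⌋₊ * ⌊Q⌋₊ * (⌊Q⌋₊ * ⌊Q⌋₊)) ≤ 1)
    (hT0 : 0 < T) (hT : ∀ k ∈ Finset.Icc 1 ⌊Q⌋₊, (k.divisors.card : ℝ) ≤ T)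
    {s L : ℕ} (hNB : NoiseBound (ZMod M) (s + 2) L)
    (hqW : (((⌊Q⌋₊ * ⌊Q⌋₊) ^ (s + 2) : ℕ) : ℝ) * ((s + 2 : ℕ) * W) ≤ 1)
    (f : ℤ → ℂ) (S : Finset ℤ) :
    (Summable fun n => ‖finProj η Q W S f n‖ ^ (2 * (s + 2))) ∧
    ∑' n, ‖finProj η Q W S f n‖ ^ (2 * (s + 2))
      ≤ (2 * (s + 2)) * 4 * (30 * A) ^ (2 * s + 2) / (2 * s + 2)
        * T ^ (2 * (L * (s + 2)) + 2 * s + 3) * ∑ m ∈ S, ‖f m‖ ^ (2 * (s + 2)) := by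
  obtain ⟨h1, h2⟩ := hasSum_arcPart (M := M) (r := s + 2) hη hW hW1 hM f S (by lia) hqW
  refine ⟨h1, ?_⟩
  have hM0 : (0 : ℝ) < M := by exact_mod_cast NeZero.pos M
  have hp : (2 : ℝ) < (2 * (s + 2) : ℕ) := by
    push_cast
    have : (0 : ℝ) ≤ s := s.cast_nonneg
    linarith
  have h3 := tsum_orderSquare_rpow_le (M := M) hη hA hφ hW hW1 hM hWQ hWq hT0 hT hp f S
  simp only [Real.rpow_natCast] at h3
  rw [tsum_prod_ofReal fun y => pow_nonneg (orderSquare_nonneg _ _ _) _] at h3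
  have h4 : ENNReal.ofReal (M * ∑' n, ‖finProj η Q W S f n‖ ^ (2 * (s + 2)))
      ≤ ENNReal.ofReal (T ^ (2 * (L * (s + 2)))) * ∑' n, ENNReal.ofReal
        (∑ i : M.divisors × ZMod M,
          orderSquare (arcPart η W ⌊Q⌋₊ f n S) i.1 i.2 ^ (2 * (s + 2))) := by
    rw [← h2.tsum_eq, ENNReal.ofReal_tsum_of_nonneg (fun n => by positivity) h2.summable,
      ← ENNReal.tsum_mul_left]
    refine ENNReal.tsum_le_tsum fun n => ?_
    rw [← ENNReal.ofReal_mul (by positivity)]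
    refine ENNReal.ofReal_le_ofReal ?_
    rw [Fintype.sum_prod_type, Finset.sum_coe_sort M.divisors
      fun u => ∑ x, orderSquare (arcPart η W ⌊Q⌋₊ f n S) u x ^ (2 * (s + 2))]
    exact sum_norm_pow_le_sum_orderSquare hNB hT fun γ hγ => arcPart_eq_zero f n S γ hγ
  have h5 := h4.trans (mul_le_mul_right h3 _)
  rw [← ENNReal.ofReal_mul (by positivity), ENNReal.ofReal_le_ofReal_iff (by positivity)] at h5
  have h6 : ((2 * (s + 2) : ℕ) : ℝ) - 2 = (2 * s + 2 : ℕ) := by push_cast; ring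
  rw [h6, Real.rpow_natCast] at h5
  refine le_of_mul_le_mul_left (h5.trans (le_of_eq ?_)) hM0
  have h7 : (2 * (s : ℝ) + 2) ≠ 0 := by positivity
  push_cast
  rw [mul_pow (30 * A) T]
  field_simp
  ring

end Interpolation

/-- The divisor bound: the number of divisors of `n` is `O(n ^ ε)`. -/
lemma exists_card_divisors_le {ε : ℝ} (hε : 0 < ε) :
    ∃ C : ℝ, 1 ≤ C ∧ ∀ n : ℕ, 0 < n → (n.divisors.card : ℝ) ≤ C * (n : ℝ) ^ ε := by
  have hlog : 0 < Real.log 2 := Real.log_pos one_lt_two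
  set K : ℝ := 1 + 1 / (ε * Real.log 2) with hK
  have hK1 : 1 ≤ K := by rw [hK]; have : 0 < 1 / (ε * Real.log 2) := by positivity
                         linarith
  set P : ℕ := ⌈(2 : ℝ) ^ (1 / ε)⌉₊ with hP
  refine ⟨K ^ P, one_le_pow₀ hK1, fun n hn => ?_⟩
  have hprod : (n : ℝ) ^ ε = ∏ x ∈ n.primeFactors, ((x : ℝ) ^ ε) ^ n.factorization x := by
    conv_lhs => rw [← Nat.prod_factorization_pow_eq_self hn.ne']
    rw [Finsupp.prod, Nat.support_factorization]
    push_cast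
    rw [← Real.finsetProd_rpow _ _ fun i _ => by positivity]
    refine Finset.prod_congr rfl fun x _ => ?_
    rw [← Real.rpow_natCast, ← Real.rpow_mul (by positivity), ← Real.rpow_natCast,
      ← Real.rpow_mul (by positivity), mul_comm]
  have hfac : ∀ x ∈ n.primeFactors, ((n.factorization x + 1 : ℕ) : ℝ)
      ≤ (if x < P then K else 1) * ((x : ℝ) ^ ε) ^ n.factorization x := by
    intro x hx
    have hx2 : (2 : ℝ) ≤ x := by exact_mod_cast (Nat.prime_of_mem_primeFactors hx).two_le
    push_cast
    set a := n.factorization x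
    split_ifs with h
    · have h1 : (1 : ℝ) + ε * Real.log 2 * a ≤ ((x : ℝ) ^ ε) ^ a := by
        calc (1 : ℝ) + ε * Real.log 2 * a ≤ Real.exp (Real.log 2 * ε * a) := by
              have := Real.add_one_le_exp (Real.log 2 * ε * a)
              linarith
          _ = ((2 : ℝ) ^ ε) ^ a := by
              rw [Real.exp_mul, Real.rpow_natCast, Real.rpow_def_of_pos two_pos]
          _ ≤ _ := by gcongr
      have h2 : (a : ℝ) + 1 ≤ K * (1 + ε * Real.log 2 * a) := by
        have h3 : K * (ε * Real.log 2) = ε * Real.log 2 + 1 := by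
          rw [hK]; field_simp
        have h4 : K * (1 + ε * Real.log 2 * a) = K + (ε * Real.log 2 + 1) * a := by
          rw [← h3]; ring
        rw [h4]
        have : 0 ≤ ε * Real.log 2 * a := by positivity
        linarith
      exact h2.trans (by gcongr)
    · rw [one_mul]
      have h1 : (2 : ℝ) ≤ (x : ℝ) ^ ε := by
        have h3 : (2 : ℝ) ^ (1 / ε) ≤ x := (Nat.le_ceil _).trans (by exact_mod_cast not_lt.1 h)
        calc (2 : ℝ) = ((2 : ℝ) ^ (1 / ε)) ^ ε := by
              rw [← Real.rpow_mul two_pos.le, one_div_mul_cancel hε.ne', Real.rpow_one]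
          _ ≤ _ := by gcongr
      have h2 : a + 1 ≤ 2 ^ a := Nat.lt_two_pow_self
      calc (a : ℝ) + 1 ≤ 2 ^ a := by exact_mod_cast h2
        _ ≤ _ := by gcongr
  rw [Nat.card_divisors hn.ne', hprod]
  push_cast at hfac ⊢
  refine (Finset.prod_le_prod (fun _ _ => by positivity) hfac).trans ?_
  rw [Finset.prod_mul_distrib]
  refine mul_le_mul_of_nonneg_right ?_ (Finset.prod_nonneg fun _ _ => by positivity)
  rw [Finset.prod_ite, Finset.prod_const, Finset.prod_const_one, mul_one]
  refine pow_le_pow_right₀ hK1 ?_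
  calc _ ≤ (Finset.range P).card := Finset.card_le_card fun x hx =>
        Finset.mem_range.2 (Finset.mem_filter.1 hx).2
    _ = P := Finset.card_range P

lemma finProj_filter_add (η : ℝ → ℝ) (Q W : ℝ) (S : Finset ℤ) (P : ℤ → Prop) [DecidablePred P]
    (f : ℤ → ℂ) (n : ℤ) : finProj η Q W S f n
      = finProj η Q W (S.filter P) f n + finProj η Q W (S.filter fun m => ¬ P m) f n := by
  rw [finProj, finProj, finProj, Finset.sum_filter_add_sum_filter_not]

/-- The finite-section bound for exponents above `2`, given the bounds at `2` and at `2 * r`. -/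
lemma tsum_rpow_finProj_le_of_pow {η : ℝ → ℝ} {Q W : ℝ} {r : ℕ} {B p : ℝ} (hB : 0 ≤ B)
    (hp : 2 < p) (hpr : p < 2 * r)
    (h2 : ∀ (f : ℤ → ℂ) (S : Finset ℤ), (Summable fun n => ‖finProj η Q W S f n‖ ^ 2) ∧
      ∑' n, ‖finProj η Q W S f n‖ ^ 2 ≤ ∑ m ∈ S, ‖f m‖ ^ 2)
    (h2r : ∀ (f : ℤ → ℂ) (S : Finset ℤ), (Summable fun n => ‖finProj η Q W S f n‖ ^ (2 * r)) ∧
      ∑' n, ‖finProj η Q W S f n‖ ^ (2 * r) ≤ B * ∑ m ∈ S, ‖f m‖ ^ (2 * r))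
    (f : ℤ → ℂ) (S : Finset ℤ) :
    ∑' n, ENNReal.ofReal (‖finProj η Q W S f n‖ ^ p)
      ≤ ENNReal.ofReal (p * (4 / (p - 2) + 2 ^ (2 * r) * B / (2 * r - p))
        * ∑ m ∈ S, ‖f m‖ ^ p) := by
  have h := tsum_rpow_le_of_distribution (g := fun n => ‖finProj η Q W S f n‖)
    (fun n => norm_nonneg _) (p := p) (s := 2 * r) (K₁ := 4) (K₂ := 2 ^ (2 * r) * B)
    (c := 1) hp hpr (by norm_num) (by positivity) one_pos S
    (a := fun m => ‖f m‖) (fun m => norm_nonneg _) ?_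
  · simpa only [Real.one_rpow, mul_one] using h
  intro l hl
  set S₁ := S.filter fun m => l < 1 * ‖f m‖ with hS₁
  set S₂ := S.filter fun m => ¬ l < 1 * ‖f m‖ with hS₂
  have key : ∀ (k : ℕ) (K : ℝ) (R : Finset ℤ), 0 < k →
      (Summable fun n => ‖finProj η Q W R f n‖ ^ k) →
      ∑' n, ‖finProj η Q W R f n‖ ^ k ≤ K →
      ∑' n, (if l < 2 * ‖finProj η Q W R f n‖ then (1 : ℝ≥0∞) else 0)
        ≤ ENNReal.ofReal (l ^ (-(k : ℝ)) * (2 ^ k * K)) := by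
    intro k K R hk hs hK
    refine (tsum_indicator_le (e := k) (h := fun n => 2 * ‖finProj η Q W R f n‖) hl
      (by exact_mod_cast hk) fun n hn => hn.le).trans ?_
    rw [ENNReal.ofReal_mul (by positivity)]
    refine mul_le_mul_right ?_ _
    simp only [Real.rpow_natCast, mul_pow]
    rw [← ENNReal.ofReal_tsum_of_nonneg (fun n => by positivity) (hs.mul_left _), tsum_mul_left]
    exact ENNReal.ofReal_le_ofReal (by gcongr)
  have hr0 : 0 < r := by
    rcases Nat.eq_zero_or_pos r with h | h
    · rw [h] at hpr; norm_num at hpr; linarith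
    · exact h
  have k1 := key 2 _ S₁ two_pos (h2 f S₁).1 (h2 f S₁).2
  have k2 := key (2 * r) _ S₂ (by lia) (h2r f S₂).1 (h2r f S₂).2
  calc _ ≤ ∑' n, ((if l < 2 * ‖finProj η Q W S₁ f n‖ then (1 : ℝ≥0∞) else 0)
        + (if l < 2 * ‖finProj η Q W S₂ f n‖ then (1 : ℝ≥0∞) else 0)) := by
        refine ENNReal.tsum_le_tsum fun n => ?_
        by_cases hn : l < ‖finProj η Q W S f n‖
        · rw [if_pos hn]
          rw [finProj_filter_add η Q W S (fun m => l < 1 * ‖f m‖) f n] at hn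
          have h3 := norm_add_le (finProj η Q W S₁ f n) (finProj η Q W S₂ f n)
          rcases lt_or_ge l (2 * ‖finProj η Q W S₁ f n‖) with h4 | h4
          · rw [if_pos h4]; exact le_self_add
          · have h5 : l < 2 * ‖finProj η Q W S₂ f n‖ := by linarith
            rw [if_pos h5]; exact le_add_self
        · rw [if_neg hn]; exact zero_le
    _ ≤ _ := by
        rw [ENNReal.tsum_add]
        refine (add_le_add k1 k2).trans ?_
        rw [← ENNReal.ofReal_add (by positivity) (by positivity)]
        refine ENNReal.ofReal_le_ofReal (le_of_eq ?_)
        have e : ∀ x : ℝ, x ^ (2 * (r : ℝ)) = x ^ (2 * r) := fun x => by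
          rw [← Real.rpow_natCast]; push_cast; rfl
        simp only [e, Real.rpow_two]
        push_cast
        ring

lemma IsCutoff.exists_tsum_rpow_finProj_le {η : ℝ → ℝ} (hη : IsCutoff η) {p : ℝ} (hp : 2 ≤ p)
    {ρ : ℝ} (hρ : 0 < ρ) : ∃ C : ℝ, 0 < C ∧ ∃ E : ℕ, 0 < E ∧ ∀ Q W : ℝ, 1 ≤ Q → 0 < W →
      W * (E * Q ^ E) ≤ 1 → ∀ (f : ℤ → ℂ) (S : Finset ℤ),
        ∑' n, ENNReal.ofReal (‖finProj η Q W S f n‖ ^ p)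
          ≤ ENNReal.ofReal (C * Q ^ ρ * ∑ m ∈ S, ‖f m‖ ^ p) := by
  set s : ℕ := ⌈p⌉₊ with hs
  set r : ℕ := s + 2 with hr
  have hs1 : 2 ≤ s := by
    have : (2 : ℝ) ≤ s := hp.trans (Nat.le_ceil p)
    exact_mod_cast this
  obtain ⟨A, hA, hφ⟩ := hη.exists_norm_dilatedCoeff_le
  obtain ⟨L, hL⟩ := exists_divisorWeight_exponent s
  set K : ℕ := 2 * (L * (s + 2)) + 2 * s + 3 with hK
  have hK0 : (0 : ℝ) < K := by positivity
  obtain ⟨C₀, hC₀, hdiv⟩ := exists_card_divisors_le (ε := ρ / K) (by positivity)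
  set B₀ : ℝ := (2 * (s + 2)) * 4 * (30 * A) ^ (2 * s + 2) / (2 * s + 2) * C₀ ^ K with hB₀
  have hpr : p < 2 * r := by
    have := Nat.le_ceil p
    rw [hr]
    push_cast
    linarith
  have h2rp : 0 < 2 * (r : ℝ) - p := by linarith
  have hB₀0 : 0 < B₀ := by positivity
  set D : ℝ := 2 ^ (2 * r) * B₀ / (2 * r - p) with hD
  have hD0 : 0 < D := by positivity
  have hC1 : 0 ≤ p * (4 / (p - 2) + D) := by
    have : 0 ≤ p - 2 := by linarith
    positivity
  refine ⟨1 + p * (4 / (p - 2) + D), by linarith, 2 * r, by lia, fun Q W hQ hW hWE f S => ?_⟩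
  have hQρ : 1 ≤ Q ^ ρ := Real.one_le_rpow hQ hρ.le
  set q : ℕ := ⌊Q⌋₊ with hq
  have hqQ : (q : ℝ) ≤ Q := Nat.floor_le (by linarith)
  have hq1 : 1 ≤ q := Nat.one_le_floor_iff Q |>.2 hQ
  have hq1' : (1 : ℝ) ≤ q := by exact_mod_cast hq1
  have hr4 : 4 ≤ r := by lia
  have hr4' : (4 : ℝ) ≤ r := by exact_mod_cast hr4
  have hqE : W * (r * (q : ℝ) ^ (2 * r)) ≤ 1 := by
    refine le_trans ?_ hWE
    push_cast
    have : (q : ℝ) ^ (2 * r) ≤ Q ^ (2 * r) := by gcongr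
    gcongr
    linarith
  have hqk : ∀ k ≤ 2 * r, W * (q : ℝ) ^ k ≤ 1 := by
    intro k hk
    refine le_trans ?_ hqE
    have : (q : ℝ) ^ k ≤ q ^ (2 * r) := pow_le_pow_right₀ hq1' hk
    have h1 : (q : ℝ) ^ (2 * r) ≤ r * q ^ (2 * r) :=
      le_mul_of_one_le_left (by positivity) (by linarith)
    gcongr
    exact this.trans h1
  have hW1 : W ≤ 1 := by simpa using hqk 0 (by lia)
  have hWQ : W * (q * q) ≤ 1 := by
    have := hqk 2 (by lia)
    linarith
  have hWq : W * q * (q * q * (q * q)) ≤ 1 := by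
    have := hqk 5 (by lia)
    linarith
  have hqW : (((q * q) ^ (s + 2) : ℕ) : ℝ) * ((s + 2 : ℕ) * W) ≤ 1 := by
    refine le_trans (le_of_eq ?_) hqE
    push_cast [hr]
    ring
  have : NeZero q.factorial := ⟨q.factorial_ne_zero⟩
  have hM : ∀ k ∈ Finset.Icc 1 q, k ∣ q.factorial := fun k hk =>
    Nat.dvd_factorial (Finset.mem_Icc.1 hk).1 (Finset.mem_Icc.1 hk).2
  have h2 : ∀ (f : ℤ → ℂ) (S : Finset ℤ), (Summable fun n => ‖finProj η Q W S f n‖ ^ 2) ∧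
      ∑' n, ‖finProj η Q W S f n‖ ^ 2 ≤ ∑ m ∈ S, ‖f m‖ ^ 2 := fun f S => by
    refine ⟨?_, tsum_norm_sq_finProj_le S f hη hW hW1 hWQ⟩
    have := (hasSum_arcPart (M := q.factorial) (r := 1) hη hW hW1 hM f S le_rfl (by
      push_cast; rw [pow_one, one_mul, mul_comm]; exact hWQ)).1
    simpa only [mul_one] using this
  have hS0 : 0 ≤ ∑ m ∈ S, ‖f m‖ ^ p := by positivity
  rcases hp.eq_or_lt with hp2 | hp2
  · subst hp2
    simp only [Real.rpow_two] at hS0 ⊢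
    rw [← ENNReal.ofReal_tsum_of_nonneg (fun n => by positivity) (h2 f S).1]
    refine ENNReal.ofReal_le_ofReal ((h2 f S).2.trans (le_mul_of_one_le_left hS0 ?_))
    nlinarith
  set T : ℝ := C₀ * Q ^ (ρ / K) with hT
  have hT0 : 0 < T := by positivity
  have hTK : T ^ K = C₀ ^ K * Q ^ ρ := by
    rw [hT, mul_pow, ← Real.rpow_natCast (Q ^ _), ← Real.rpow_mul (by linarith),
      div_mul_cancel₀ _ hK0.ne']
  have hTdiv : ∀ k ∈ Finset.Icc 1 q, (k.divisors.card : ℝ) ≤ T := fun k hk => by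
    obtain ⟨hk1, hk2⟩ := Finset.mem_Icc.1 hk
    refine (hdiv k hk1).trans ?_
    have : (k : ℝ) ≤ Q := le_trans (by exact_mod_cast hk2) hqQ
    rw [hT]
    gcongr
  have h := tsum_rpow_finProj_le_of_pow (r := r) (B := B₀ * Q ^ ρ) (by positivity) hp2 hpr h2
    (fun f S => by
      have := tsum_norm_pow_finProj_le hη hA (hφ W hW) hW hW1 hM hWQ hWq hT0 hTdiv
        (noiseBound_zmod s L hL q.factorial) hqW f S
      refine ⟨this.1, this.2.trans (le_of_eq ?_)⟩
      rw [← hK, hTK, hB₀]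
      ring) f S
  refine h.trans (ENNReal.ofReal_le_ofReal (mul_le_mul_of_nonneg_right ?_ hS0))
  have e : 2 ^ (2 * r) * (B₀ * Q ^ ρ) / (2 * r - p) = D * Q ^ ρ := by rw [hD]; ring
  rw [e]
  have h3 : 0 ≤ p * (4 / (p - 2)) := by
    have : 0 < p - 2 := by linarith
    positivity
  nlinarith

lemma iwKernel_neg (η : ℝ → ℝ) (Q W : ℝ) (m : ℤ) :
    iwKernel η Q W (-m) = (starRingEnd ℂ) (iwKernel η Q W m) := by
  rw [iwKernel, iwKernel, ← integral_conj]
  refine integral_congr_ae (Eventually.of_forall fun ξ => ?_)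
  simp only
  rw [map_mul (starRingEnd ℂ), Complex.conj_ofReal, conj_e2pi]
  congr 2
  push_cast
  ring

lemma sum_finProj_mul (η : ℝ → ℝ) (Q W : ℝ) (f h : ℤ → ℂ) (S R : Finset ℤ) :
    ∑ n ∈ R, finProj η Q W S f n * h n
      = ∑ m ∈ S, f m * (starRingEnd ℂ) (finProj η Q W R (fun n => (starRingEnd ℂ) (h n)) m) := by
  simp_rw [finProj, Finset.sum_mul, map_sum, Finset.mul_sum]
  rw [Finset.sum_comm]
  refine Finset.sum_congr rfl fun m _ => Finset.sum_congr rfl fun n _ => ?_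
  rw [map_mul (starRingEnd ℂ), Complex.conj_conj, ← iwKernel_neg, neg_sub]
  ring

lemma le_rpow_sub_one_mul_of_le {p p' X a B : ℝ} (hpp : p.HolderConjugate p') (hX : 0 < X)
    (ha : 0 ≤ a) (hB : 0 ≤ B) (h : X ≤ a ^ (1 / p) * (B * X) ^ (1 / p')) :
    X ≤ B ^ (p - 1) * a := by
  have hp0 : 0 < p := hpp.pos
  have h6 : X ^ p ≤ a * (B * X) ^ (p - 1) := by
    have := Real.rpow_le_rpow hX.le h hp0.le
    rw [Real.mul_rpow (by positivity) (by positivity), ← Real.rpow_mul ha,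
      ← Real.rpow_mul (by positivity), one_div_mul_cancel hp0.ne', Real.rpow_one] at this
    refine this.trans (le_of_eq ?_)
    congr 2
    rw [one_div, ← hpp.one_sub_inv, sub_mul, one_mul, inv_mul_cancel₀ hp0.ne']
  have h7 : X ^ p = X * X ^ (p - 1) := by
    rw [Real.rpow_sub_one hX.ne']
    field_simp
  rw [h7, Real.mul_rpow hB hX.le] at h6
  have h8 : 0 < X ^ (p - 1) := by positivity
  refine le_of_mul_le_mul_right (h6.trans (le_of_eq ?_)) h8
  ring

/-- Duality: a finite-section bound at `p` follows from the one at the dual exponent. -/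
lemma sum_rpow_finProj_le_of_conj {η : ℝ → ℝ} {Q W p p' B : ℝ} (hpp : p.HolderConjugate p')
    (hB : 0 ≤ B)
    (h : ∀ (f : ℤ → ℂ) (S R : Finset ℤ),
      ∑ n ∈ R, ‖finProj η Q W S f n‖ ^ p' ≤ B * ∑ m ∈ S, ‖f m‖ ^ p')
    (f : ℤ → ℂ) (S R : Finset ℤ) :
    ∑ n ∈ R, ‖finProj η Q W S f n‖ ^ p ≤ B ^ (p - 1) * ∑ m ∈ S, ‖f m‖ ^ p := by
  set X : ℝ := ∑ n ∈ R, ‖finProj η Q W S f n‖ ^ p with hX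
  set a : ℝ := ∑ m ∈ S, ‖f m‖ ^ p with ha
  have hX0 : 0 ≤ X := by positivity
  have ha0 : 0 ≤ a := by positivity
  have hp1 : 1 < p := hpp.lt
  have hp0 : 0 < p := hpp.pos
  have hp'0 : 0 < p' := hpp.symm.pos
  rcases hX0.eq_or_lt with hX00 | hXpos
  · rw [← hX00]; positivity
  set g : ℤ → ℂ := fun n => (starRingEnd ℂ) (finProj η Q W S f n)
    * ((‖finProj η Q W S f n‖ ^ (p - 2) : ℝ) : ℂ) with hg
  have hgn : ∀ n, ‖g n‖ = ‖finProj η Q W S f n‖ ^ (p - 1) := fun n => by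
    rw [hg]
    simp only
    rw [norm_mul, RCLike.norm_conj, Complex.norm_real, Real.norm_of_nonneg (by positivity)]
    rcases (norm_nonneg (finProj η Q W S f n)).eq_or_lt with h0 | h0
    · rw [← h0, zero_mul, Real.zero_rpow (by linarith)]
    · rw [← Real.rpow_one_add' h0.le (by linarith)]
      congr 1
      ring
  have hgf : ∀ n, finProj η Q W S f n * g n = ((‖finProj η Q W S f n‖ ^ p : ℝ) : ℂ) := fun n => by
    rw [hg]
    simp only
    rw [← mul_assoc, Complex.mul_conj, Complex.normSq_eq_norm_sq, ← Complex.ofReal_mul]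
    congr 1
    rcases (norm_nonneg (finProj η Q W S f n)).eq_or_lt with h0 | h0
    · rw [← h0, Real.zero_rpow hp0.ne']
      simp
    · rw [← Real.rpow_natCast, ← Real.rpow_add h0]
      congr 1
      push_cast
      ring
  have h1 : X = ‖∑ n ∈ R, finProj η Q W S f n * g n‖ := by
    simp_rw [hgf]
    rw [← Complex.ofReal_sum, Complex.norm_real, Real.norm_of_nonneg hX0]
  have h2 : X ≤ ∑ m ∈ S, ‖f m‖ * ‖finProj η Q W R (fun n => (starRingEnd ℂ) (g n)) m‖ := by
    rw [h1, sum_finProj_mul]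
    refine (norm_sum_le _ _).trans (le_of_eq (Finset.sum_congr rfl fun m _ => ?_))
    rw [norm_mul, RCLike.norm_conj]
  have h3 := h2.trans (Real.inner_le_Lp_mul_Lq_of_nonneg S hpp (fun m _ => norm_nonneg _)
    (fun m _ => norm_nonneg _))
  have h4 : ∑ m ∈ S, ‖finProj η Q W R (fun n => (starRingEnd ℂ) (g n)) m‖ ^ p' ≤ B * X := by
    refine (h _ R S).trans (le_of_eq ?_)
    congr 1
    refine Finset.sum_congr rfl fun n _ => ?_
    rw [RCLike.norm_conj, hgn, ← Real.rpow_mul (norm_nonneg _), hpp.sub_one_mul_conj]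
  have h5 : X ≤ a ^ (1 / p) * (B * X) ^ (1 / p') := h3.trans (by gcongr)
  exact le_rpow_sub_one_mul_of_le hpp hXpos ha0 hB h5

lemma IsCutoff.exists_sum_rpow_finProj_le {η : ℝ → ℝ} (hη : IsCutoff η) {p : ℝ} (hp : 1 < p)
    {ρ : ℝ} (hρ : 0 < ρ) : ∃ C : ℝ, 0 < C ∧ ∃ E : ℕ, 0 < E ∧ ∀ Q W : ℝ, 1 ≤ Q → 0 < W →
      W * (E * Q ^ E) ≤ 1 → ∀ (f : ℤ → ℂ) (S R : Finset ℤ),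
        ∑ n ∈ R, ‖finProj η Q W S f n‖ ^ p ≤ C * Q ^ ρ * ∑ m ∈ S, ‖f m‖ ^ p := by
  have main : ∀ {p : ℝ}, 2 ≤ p → ∃ C : ℝ, 0 < C ∧ ∃ E : ℕ, 0 < E ∧ ∀ Q W : ℝ, 1 ≤ Q → 0 < W →
      W * (E * Q ^ E) ≤ 1 → ∀ (f : ℤ → ℂ) (S R : Finset ℤ),
        ∑ n ∈ R, ‖finProj η Q W S f n‖ ^ p ≤ C * Q ^ ρ * ∑ m ∈ S, ‖f m‖ ^ p := by
    intro p hp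
    obtain ⟨C, hC, E, hE, h⟩ := hη.exists_tsum_rpow_finProj_le hp hρ
    refine ⟨C, hC, E, hE, fun Q W hQ hW hWE f S R => ?_⟩
    have h1 := (ENNReal.sum_le_tsum R).trans (h Q W hQ hW hWE f S)
    rw [← ENNReal.ofReal_sum_of_nonneg fun n _ => by positivity] at h1
    exact (ENNReal.ofReal_le_ofReal_iff (by positivity)).1 h1
  rcases le_total 2 p with hp2 | hp2
  · exact main hp2
  · have hpp : p.HolderConjugate p.conjExponent := Real.HolderConjugate.conjExponent hp
    have hp' : 2 ≤ p.conjExponent := by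
      rw [Real.conjExponent, le_div_iff₀ (by linarith)]
      linarith
    obtain ⟨C, hC, E, hE, h⟩ := main hp'
    refine ⟨C ^ (p - 1), by positivity, E, hE, fun Q W hQ hW hWE f S R => ?_⟩
    refine (sum_rpow_finProj_le_of_conj hpp (by positivity) (h Q W hQ hW hWE) f S R).trans ?_
    rw [Real.mul_rpow hC.le (by positivity)]
    have h1 : (Q ^ ρ) ^ (p - 1) ≤ Q ^ ρ := by
      conv_rhs => rw [← Real.rpow_one (Q ^ ρ)]
      exact Real.rpow_le_rpow_of_exponent_le (Real.one_le_rpow hQ hρ.le) (by linarith)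
    gcongr

/-- Finite sections converge to the projection. -/
lemma tendsto_finProj {η : ℝ → ℝ} (hη : IsCutoff η) {Q W : ℝ} (hW : 0 < W) (hW1 : W ≤ 1)
    {f : ℤ → ℂ} {b : ℝ} (hf : ∀ m, ‖f m‖ ≤ b) (n : ℤ) :
    Tendsto (fun S => finProj η Q W S f n) atTop (nhds (iwProj η Q W f n)) := by
  have hs : Summable fun m => iwKernel η Q W (n - m) * f m := by
    have h1 := (Equiv.subLeft n).summable_iff.2 (summable_norm_iwKernel (Q := Q) hη hW hW1)
    refine Summable.of_norm_bounded (h1.mul_right b) fun m => ?_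
    rw [norm_mul]
    exact mul_le_mul_of_nonneg_left (hf m) (norm_nonneg _)
  have h2 : iwProj η Q W f n = ∑' m, iwKernel η Q W (n - m) * f m := by
    rw [iwProj, ← (Equiv.subLeft n).tsum_eq]
    refine tsum_congr fun m => ?_
    simp
  rw [h2]
  exact hs.hasSum

lemma lpNormZ_iwProj_le {η : ℝ → ℝ} (hη : IsCutoff η) {Q W p B : ℝ} (hp : 0 < p) (hB : 0 ≤ B)
    (hW : 0 < W) (hW1 : W ≤ 1)
    (h : ∀ (f : ℤ → ℂ) (S R : Finset ℤ),
      ∑ n ∈ R, ‖finProj η Q W S f n‖ ^ p ≤ B * ∑ m ∈ S, ‖f m‖ ^ p)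
    {f : ℤ → ℂ} {b : ℝ} (hf : ∀ m, ‖f m‖ ≤ b) :
    lpNormZ p (iwProj η Q W f) ≤ ENNReal.ofReal (B ^ (1 / p)) * lpNormZ p f := by
  have hof : ∀ z : ℂ, (‖z‖₊ : ℝ≥0∞) ^ p = ENNReal.ofReal (‖z‖ ^ p) := fun z => by
    rw [← ENNReal.ofReal_rpow_of_nonneg (norm_nonneg _) hp.le, ← enorm_eq_nnnorm,
      ofReal_norm]
  have key : ∑' n, (‖iwProj η Q W f n‖₊ : ℝ≥0∞) ^ p
      ≤ ENNReal.ofReal B * ∑' m, (‖f m‖₊ : ℝ≥0∞) ^ p := by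
    rw [ENNReal.tsum_eq_iSup_sum]
    refine iSup_le fun R => ?_
    have ht : Tendsto (fun S => ∑ n ∈ R, ENNReal.ofReal (‖finProj η Q W S f n‖ ^ p)) atTop
        (nhds (∑ n ∈ R, ENNReal.ofReal (‖iwProj η Q W f n‖ ^ p))) := by
      refine tendsto_finsetSum _ fun n _ => (ENNReal.continuous_ofReal.tendsto _).comp ?_
      exact ((Real.continuous_rpow_const hp.le).tendsto _).comp
        (tendsto_finProj hη hW hW1 hf n).norm
    simp_rw [hof]
    refine le_of_tendsto ht (Eventually.of_forall fun S => ?_)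
    rw [← ENNReal.ofReal_sum_of_nonneg fun n _ => by positivity]
    refine (ENNReal.ofReal_le_ofReal (h f S R)).trans ?_
    rw [ENNReal.ofReal_mul hB, ENNReal.ofReal_sum_of_nonneg fun n _ => by positivity]
    exact mul_le_mul_right (ENNReal.sum_le_tsum S) _
  rw [lpNormZ, lpNormZ, ← ENNReal.ofReal_rpow_of_nonneg hB (by positivity),
    ← ENNReal.mul_rpow_of_nonneg _ _ (by positivity)]
  exact ENNReal.rpow_le_rpow key (by positivity)

/-- **Ionescu–Wainger theorem for projections.**
Fix `d ∈ ℤ₊` and a smooth even `η : ℝ → [0,1]` with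
`1_{[-1/4,1/4]} ≤ η ≤ 1_{(-1/2,1/2)}`.  For every `p ∈ (1, ∞)`, all `C₁, C₂ > 0` and
every `ρ ∈ (0, 1)` there are `D_p > 0` and `C > 0` such that for all `δ ∈ (0, 1]` and
all integers `N > D_p δ^{-D_p}`, and every `f ∈ ℓ^p(ℤ) ∩ ℓ²(ℤ)`:
`‖ Π[≤ δ^{-C₁}, ≤ N^{-d} δ^{-C₂}] f ‖_{ℓ^p(ℤ)} ≤ C δ^{-C₁ρ} ‖f‖_{ℓ^p(ℤ)}`. -/
theorem ionescu_wainger_projections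
    (d : ℕ) (hd : 0 < d)
    (η : ℝ → ℝ) (hηsmooth : ContDiff ℝ (⊤ : ℕ∞) η) (hηeven : ∀ x : ℝ, η (-x) = η x)
    (hη01 : ∀ x : ℝ, η x ∈ Set.Icc (0 : ℝ) 1)
    (hη1 : ∀ x ∈ Set.Icc (-(1 / 4) : ℝ) (1 / 4), η x = 1)
    (hη0 : ∀ x : ℝ, x ∉ Set.Ioo (-(1 / 2) : ℝ) (1 / 2) → η x = 0)
    (p : ℝ) (hp : 1 < p) (C₁ C₂ : ℝ) (hC₁ : 0 < C₁) (hC₂ : 0 < C₂)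
    (ρ : ℝ) (hρ : ρ ∈ Set.Ioo (0 : ℝ) 1) :
    ∃ D : ℝ, 0 < D ∧ ∃ C : ℝ, 0 < C ∧
      ∀ δ : ℝ, δ ∈ Set.Ioc (0 : ℝ) 1 →
        ∀ N : ℕ, D * δ ^ (-D) < (N : ℝ) →
          ∀ f : ℤ → ℂ, Memℓp f (ENNReal.ofReal p) → Memℓp f 2 →
            lpNormZ p (iwProj η (δ ^ (-C₁)) ((N : ℝ) ^ (-(d : ℝ)) * δ ^ (-C₂)) f)
              ≤ ENNReal.ofReal (C * δ ^ (-(C₁ * ρ))) * lpNormZ p f := by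
  have hη : IsCutoff η := ⟨hηsmooth, hη01, hη0⟩
  have hp0 : 0 < p := by linarith
  obtain ⟨C, hC, E, hE, h⟩ := hη.exists_sum_rpow_finProj_le hp (ρ := p * ρ) (mul_pos hp0 hρ.1)
  have hE1 : (1 : ℝ) ≤ E := by exact_mod_cast hE
  refine ⟨E + C₂ + C₁ * E, by positivity, C ^ (1 / p), by positivity, ?_⟩
  rintro δ ⟨hδ0, hδ1⟩ N hN f - hf
  obtain ⟨b, hb⟩ := memℓp_infty_iff.1 (hf.of_exponent_ge le_top)
  replace hb : ∀ m, ‖f m‖ ≤ b := fun m => hb ⟨m, rfl⟩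
  set D : ℝ := E + C₂ + C₁ * E with hD
  have hD0 : 0 < D := by positivity
  have hNpos : (0 : ℝ) < N := lt_trans (by positivity) hN
  have hN1 : (1 : ℝ) ≤ N := by exact_mod_cast (by exact_mod_cast hNpos : 0 < N)
  set Q : ℝ := δ ^ (-C₁) with hQ
  set W : ℝ := (N : ℝ) ^ (-(d : ℝ)) * δ ^ (-C₂) with hW
  have hQ1 : 1 ≤ Q := Real.one_le_rpow_of_pos_of_le_one_of_nonpos hδ0 hδ1 (by linarith)
  have hW0 : 0 < W := by positivity
  have hQE : Q ^ E = δ ^ (-(C₁ * E)) := by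
    rw [hQ, ← Real.rpow_natCast, ← Real.rpow_mul hδ0.le, neg_mul]
  have hNd : (N : ℝ) ^ (-(d : ℝ)) ≤ (N : ℝ)⁻¹ := by
    rw [← Real.rpow_neg_one]
    have : (1 : ℝ) ≤ d := by exact_mod_cast hd
    exact Real.rpow_le_rpow_of_exponent_le hN1 (by linarith)
  have hWE : W * (E * Q ^ E) ≤ 1 := by
    have h1 : δ ^ (-C₂) * (E * Q ^ E) ≤ N := by
      refine le_trans ?_ hN.le
      calc δ ^ (-C₂) * (E * Q ^ E) = E * δ ^ (-C₂ + -(C₁ * E)) := by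
            rw [hQE, Real.rpow_add hδ0]; ring
        _ ≤ D * δ ^ (-D) := by
            refine mul_le_mul (by rw [hD]; nlinarith)
              (Real.rpow_le_rpow_of_exponent_ge hδ0 hδ1 (by rw [hD]; linarith))
              (by positivity) hD0.le
    calc W * (E * Q ^ E) = (N : ℝ) ^ (-(d : ℝ)) * (δ ^ (-C₂) * (E * Q ^ E)) := by rw [hW]; ring
      _ ≤ (N : ℝ)⁻¹ * N := by gcongr
      _ = 1 := inv_mul_cancel₀ hNpos.ne'
  have hW1 : W ≤ 1 := by
    refine le_trans (le_mul_of_one_le_right hW0.le ?_) hWE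
    have := one_le_pow₀ hQ1 (n := E)
    nlinarith
  refine (lpNormZ_iwProj_le hη hp0 (by positivity) hW0 hW1 (h Q W hQ1 hW0 hWE) hb).trans
    (le_of_eq ?_)
  congr 2
  rw [Real.mul_rpow hC.le (by positivity), hQ, ← Real.rpow_mul hδ0.le, ← Real.rpow_mul hδ0.le]
  congr 2
  field_simp
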